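/- Let (s_{0,0}, …, s_{0,m}) = N(σ_0, …, σ_m) be a Nikishin system and let Λ ⊂ ℤ₊^{m+1} be an infinite set of distinct multi-indices for which there exist constants c > 0 and κ < 1 with n_j ≥ |n|/(m+1) − c·|n|^κ for every n ∈ Λ and every j = 0, …, m. For each n ∈ Λ let Q_n be a type II polynomial with associated polynomials P_{n,k}. Then for each k = 0, …, m the rational functions P_{n,k}/Q_n converge to ŝ_{0,k} uniformly on every compact subset K of ℂ ∖ Co(supp σ_0) as n runs over Λ (for every ε > 0 there is N such that sup_{z∈K} |ŝ_{0,k}(z) − P_{n,k}(z)/Q_n(z)| < ε whenever n ∈ Λ and |n| ≥ N; note all zeros of Q_n lie in Co(supp σ_0), so Q_n ≠ 0 on K). Moreover, for every such compact K there exists δ_K < 1 with limsup_{n∈Λ} (sup_{z∈K} |ŝ_{0,k}(z) − P_{n,k}(z)/Q_n(z)|)^{1/(2|n|)} ≤ δ_K (the paper identifies δ_K = max{|φ_t(z)| : z ∈ K, t ∈ Co(supp σ_1) ∪ {∞}}, where φ_t maps (ℂ ∪ {∞}) ∖ Co(supp σ_0) conformally onto the unit disc with φ_t(t) = 0, φ_t'(t)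 > 0). -/

import Mathlib

open MeasureTheory Set Polynomial Filter

noncomputable section

/-- A signed Borel measure on `ℝ`, represented by a pair of (nonnegative) measures
(a "positive part" and a "negative part"). -/
structure SignedM where
  pos : MeasureTheory.Measure ℝ
  neg : MeasureTheory.Measure ℝ

namespace SignedM

/-- Integral of a complex-valued function against a signed measure. -/
def cintegral (s : SignedM) (f : ℝ → ℂ) : ℂ :=
  (∫ x, f x ∂s.pos) - ∫ x, f x ∂s.neg

/-- Integral of a real-valued function against a signed measure. -/
def rintegral (s : SignedM) (f : ℝ → ℝ) : ℝ :=
  (∫ x, f x ∂s.pos) - ∫ x, f x ∂s.neg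

/-- The Cauchy transform `ŝ(z) = ∫ ds(x)/(z - x)` at a complex point. -/
def cauchy (s : SignedM) (z : ℂ) : ℂ :=
  s.cintegral fun x => (z - (x : ℂ))⁻¹

/-- The Cauchy transform at a real point (real-valued). -/
def cauchyR (s : SignedM) (x : ℝ) : ℝ :=
  s.rintegral fun t => (x - t)⁻¹

/-- The total variation `|s|` (for the constant-sign representation used here). -/
def mass (s : SignedM) : ℝ :=
  (s.pos Set.univ).toReal + (s.neg Set.univ).toReal

/-- The (topological) support of a nonnegative measure. -/
def msupport (μ : MeasureTheory.Measure ℝ) : Set ℝ :=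
  {x | ∀ U : Set ℝ, IsOpen U → x ∈ U → μ U ≠ 0}

/-- The support of a signed measure. -/
def supp (s : SignedM) : Set ℝ := msupport s.pos ∪ msupport s.neg

/-- The signed measure `g·s` with (real, possibly sign-changing) density `g` w.r.t. `s`. -/
def withDensityR (s : SignedM) (g : ℝ → ℝ) : SignedM where
  pos := s.pos.withDensity (fun x => ENNReal.ofReal (g x)) +
    s.neg.withDensity (fun x => ENNReal.ofReal (-g x))
  neg := s.pos.withDensity (fun x => ENNReal.ofReal (-g x)) +
    s.neg.withDensity (fun x => ENNReal.ofReal (g x))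

/-- The product `⟨a, b⟩`: the measure with density `b̂` with respect to `a`. -/
def nik (a b : SignedM) : SignedM := a.withDensityR b.cauchyR

end SignedM

/-- `s ∈ M(Δ)`: a finite Borel measure with constant sign, whose support is compact and
consists of infinitely many points, `Δ` being the smallest closed interval containing it. -/
structure IsM (s : SignedM) (Δ : Set ℝ) : Prop where
  posFinite : MeasureTheory.IsFiniteMeasure s.pos
  negFinite : MeasureTheory.IsFiniteMeasure s.neg
  constSign : s.pos = 0 ∨ s.neg = 0
  compactSupp : IsCompact s.supp
  infiniteSupp : s.supp.Infinite
  hullEq : Δ = Set.Icc (sInf s.supp) (sSup s.supp)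

/-- A set of reals, viewed inside `ℂ`. -/
def cSet (Δ : Set ℝ) : Set ℂ := (fun x : ℝ => (x : ℂ)) '' Δ

/-- `τ` is the inverse measure of `s`: `1/ŝ(z) = z/|s| + b + τ̂(z)` on `ℂ ∖ Δ`. -/
def IsInverse (s τ : SignedM) (Δ : Set ℝ) : Prop :=
  ∃ b : ℝ, ∀ z : ℂ, z ∉ cSet Δ →
    (s.cauchy z)⁻¹ = z / (s.mass : ℂ) + (b : ℂ) + τ.cauchy z

/-- The iterated products `s_{j,k} = ⟨σ_j, σ_{j+1}, …, σ_k⟩` of a Nikishin system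
(`s_{j,k} = σ_j` when `j ≥ k`). -/
def nikSys (σ : ℕ → SignedM) : ℕ → ℕ → SignedM
  | j, k => if h : j < k then (σ j).nik (nikSys σ (j + 1) k) else σ j
  termination_by j k => k - j
  decreasing_by omega

/-- `Q` is a type II polynomial for the Nikishin system `N(σ₀, …, σ_m)` and the
multi-index `n`, with associated polynomials `P k`:  `Q ≠ 0`, `deg Q ≤ |n|` and
`Q·ŝ_{0,k} − P_k = O(1/z^{n_k+1})` as `z → ∞` for every `k ≤ m`. -/
def IsTypeII (σ : ℕ → SignedM) (m : ℕ) (n : ℕ → ℕ) (Q : Polynomial ℝ)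
    (P : ℕ → Polynomial ℝ) : Prop :=
  Q ≠ 0 ∧ Q.degree ≤ ((∑ j ∈ Finset.range (m + 1), n j : ℕ) : WithBot ℕ) ∧
  ∀ k ≤ m, ∃ C R : ℝ, ∀ z : ℂ, R ≤ ‖z‖ →
    ‖aeval z Q * (nikSys σ 0 k).cauchy z - aeval z (P k)‖ ≤ C / ‖z‖ ^ (n k + 1)

namespace NikAux

open scoped Topology InnerProductSpace CompactlySupported

/-- `τ` is a finite measure carried by `I` but by no finite set. -/
structure Conc (τ : Measure ℝ) (I : Set ℝ) : Prop where
  fin : IsFiniteMeasure τ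
  compl : τ Iᶜ = 0
  inf : ∀ F : Finset ℝ, τ ((F : Set ℝ)ᶜ) ≠ 0

/-- The Cauchy transform of `N dτ`. -/
def ct (τ : Measure ℝ) (N : ℝ → ℝ) (z : ℂ) : ℂ := ∫ t, (N t : ℂ) / (z - t) ∂τ

/-- The Cauchy transform of `N dτ` at real points. -/
def ctR (τ : Measure ℝ) (N : ℝ → ℝ) (x : ℝ) : ℝ := ∫ t, N t / (x - t) ∂τ

lemma ct_ofReal (τ : Measure ℝ) (N : ℝ → ℝ) (x : ℝ) : ct τ N x = ctR τ N x := by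
  unfold ct ctR
  rw [← integral_complex_ofReal]
  congr 1
  ext t
  push_cast
  rfl

lemma integrable_of_continuousOn {X E : Type*} [TopologicalSpace X] [MeasurableSpace X]
    [OpensMeasurableSpace X] [T2Space X] [TopologicalSpace.PseudoMetrizableSpace X]
    [NormedAddCommGroup E] {τ : Measure X} [IsFiniteMeasure τ] {I : Set X} (hI : IsCompact I)
    (h0 : τ Iᶜ = 0) {f : X → E} (hf : ContinuousOn f I) : Integrable f τ := by
  have h1 : IntegrableOn f I τ := hf.integrableOn_compact' hI hI.measurableSet
  have h2 : τ.restrict I = τ := Measure.restrict_eq_self_of_ae_mem (by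
    rw [ae_iff]; exact h0)
  rwa [IntegrableOn, h2] at h1

lemma ae_mem_of_compl {X : Type*} [MeasurableSpace X] {τ : Measure X} {I : Set X}
    (h0 : τ Iᶜ = 0) : ∀ᵐ t ∂τ, t ∈ I := by
  rw [ae_iff]; exact h0

lemma integral_congr_on {X E : Type*} [MeasurableSpace X] [NormedAddCommGroup E] [NormedSpace ℝ E]
    {τ : Measure X} {I : Set X} (h0 : τ Iᶜ = 0) {f g : X → E} (h : ∀ t ∈ I, f t = g t) :
    ∫ t, f t ∂τ = ∫ t, g t ∂τ :=
  integral_congr_ae ((ae_mem_of_compl h0).mono h)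

lemma integral_swap_on {E : Type*} [NormedAddCommGroup E] [NormedSpace ℝ E]
    {τ κ : Measure ℝ} [IsFiniteMeasure τ] [IsFiniteMeasure κ] {I J : Set ℝ}
    (hI : IsCompact I) (hJ : IsCompact J) (hτ : τ Iᶜ = 0) (hκ : κ Jᶜ = 0) {f : ℝ → ℝ → E}
    (hf : ContinuousOn (Function.uncurry f) (I ×ˢ J)) :
    ∫ t, ∫ w, f t w ∂κ ∂τ = ∫ w, ∫ t, f t w ∂τ ∂κ := by
  refine integral_integral_swap (integrable_of_continuousOn (hI.prod hJ) ?_ hf)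
  have h1 : (I ×ˢ J)ᶜ ⊆ (Iᶜ ×ˢ univ) ∪ (univ ×ˢ Jᶜ) := by
    rintro ⟨a, b⟩ h
    simp only [mem_compl_iff, mem_prod, not_and_or] at h
    rcases h with h | h <;> simp [h]
  refine measure_mono_null h1 (measure_union_null ?_ ?_) <;> simp [Measure.prod_prod, hτ, hκ]

lemma conc_ne_zero {τ : Measure ℝ} {I : Set ℝ} (h : Conc τ I) : τ ≠ 0 := by
  rintro rfl
  exact h.inf ∅ (by simp)

lemma integral_pos_on {τ : Measure ℝ} [IsFiniteMeasure τ] {I : Set ℝ} (hI : IsCompact I)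
    (h0 : τ Iᶜ = 0) (hne : τ ≠ 0) {f : ℝ → ℝ} (hf : ContinuousOn f I) (hpos : ∀ t ∈ I, 0 < f t) :
    0 < ∫ t, f t ∂τ := by
  have hae := ae_mem_of_compl h0
  rw [integral_pos_iff_support_of_nonneg_ae (hae.mono fun t ht => (hpos t ht).le)
    (integrable_of_continuousOn hI h0 hf)]
  rw [pos_iff_ne_zero]
  intro h
  apply hne
  rw [← Measure.measure_univ_eq_zero]
  have : (univ : Set ℝ) ⊆ Function.support f ∪ Iᶜ := by
    intro t _
    by_cases ht : t ∈ I
    · left; exact (hpos t ht).ne'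
    · right; exact ht
  exact measure_mono_null this (measure_union_null h h0)

lemma const_sign {a b : ℝ} {N : ℝ → ℝ} (hN : ContinuousOn N (Icc a b))
    (h0 : ∀ t ∈ Icc a b, N t ≠ 0) : (∀ t ∈ Icc a b, 0 < N t) ∨ (∀ t ∈ Icc a b, N t < 0) := by
  by_contra hcon
  push Not at hcon
  obtain ⟨⟨x, hx, hx0⟩, y, hy, hy0⟩ := hcon
  have := isPreconnected_Icc.intermediate_value hx hy hN
  obtain ⟨w, hw, hw0⟩ := this ⟨hx0, hy0⟩
  exact h0 w hw hw0

lemma integral_ne_zero_on {τ : Measure ℝ} {a b : ℝ} (h : Conc τ (Icc a b))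
    {f : ℝ → ℝ} (hf : ContinuousOn f (Icc a b)) (h0 : ∀ t ∈ Icc a b, f t ≠ 0) :
    ∫ t, f t ∂τ ≠ 0 := by
  have := h.fin
  rcases const_sign hf h0 with hp | hn
  · exact (integral_pos_on isCompact_Icc h.compl (conc_ne_zero h) hf hp).ne'
  · have := integral_pos_on isCompact_Icc h.compl (conc_ne_zero h) hf.neg
      (fun t ht => neg_pos.2 (hn t ht))
    simp only [Pi.neg_apply, integral_neg] at this
    linarith

lemma ofReal_notMem {x : ℝ} {I : Set ℝ} (hx : x ∉ I) : (x : ℂ) ∉ ((↑) : ℝ → ℂ) '' I := by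
  rintro ⟨y, hy, hxy⟩
  exact hx (by rwa [Complex.ofReal_injective hxy] at hy)

lemma im_notMem {z : ℂ} (hz : z.im ≠ 0) (I : Set ℝ) : z ∉ ((↑) : ℝ → ℂ) '' I := by
  rintro ⟨y, _, rfl⟩
  simp at hz

lemma sub_ne_of_notMem {z : ℂ} {I : Set ℝ} (hz : z ∉ ((↑) : ℝ → ℂ) '' I) {t : ℝ} (ht : t ∈ I) :
    z - t ≠ 0 := fun h => hz ⟨t, ht, (sub_eq_zero.1 h).symm⟩

lemma ct_integrand_cont {I : Set ℝ} {N : ℝ → ℝ} (hN : ContinuousOn N I) {z : ℂ}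
    (hz : z ∉ ((↑) : ℝ → ℂ) '' I) : ContinuousOn (fun t : ℝ => (N t : ℂ) / (z - t)) I := by
  refine ContinuousOn.div (Complex.continuous_ofReal.comp_continuousOn hN) (by fun_prop) ?_
  intro t ht
  exact sub_ne_of_notMem hz ht

lemma ct_integrable {τ : Measure ℝ} [IsFiniteMeasure τ] {I : Set ℝ} (hI : IsCompact I)
    (h0 : τ Iᶜ = 0) {N : ℝ → ℝ} (hN : ContinuousOn N I) {z : ℂ}
    (hz : z ∉ ((↑) : ℝ → ℂ) '' I) : Integrable (fun t : ℝ => (N t : ℂ) / (z - t)) τ :=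
  integrable_of_continuousOn hI h0 (ct_integrand_cont hN hz)

lemma ct_continuousAt {τ : Measure ℝ} [IsFiniteMeasure τ] {I : Set ℝ} (hI : IsCompact I)
    (h0 : τ Iᶜ = 0) {N : ℝ → ℝ} (hN : ContinuousOn N I) {z : ℂ}
    (hz : z ∉ ((↑) : ℝ → ℂ) '' I) : ContinuousAt (ct τ N) z := by
  have hcl : IsClosed (((↑) : ℝ → ℂ) '' I) := (hI.image Complex.continuous_ofReal).isClosed
  obtain ⟨r, hr, hball⟩ := Metric.isOpen_iff.1 hcl.isOpen_compl z hz
  have hNI : Integrable N τ := integrable_of_continuousOn hI h0 hN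
  refine continuousAt_of_dominated (bound := fun t => |N t| * (2 / r)) ?_ ?_ ?_ ?_
  · filter_upwards [hcl.isOpen_compl.mem_nhds hz] with w hw
    exact (ct_integrable hI h0 hN hw).aestronglyMeasurable
  · filter_upwards [Metric.ball_mem_nhds z (half_pos hr)] with w hw
    filter_upwards [ae_mem_of_compl h0] with t ht
    rw [norm_div, Complex.norm_real, Real.norm_eq_abs, div_eq_mul_inv]
    gcongr
    rw [show (2 / r) = (r / 2)⁻¹ by field_simp]
    refine inv_anti₀ (half_pos hr) ?_
    have h1 : r ≤ ‖z - t‖ := by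
      by_contra hlt
      push Not at hlt
      exact hball (by rw [Metric.mem_ball, dist_comm, dist_eq_norm]; exact hlt) ⟨t, ht, rfl⟩
    have h2 : ‖w - z‖ < r / 2 := by simpa [dist_eq_norm] using hw
    have h3 : ‖z - t‖ ≤ ‖w - t‖ + ‖w - z‖ := by
      rw [show z - t = (w - t) - (w - z) by ring]; exact norm_sub_le _ _
    linarith
  · exact hNI.abs.mul_const _
  · filter_upwards [ae_mem_of_compl h0] with t ht
    refine ContinuousAt.div continuousAt_const (by fun_prop) (sub_ne_of_notMem hz ht)

lemma ctR_continuousOn {τ : Measure ℝ} [IsFiniteMeasure τ] {I : Set ℝ} (hI : IsCompact I)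
    (h0 : τ Iᶜ = 0) {N : ℝ → ℝ} (hN : ContinuousOn N I) {S : Set ℝ} (hS : Disjoint S I) :
    ContinuousOn (ctR τ N) S := by
  intro x hx
  have hxI : x ∉ I := fun h => hS.le_bot ⟨hx, h⟩
  have h1 : ContinuousAt (fun y : ℝ => (ct τ N y).re) x :=
    Complex.continuous_re.continuousAt.comp
      (ContinuousAt.comp (f := fun y : ℝ => (y : ℂ)) (ct_continuousAt hI h0 hN (ofReal_notMem hxI))
        Complex.continuous_ofReal.continuousAt)
  refine ContinuousAt.continuousWithinAt (h1.congr (Eventually.of_forall fun y => ?_))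
  simp [ct_ofReal]

lemma norm_inv_I_sub (y t : ℝ) (hy : 0 < y) : ‖((y : ℂ) * Complex.I - t)⁻¹‖ ≤ y⁻¹ := by
  rw [norm_inv]
  refine inv_anti₀ hy ?_
  have := Complex.abs_im_le_norm ((y : ℂ) * Complex.I - t)
  simpa [abs_of_pos hy] using this

lemma ct_tendsto_zero {τ : Measure ℝ} {N : ℝ → ℝ} (hN : Integrable N τ) :
    Tendsto (fun y : ℝ => ct τ N (y * Complex.I)) atTop (𝓝 0) := by
  have hlim : Tendsto (fun y : ℝ => y⁻¹ * ∫ t, |N t| ∂τ) atTop (𝓝 0) := by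
    simpa using tendsto_inv_atTop_zero.mul_const (∫ t, |N t| ∂τ)
  refine squeeze_zero_norm' ?_ hlim
  filter_upwards [eventually_gt_atTop 0] with y hy
  unfold ct
  rw [← integral_const_mul]
  refine norm_integral_le_of_norm_le (hN.abs.const_mul _) (Eventually.of_forall fun t => ?_)
  rw [div_eq_mul_inv, norm_mul, Complex.norm_real, Real.norm_eq_abs, mul_comm]
  gcongr
  exact norm_inv_I_sub y t hy

lemma mul_ct_tendsto {τ : Measure ℝ} {N : ℝ → ℝ} (hN : Integrable N τ) :
    Tendsto (fun y : ℝ => (y * Complex.I) * ct τ N (y * Complex.I)) atTop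
      (𝓝 ((∫ t, N t ∂τ : ℝ) : ℂ)) := by
  unfold ct
  simp_rw [← integral_const_mul]
  rw [← integral_complex_ofReal]
  refine tendsto_integral_filter_of_dominated_convergence (fun t => |N t|) ?_ ?_ hN.abs ?_
  · refine Eventually.of_forall fun y => ?_
    exact aestronglyMeasurable_const.mul (hN.ofReal.aestronglyMeasurable.mul
      (Measurable.aestronglyMeasurable (by fun_prop)))
  · filter_upwards [eventually_gt_atTop 0] with y hy
    refine Eventually.of_forall fun t => ?_
    have := norm_inv_I_sub y t hy
    rw [div_eq_mul_inv, norm_mul, norm_mul, norm_mul, Complex.norm_I, Complex.norm_real,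
      Complex.norm_real, Real.norm_eq_abs, Real.norm_eq_abs, abs_of_pos hy, mul_one]
    calc y * (|N t| * ‖((y : ℂ) * Complex.I - t)⁻¹‖) ≤ y * (|N t| * y⁻¹) := by gcongr
      _ = |N t| := by field_simp
  · refine Eventually.of_forall fun t => ?_
    have h1 : Tendsto (fun y : ℝ => ((y : ℂ) * Complex.I - t)⁻¹) atTop (𝓝 0) := by
      refine squeeze_zero_norm' ?_ tendsto_inv_atTop_zero
      filter_upwards [eventually_gt_atTop 0] with y hy using norm_inv_I_sub y t hy
    have h2 : Tendsto (fun y : ℝ => (N t : ℂ) + N t * t * ((y : ℂ) * Complex.I - t)⁻¹) atTop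
        (𝓝 (N t : ℂ)) := by
      simpa using (h1.const_mul ((N t : ℂ) * t)).const_add (N t : ℂ)
    refine h2.congr' ?_
    filter_upwards [eventually_gt_atTop 0] with y hy
    have : (y : ℂ) * Complex.I - t ≠ 0 := by
      intro h
      have := congrArg Complex.im h
      simp at this
      exact hy.ne' this
    field_simp
    ring

lemma ct_im_ne_zero {τ : Measure ℝ} {a b : ℝ} (h : Conc τ (Icc a b)) {N : ℝ → ℝ}
    (hN : ContinuousOn N (Icc a b)) (h0 : ∀ t ∈ Icc a b, N t ≠ 0) {z : ℂ} (hz : 0 < z.im) :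
    (ct τ N z).im ≠ 0 := by
  have := h.fin
  have hzI := im_notMem hz.ne' (Icc a b)
  have hintg := ct_integrable isCompact_Icc h.compl hN hzI
  have h1 : (ct τ N z).im = ∫ t, ((N t : ℂ) / (z - t)).im ∂τ := by
    have := Complex.imCLM.integral_comp_comm hintg
    exact this.symm
  rw [h1]
  refine integral_ne_zero_on h (Complex.continuous_im.comp_continuousOn (ct_integrand_cont hN hzI)) ?_
  intro t ht
  have h3 := sub_ne_of_notMem hzI ht
  have h4 : Complex.normSq (z - t) ≠ 0 := by simpa using h3
  simp only [Complex.div_im, Complex.ofReal_im, Complex.ofReal_re, Complex.sub_im]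
  simp [h0 t ht, h4, hz.ne']

lemma ctR_ne_zero {τ : Measure ℝ} {a b : ℝ} (h : Conc τ (Icc a b)) {N : ℝ → ℝ}
    (hN : ContinuousOn N (Icc a b)) (h0 : ∀ t ∈ Icc a b, N t ≠ 0) {x : ℝ} (hx : x ∉ Icc a b) :
    ctR τ N x ≠ 0 := by
  have hne : ∀ t ∈ Icc a b, x - t ≠ 0 := by
    intro t ht h
    exact hx (by rwa [sub_eq_zero.1 h])
  refine integral_ne_zero_on h (hN.div (by fun_prop) hne) ?_
  intro t ht
  exact div_ne_zero (h0 t ht) (hne t ht)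

lemma ct_congr {τ : Measure ℝ} {I : Set ℝ} (h0 : τ Iᶜ = 0) {N M : ℝ → ℝ}
    (h : ∀ t ∈ I, N t = M t) (z : ℂ) : ct τ N z = ct τ M z :=
  integral_congr_on h0 fun t ht => by rw [h t ht]

/-- Two functions agreeing on the upper half plane and continuous at a real point agree there. -/
lemma eq_of_eq_upper {F G : ℂ → ℂ} {x : ℝ} (hF : ContinuousAt F x) (hG : ContinuousAt G x)
    (h : ∀ z : ℂ, 0 < z.im → F z = G z) : F x = G x := by
  have hcurve : Tendsto (fun y : ℝ => (x : ℂ) + y * Complex.I) (𝓝[>] 0) (𝓝 (x : ℂ)) := by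
    have : Continuous (fun y : ℝ => (x : ℂ) + y * Complex.I) := by fun_prop
    have h1 := (this.tendsto 0).mono_left (nhdsWithin_le_nhds (s := Ioi 0))
    simpa using h1
  refine tendsto_nhds_unique_of_eventuallyEq (hF.tendsto.comp hcurve) (hG.tendsto.comp hcurve) ?_
  filter_upwards [self_mem_nhdsWithin] with y hy
  exact h _ (by simpa using hy)

section

section spectral
variable {H : Type*} [NormedAddCommGroup H] [InnerProductSpace ℂ H] [CompleteSpace H]

lemma exists_spectral_measure (A : H →L[ℂ] H) (hA : IsSelfAdjoint A) (v : H) :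
    ∃ ν : Measure ℝ, IsFiniteMeasure ν ∧ ν (spectrum ℝ A)ᶜ = 0 ∧
      ∀ f : ℝ → ℝ, ContinuousOn f (spectrum ℝ A) →
        ⟪v, cfc f A v⟫_ℂ = ((∫ t, f t ∂ν : ℝ) : ℂ) := by
  have : CompactSpace (spectrum ℝ A) := isCompact_iff_compactSpace.1 (spectrum.isCompact A)
  let Φ := cfcHom (R := ℝ) hA
  let L : C_c(spectrum ℝ A, ℝ) →ₗ[ℝ] ℝ :=
    { toFun := fun f => (⟪v, Φ f.toContinuousMap v⟫_ℂ).re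
      map_add' := by
        intro f g
        have : (f + g).toContinuousMap = f.toContinuousMap + g.toContinuousMap := rfl
        rw [this, map_add]
        simp
      map_smul' := by
        intro r f
        have : (r • f).toContinuousMap = r • f.toContinuousMap := rfl
        rw [this, map_smul]
        simp [inner_smul_right_eq_smul] }
  have hL : ∀ f, 0 ≤ f → 0 ≤ L f := by
    intro f hf
    let g : C(spectrum ℝ A, ℝ) := ⟨fun x => Real.sqrt (f x), by fun_prop⟩
    have hg : f.toContinuousMap = star g * g := by
      ext x
      have := hf x
      simp [g]
      exact (Real.mul_self_sqrt (hf x)).symm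
    change 0 ≤ (⟪v, Φ f.toContinuousMap v⟫_ℂ).re
    rw [hg, map_mul, map_star]
    have : ⟪v, (star (Φ g) * Φ g) v⟫_ℂ = ⟪Φ g v, Φ g v⟫_ℂ := by
      rw [ContinuousLinearMap.star_eq_adjoint, mul_apply_eq_comp,
        ContinuousLinearMap.adjoint_inner_right]
    rw [this]
    exact inner_self_nonneg (𝕜 := ℂ)
  let Λ := PositiveLinearMap.mk₀ L hL
  let ν₀ := RealRMK.rieszMeasure Λ
  have hintg := RealRMK.integral_rieszMeasure Λ
  have hfin : IsFiniteMeasure ν₀ := inferInstance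
  refine ⟨ν₀.map Subtype.val, inferInstance, ?_, ?_⟩
  · rw [Measure.map_apply measurable_subtype_coe (spectrum.isCompact A).measurableSet.compl]
    convert measure_empty (μ := ν₀)
    ext x
    simp
  · intro f hf
    rw [cfc_apply f A hA hf]
    have h1 : ∫ t, f t ∂(ν₀.map Subtype.val) = ∫ t : spectrum ℝ A, f t ∂ν₀ :=
      (MeasurableEmbedding.subtype_coe (spectrum.isCompact A).measurableSet).integral_map f
    let F : C_c(spectrum ℝ A, ℝ) := CompactlySupportedContinuousMap.continuousMapEquiv
      ⟨_, hf.domRestrict⟩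
    have h2 := hintg F
    have h3 : (∫ t : spectrum ℝ A, f t ∂ν₀) = Λ F := h2
    rw [h1, h3]
    change _ = (((⟪v, Φ ⟨_, hf.domRestrict⟩ v⟫_ℂ).re : ℝ) : ℂ)
    have hsa : IsSelfAdjoint (Φ ⟨_, hf.domRestrict⟩) := by
      have h5 : IsSelfAdjoint (⟨_, hf.domRestrict⟩ : C(spectrum ℝ A, ℝ)) := IsSelfAdjoint.all _
      exact h5.map Φ
    have := hsa.isSymmetric
    have h4 : (starRingEnd ℂ) ⟪v, Φ ⟨_, hf.domRestrict⟩ v⟫_ℂ = ⟪v, Φ ⟨_, hf.domRestrict⟩ v⟫_ℂ := by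
      rw [inner_conj_symm]
      exact this v v
    exact (Complex.conj_eq_iff_re.1 h4).symm


lemma resolvent_inner {A : H →L[ℂ] H} (hA : IsSelfAdjoint A) {v : H} {ν : Measure ℝ}
    [IsFiniteMeasure ν] (hν0 : ν (spectrum ℝ A)ᶜ = 0)
    (hν : ∀ f : ℝ → ℝ, ContinuousOn f (spectrum ℝ A) →
        ⟪v, cfc f A v⟫_ℂ = ((∫ t, f t ∂ν : ℝ) : ℂ)) {z : ℂ} (hz : z.im ≠ 0) {S : H →L[ℂ] H}
    (hS : S * (algebraMap ℂ _ z - A) = 1) : ⟪v, S v⟫_ℂ = ct ν (fun _ => 1) z := by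
  let d : ℝ → ℝ := fun t => t ^ 2 - 2 * z.re * t + (z.re ^ 2 + z.im ^ 2)
  have hd : ∀ t, d t ≠ 0 := by
    intro t
    have : d t = (t - z.re) ^ 2 + z.im ^ 2 := by simp only [d]; ring
    rw [this]
    positivity
  have hdc : Continuous d := by fun_prop
  let f : ℝ → ℝ := fun t => (d t)⁻¹
  have hf : Continuous f := hdc.inv₀ hd
  have hcomp : IsCompact (spectrum ℝ A) := spectrum.isCompact A
  set R := cfc f A with hR
  set R1 := cfc (fun t => t * f t) A with hR1
  have e1 : A * R = R1 := by
    rw [hR1, cfc_mul (fun t => t) f A continuousOn_id hf.continuousOn, cfc_id' ℝ A]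
  have e2 : A * R1 = cfc (fun t => t * (t * f t)) A := by
    rw [hR1, cfc_mul (fun t => t) (fun t => t * f t) A continuousOn_id
      (continuous_id.mul hf).continuousOn, cfc_id' ℝ A]
  have e3 : A * R1 - (2 * z.re) • R1 + (z.re ^ 2 + z.im ^ 2) • R = 1 := by
    have c1 : Continuous fun t => t * (t * f t) := continuous_id.mul (continuous_id.mul hf)
    have c2 : Continuous fun t => t * f t := continuous_id.mul hf
    have c3 : Continuous fun t => (2 * z.re) • (t * f t) := continuous_const.mul c2
    have c4 : Continuous fun t => (z.re ^ 2 + z.im ^ 2) • f t := continuous_const.mul hf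
    have c5 : Continuous fun t => t * (t * f t) - (2 * z.re) • (t * f t) := c1.sub c3
    rw [e2, hR1, hR, ← cfc_smul (2 * z.re) (fun t => t * f t) A c2.continuousOn,
      ← cfc_smul (z.re ^ 2 + z.im ^ 2) f A hf.continuousOn,
      ← cfc_sub (fun t => t * (t * f t)) (fun t => (2 * z.re) • (t * f t)) A c1.continuousOn
        c3.continuousOn,
      ← cfc_add A (fun t => t * (t * f t) - (2 * z.re) • (t * f t))
        (fun t => (z.re ^ 2 + z.im ^ 2) • f t)
        c5.continuousOn c4.continuousOn]
    rw [← cfc_one ℝ A]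
    refine cfc_congr fun t _ => ?_
    simp only [smul_eq_mul, f, Pi.one_apply]
    have := hd t
    field_simp
    simp only [d]
    ring
  have e4 : (algebraMap ℂ (H →L[ℂ] H) z - A) * ((starRingEnd ℂ z) • R - R1) = 1 := by
    rw [← e3]
    have h1 : (2 * z.re) • R1 = (z + starRingEnd ℂ z) • R1 := by
      rw [Complex.add_conj]
      exact (Complex.coe_smul (2 * z.re) R1).symm
    have h2 : (z.re ^ 2 + z.im ^ 2) • R = (z * starRingEnd ℂ z) • R := by
      rw [Complex.mul_conj, Complex.normSq_apply, ← pow_two, ← pow_two]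
      exact (Complex.coe_smul (z.re ^ 2 + z.im ^ 2) R).symm
    rw [h1, h2, Algebra.algebraMap_eq_smul_one, sub_mul, mul_sub, mul_sub]
    simp only [smul_mul_assoc, one_mul, mul_smul_comm, e1]
    module
  have e5 : S = (starRingEnd ℂ z) • R - R1 := by
    calc S = S * ((algebraMap ℂ (H →L[ℂ] H) z - A) * ((starRingEnd ℂ z) • R - R1)) := by
          rw [e4, mul_one]
      _ = _ := by rw [← mul_assoc, hS, one_mul]
  have hin : ∀ g : ℝ → ℝ, Continuous g → Integrable g ν := fun g hg =>
    integrable_of_continuousOn hcomp hν0 hg.continuousOn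
  have hν1 := hν (fun t => t * f t) (continuous_id.mul hf).continuousOn
  rw [← hR1] at hν1
  rw [e5, sub_apply, smul_apply, inner_sub_right,
    inner_smul_right, hν f hf.continuousOn, hν1]
  unfold ct
  rw [← integral_complex_ofReal, ← integral_complex_ofReal, ← integral_const_mul,
    ← integral_sub ((hin f hf).ofReal.const_mul _) (hin _ (continuous_id.mul hf)).ofReal]
  congr 1
  ext t
  have hzt : z - t ≠ 0 := by
    intro h
    have := congrArg Complex.im h
    simp at this
    exact hz this
  have hdt : (d t : ℂ) = (z - t) * (starRingEnd ℂ z - t) := by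
    have : (d t : ℂ) = t ^ 2 - (z + starRingEnd ℂ z) * t + z * starRingEnd ℂ z := by
      rw [Complex.add_conj, Complex.mul_conj, Complex.normSq_apply]
      simp only [d]
      push_cast
      ring
    rw [this]; ring
  have hdt0 : (d t : ℂ) ≠ 0 := by exact_mod_cast hd t
  have h6 : starRingEnd ℂ z - t ≠ 0 := by
    intro h
    rw [hdt, h, mul_zero] at hdt0
    exact hdt0 rfl
  simp only [f]
  push_cast
  rw [hdt]
  field_simp
end spectral

lemma sherman_morrison {𝓐 : Type*} [Ring 𝓐] [Algebra ℂ 𝓐] {R U E : 𝓐} (h1 : R * U = 1)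
    (h2 : U * R = 1) {g b d : ℂ} (hE : E * R * E = g • E) (hd : b - d - d * b * g = 0) :
    (R - d • (R * E * R)) * (U + b • E) = 1 ∧ (U + b • E) * (R - d • (R * E * R)) = 1 := by
  constructor
  · have h3 : (R - d • (R * E * R)) * (U + b • E)
        = R * U + b • (R * E) - d • (R * E * (R * U)) - (d * b) • (R * (E * R * E)) := by
      simp only [sub_mul, mul_add, mul_smul_comm, smul_mul_assoc, mul_assoc]
      module
    rw [h3, h1, hE, mul_one, mul_smul_comm]
    have : (1 : 𝓐) + b • (R * E) - d • (R * E) - (d * b) • g • (R * E)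
        = 1 + (b - d - d * b * g) • (R * E) := by module
    rw [this, hd, zero_smul, add_zero]
  · have h3 : (U + b • E) * (R - d • (R * E * R))
        = U * R + b • (E * R) - d • ((U * R) * (E * R)) - (d * b) • ((E * R * E) * R) := by
      simp only [add_mul, mul_sub, mul_smul_comm, smul_mul_assoc, mul_assoc]
      module
    rw [h3, h2, hE, one_mul, smul_mul_assoc]
    have : (1 : 𝓐) + b • (E * R) - d • (E * R) - (d * b) • g • (E * R)
        = 1 + (b - d - d * b * g) • (E * R) := by module
    rw [this, hd, zero_smul, add_zero]

section rankone
variable {H : Type*} [NormedAddCommGroup H] [InnerProductSpace ℂ H] [CompleteSpace H]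

lemma rank_one_perturbation {K : Set ℝ} {X : H →L[ℂ] H} (hX : IsSelfAdjoint X) (u : H)
    {m : ℂ → ℂ} (hres : ∀ z : ℂ, z ∉ ((↑) : ℝ → ℂ) '' K → ∃ R : H →L[ℂ] H,
      R * (algebraMap ℂ _ z - X) = 1 ∧ (algebraMap ℂ _ z - X) * R = 1 ∧ ⟪u, R u⟫_ℂ = m z)
    {c : ℝ} (hc : c ≠ 0) (hG : ∀ x : ℝ, x ∉ K → c + m x ≠ 0) :
    ∃ ν : Measure ℝ, IsFiniteMeasure ν ∧ ν Kᶜ = 0 ∧ ∀ z : ℂ, z.im ≠ 0 →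
      (c : ℂ) + m z ≠ 0 →
      ((c : ℂ) + m z)⁻¹ = (c : ℂ)⁻¹ - ((c : ℂ) ^ 2)⁻¹ * ct ν (fun _ => 1) z := by
  obtain ⟨E, hE⟩ : ∃ E : H →L[ℂ] H, ∀ g, E g = ⟪u, g⟫_ℂ • u :=
    ⟨(innerSL ℂ u).smulRight u, fun g => rfl⟩
  have hEsa : IsSelfAdjoint E := by
    rw [ContinuousLinearMap.isSelfAdjoint_iff_isSymmetric]
    intro f g
    simp only [ContinuousLinearMap.coe_coe, hE]
    rw [inner_smul_left, inner_smul_right, inner_conj_symm]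
    ring
  obtain ⟨A, hAdef⟩ : ∃ A : H →L[ℂ] H, A = X - (c⁻¹ : ℝ) • E := ⟨_, rfl⟩
  have hA : IsSelfAdjoint A := by
    rw [hAdef]
    exact hX.sub ((IsSelfAdjoint.all (c⁻¹ : ℝ)).smul hEsa)
  have hcC : (c : ℂ) ≠ 0 := by exact_mod_cast hc
  have key : ∀ z : ℂ, z ∉ ((↑) : ℝ → ℂ) '' K → (c : ℂ) + m z ≠ 0 →
      ∃ S : H →L[ℂ] H, S * (algebraMap ℂ _ z - A) = 1 ∧
        (algebraMap ℂ _ z - A) * S = 1 ∧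
        ⟪u, S u⟫_ℂ = c - (c : ℂ) ^ 2 * ((c : ℂ) + m z)⁻¹ := by
    intro z hz hGz
    obtain ⟨R, hRX, hXR, hRu⟩ := hres z hz
    have hERE : E * R * E = m z • E := by
      ext1 f
      rw [smul_apply, mul_apply_eq_comp, mul_apply_eq_comp]
      rw [hE f, map_smul, map_smul, hE, hRu, smul_comm]
    have hU : algebraMap ℂ _ z - A = (algebraMap ℂ _ z - X) + (c : ℂ)⁻¹ • E := by
      have : (c⁻¹ : ℝ) • E = (c : ℂ)⁻¹ • E := by
        rw [← Complex.ofReal_inv]; exact (Complex.coe_smul _ E).symm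
      rw [hAdef, this]
      abel
    have hcoef : (c : ℂ)⁻¹ - ((c : ℂ) + m z)⁻¹ - ((c : ℂ) + m z)⁻¹ * (c : ℂ)⁻¹ * m z = 0 := by
      field_simp
      ring
    obtain ⟨hS1, hS2⟩ := sherman_morrison hRX hXR hERE hcoef
    refine ⟨R - ((c : ℂ) + m z)⁻¹ • (R * E * R), by rw [hU, hS1], by rw [hU, hS2], ?_⟩
    have : (R - ((c : ℂ) + m z)⁻¹ • (R * E * R)) u
        = R u - ((c : ℂ) + m z)⁻¹ • R (E (R u)) := by
      simp only [sub_apply, smul_apply, mul_apply_eq_comp]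
    rw [this, hE, hRu, map_smul, inner_sub_right, inner_smul_right, inner_smul_right, hRu]
    field_simp
    ring
  obtain ⟨ν, hνf, hν0, hν⟩ := exists_spectral_measure A hA u
  refine ⟨ν, hνf, ?_, ?_⟩
  · refine measure_mono_null (compl_subset_compl.2 ?_) hν0
    intro x hx
    by_contra hxK
    obtain ⟨S, h1, h2, -⟩ := key x (ofReal_notMem hxK) (hG x hxK)
    have hx' := spectrum.mem_iff.1 hx
    apply hx'
    have h3 : algebraMap ℝ (H →L[ℂ] H) x = algebraMap ℂ _ (x : ℂ) := by
      rw [Algebra.algebraMap_eq_smul_one, Algebra.algebraMap_eq_smul_one]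
      exact (Complex.coe_smul x _).symm
    rw [h3]
    exact isUnit_iff_exists.2 ⟨S, h2, h1⟩
  · intro z hz hGz
    obtain ⟨S, h1, h2, h3⟩ := key z (im_notMem hz K) hGz
    have h4 := resolvent_inner hA hν0 hν hz h1
    rw [← h4, h3]
    field_simp
    ring
end rankone

section mult
variable {μ : Measure ℝ} [IsFiniteMeasure μ]

lemma exists_mulOp {K : Set ℝ} (hK : IsCompact K) (h0 : μ Kᶜ = 0) {h : ℝ → ℂ}
    (hh : ContinuousOn h K) :
    ∃ M : Lp ℂ 2 μ →L[ℂ] Lp ℂ 2 μ, ∀ g, (M g : ℝ → ℂ) =ᵐ[μ] fun t => h t * g t := by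
  obtain ⟨C, hC⟩ := hK.exists_bound_of_continuousOn hh
  have hmem : MemLp h ⊤ μ := memLp_top_of_bound
    (integrable_of_continuousOn hK h0 hh).aestronglyMeasurable C
    ((ae_mem_of_compl h0).mono hC)
  let B : ℂ →L[ℂ] ℂ →L[ℂ] ℂ := ContinuousLinearMap.mul ℂ ℂ
  refine ⟨B.holderL μ ⊤ 2 2 (hmem.toLp h), fun g => ?_⟩
  have h1 := B.coeFn_holder (p := ⊤) (q := 2) (r := 2) (hmem.toLp h) g
  filter_upwards [h1, hmem.coeFn_toLp] with t h1 h2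
  change (B.holder 2 (hmem.toLp h) g) t = _
  rw [h1, h2]
  rfl

lemma mulOp_ext {ρ : Measure ℝ} {M M' : Lp ℂ 2 ρ →L[ℂ] Lp ℂ 2 ρ}
    (h : ∀ g, (M g : ℝ → ℂ) =ᵐ[ρ] M' g) : M = M' :=
  ContinuousLinearMap.ext fun g => Lp.ext (h g)

lemma inv_transform_of_ne {K : Set ℝ} (hK : IsCompact K) (h0 : μ Kᶜ = 0) {N : ℝ → ℝ} (hN : ContinuousOn N K)
    (hpos : ∀ t ∈ K, 0 ≤ N t) {c : ℝ} (hc : c ≠ 0)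
    (hG : ∀ x : ℝ, x ∉ K → c + ctR μ N x ≠ 0) :
    ∃ ν : Measure ℝ, IsFiniteMeasure ν ∧ ν Kᶜ = 0 ∧ ∀ z : ℂ, z.im ≠ 0 →
      (c : ℂ) + ct μ N z ≠ 0 →
      ((c : ℂ) + ct μ N z)⁻¹ = (c : ℂ)⁻¹ - ((c : ℂ) ^ 2)⁻¹ * ct ν (fun _ => 1) z := by
  obtain ⟨X, hX⟩ := exists_mulOp (μ := μ) hK h0 (h := fun t => (t : ℂ)) (by fun_prop)
  have hsq : ContinuousOn (fun t => ((Real.sqrt (N t) : ℝ) : ℂ)) K :=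
    Complex.continuous_ofReal.comp_continuousOn hN.sqrt
  obtain ⟨C, hC⟩ := hK.exists_bound_of_continuousOn hsq
  have h1mem : MemLp (fun t => ((Real.sqrt (N t) : ℝ) : ℂ)) 2 μ := MemLp.of_bound
    (integrable_of_continuousOn hK h0 hsq).aestronglyMeasurable C ((ae_mem_of_compl h0).mono hC)
  have hucoe : (h1mem.toLp _ : ℝ → ℂ) =ᵐ[μ] fun t => ((Real.sqrt (N t) : ℝ) : ℂ) :=
    h1mem.coeFn_toLp
  generalize h1mem.toLp _ = u at hucoe
  have hXsa : IsSelfAdjoint X := by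
    rw [ContinuousLinearMap.isSelfAdjoint_iff_isSymmetric]
    intro f g
    simp only [ContinuousLinearMap.coe_coe]
    rw [L2.inner_def, L2.inner_def]
    refine integral_congr_ae ?_
    filter_upwards [hX f, hX g] with t h1 h2
    rw [h1, h2]
    simp
    ring
  refine rank_one_perturbation hXsa u ?_ hc (fun x hx => ?_)
  · intro z hz
    obtain ⟨R, hR⟩ := exists_mulOp (μ := μ) hK h0 (h := fun t => (z - t)⁻¹)
      (ContinuousOn.inv₀ (by fun_prop) fun t ht => sub_ne_of_notMem hz ht)
    have hae := ae_mem_of_compl h0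
    have hRX : R * (algebraMap ℂ _ z - X) = 1 := by
      refine mulOp_ext fun f => ?_
      rw [mul_apply_eq_comp]
      filter_upwards [hR ((algebraMap ℂ (Lp ℂ 2 μ →L[ℂ] Lp ℂ 2 μ) z - X) f), hX f,
        Lp.coeFn_sub (z • f) (X f), Lp.coeFn_smul z f, hae] with t h1 h2 h3 h4 ht
      rw [h1]
      have : (algebraMap ℂ (Lp ℂ 2 μ →L[ℂ] Lp ℂ 2 μ) z - X) f = z • f - X f := rfl
      rw [this, h3]
      simp only [Pi.sub_apply, h4, Pi.smul_apply, h2, smul_eq_mul]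
      have := sub_ne_of_notMem hz ht
      change _ = f t
      field_simp
    have hXR : (algebraMap ℂ _ z - X) * R = 1 := by
      refine mulOp_ext fun f => ?_
      have : ((algebraMap ℂ (Lp ℂ 2 μ →L[ℂ] Lp ℂ 2 μ) z - X) * R) f = z • R f - X (R f) := rfl
      rw [this]
      filter_upwards [hR f, hX (R f),
        Lp.coeFn_sub (z • R f) (X (R f)), Lp.coeFn_smul z (R f), hae] with t h1 h2 h3 h4 ht
      rw [h3]
      simp only [Pi.sub_apply, h4, Pi.smul_apply, h2, h1, smul_eq_mul]
      have := sub_ne_of_notMem hz ht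
      change _ = f t
      field_simp
    have hRu : ⟪u, R u⟫_ℂ = ct μ N z := by
      rw [L2.inner_def, ct]
      refine integral_congr_ae ?_
      filter_upwards [hR u, hucoe, hae] with t h1 h2 ht
      rw [h1, h2]
      have : ((Real.sqrt (N t) : ℝ) : ℂ) * ((Real.sqrt (N t) : ℝ) : ℂ) = N t := by
        rw [← Complex.ofReal_mul, Real.mul_self_sqrt (hpos t ht)]
      simp only [RCLike.inner_apply, Complex.conj_ofReal]
      rw [mul_assoc, this, div_eq_mul_inv, mul_comm]
    exact ⟨R, hRX, hXR, hRu⟩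
  · rw [ct_ofReal]
    exact_mod_cast hG x hx
end mult

end

lemma mul_ct {τ : Measure ℝ} [IsFiniteMeasure τ] {I : Set ℝ} (hI : IsCompact I)
    (h0 : τ Iᶜ = 0) {N : ℝ → ℝ} (hN : ContinuousOn N I) {z : ℂ}
    (hz : z ∉ ((↑) : ℝ → ℂ) '' I) (x : ℝ) :
    (z - x) * ct τ N z = (∫ t, N t ∂τ : ℝ) + ct τ (fun t => (t - x) * N t) z := by
  unfold ct
  have hN' : ContinuousOn (fun t => (t - x) * N t) I := ContinuousOn.mul (by fun_prop) hN
  rw [← integral_complex_ofReal, ← integral_const_mul]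
  refine Eq.trans ?_
    (integral_add (integrable_of_continuousOn hI h0 hN).ofReal (ct_integrable hI h0 hN' hz))
  refine integral_congr_on h0 fun t ht => ?_
  have := sub_ne_of_notMem hz ht
  push_cast
  field_simp
  ring

lemma ct_const_mul (τ : Measure ℝ) (N : ℝ → ℝ) (a : ℝ) (z : ℂ) :
    ct τ (fun t => a * N t) z = a * ct τ N z := by
  unfold ct
  rw [← integral_const_mul]
  congr 1
  ext t
  push_cast
  ring

lemma ct_neg (τ : Measure ℝ) (N : ℝ → ℝ) (z : ℂ) :
    ct τ (fun t => -N t) z = -ct τ N z := by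
  simpa using ct_const_mul τ N (-1) z

lemma ct_add {τ : Measure ℝ} [IsFiniteMeasure τ] {I : Set ℝ} (hI : IsCompact I)
    (h0 : τ Iᶜ = 0) {N M : ℝ → ℝ} (hN : ContinuousOn N I) (hM : ContinuousOn M I) {z : ℂ}
    (hz : z ∉ ((↑) : ℝ → ℂ) '' I) :
    ct τ (fun t => N t + M t) z = ct τ N z + ct τ M z := by
  unfold ct
  rw [← integral_add (ct_integrable hI h0 hN hz) (ct_integrable hI h0 hM hz)]
  congr 1
  ext t
  push_cast
  ring

lemma poly_mul_ct {τ : Measure ℝ} [IsFiniteMeasure τ] {I : Set ℝ} (hI : IsCompact I)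
    (h0 : τ Iᶜ = 0) {N : ℝ → ℝ} (hN : ContinuousOn N I) (p : ℝ[X]) :
    ∃ r : ℝ[X], ∀ z : ℂ, z ∉ ((↑) : ℝ → ℂ) '' I →
      aeval z p * ct τ N z = aeval z r + ct τ (fun t => p.eval t * N t) z := by
  induction p using Polynomial.induction_on with
  | C a => exact ⟨0, fun z hz => by simp [ct_const_mul]⟩
  | add p q hp hq =>
    obtain ⟨r, hr⟩ := hp
    obtain ⟨s, hs⟩ := hq
    refine ⟨r + s, fun z hz => ?_⟩
    have := ct_add hI h0 (N := fun t => p.eval t * N t) (M := fun t => q.eval t * N t)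
      (p.continuous.continuousOn.mul hN) (q.continuous.continuousOn.mul hN) hz
    simp only [eval_add, add_mul, map_add] at this ⊢
    rw [hr z hz, hs z hz, this]
    ring
  | monomial n a h =>
    obtain ⟨r, hr⟩ := h
    refine ⟨X * r + C (∫ t, (C a * X ^ n : ℝ[X]).eval t * N t ∂τ), fun z hz => ?_⟩
    have h1 := mul_ct hI h0 (N := fun t => (C a * X ^ n : ℝ[X]).eval t * N t)
      ((Polynomial.continuous _).continuousOn.mul hN) hz 0
    have h2 := hr z hz
    rw [pow_succ, ← mul_assoc, map_mul, aeval_X, mul_right_comm, h2]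
    have h3 : (fun t => (C a * X ^ n * X : ℝ[X]).eval t * N t) =
        fun t => (t - 0) * ((C a * X ^ n : ℝ[X]).eval t * N t) := by
      ext t
      rw [eval_mul, eval_X]
      ring
    rw [h3, add_mul, mul_comm (ct _ _ _) z]
    simp only [Complex.ofReal_zero, sub_zero] at h1 ⊢
    rw [h1]
    simp only [map_add, map_mul, aeval_X, aeval_C, Complex.coe_algebraMap]
    ring

lemma norm_mul_I_tendsto : Tendsto (fun y : ℝ => ‖(y : ℂ) * Complex.I‖) atTop atTop := by
  simpa using tendsto_abs_atTop_atTop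

lemma poly_eq_zero_of_tendsto {r : ℝ[X]}
    (h : Tendsto (fun y : ℝ => aeval ((y : ℂ) * Complex.I) r) atTop (𝓝 0)) : r = 0 := by
  by_cases hd : 0 < r.degree
  · have h1 : 0 < (r.map (algebraMap ℝ ℂ)).degree := by rwa [degree_map]
    have h2 := Polynomial.tendsto_norm_atTop _ h1 norm_mul_I_tendsto
    have h3 := h.norm
    simp only [eval_map_algebraMap] at h2
    exact absurd h3 (not_tendsto_nhds_of_tendsto_atTop h2 _)
  · rw [eq_C_of_degree_le_zero (not_lt.1 hd)] at h ⊢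
    simp only [aeval_C] at h
    have := tendsto_nhds_unique h tendsto_const_nhds
    have h0 : r.coeff 0 = 0 := by simpa using this.symm
    rw [h0, map_zero]

lemma mul_I_notMem {y : ℝ} (hy : 0 < y) (I : Set ℝ) :
    (y : ℂ) * Complex.I ∉ ((↑) : ℝ → ℂ) '' I := by
  apply im_notMem
  simpa using hy.ne'

/-- If `p` times the Cauchy transform is a polynomial, then `p` annihilates the measure. -/
lemma integral_eq_zero_of_poly {τ : Measure ℝ} [IsFiniteMeasure τ] {I : Set ℝ} (hI : IsCompact I)
    (h0 : τ Iᶜ = 0) {N : ℝ → ℝ} (hN : ContinuousOn N I) {p D : ℝ[X]}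
    (h : ∀ z : ℂ, 0 < z.im → aeval z p * ct τ N z = aeval z D) (q : ℝ[X]) :
    ∫ t, q.eval t * (p.eval t * N t) ∂τ = 0 := by
  have hintg : ∀ q : ℝ[X], Integrable (fun t => q.eval t * N t) τ := fun q =>
    integrable_of_continuousOn hI h0 (q.continuous.continuousOn.mul hN)
  obtain ⟨r, hr⟩ := poly_mul_ct hI h0 hN (X * q * p)
  have h1 : X * q * D - r = 0 := by
    refine poly_eq_zero_of_tendsto ?_
    refine (ct_tendsto_zero (hintg (X * q * p))).congr' ?_
    filter_upwards [eventually_gt_atTop 0] with y hy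
    have h2 := hr _ (mul_I_notMem hy I)
    have h3 := h ((y : ℂ) * Complex.I) (by simpa using hy)
    rw [map_mul, mul_assoc, h3] at h2
    simp only [map_sub, map_mul, aeval_X] at h2 ⊢
    linear_combination -h2
  obtain ⟨r', hr'⟩ := poly_mul_ct hI h0 hN (q * p)
  have h1' : q * D - r' = 0 := by
    refine poly_eq_zero_of_tendsto ?_
    refine (ct_tendsto_zero (hintg (q * p))).congr' ?_
    filter_upwards [eventually_gt_atTop 0] with y hy
    have h2 := hr' _ (mul_I_notMem hy I)
    have h3 := h ((y : ℂ) * Complex.I) (by simpa using hy)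
    rw [map_mul, mul_assoc, h3] at h2
    simp only [map_sub, map_mul] at h2 ⊢
    linear_combination -h2
  have h4 : ∀ z : ℂ, 0 < z.im → ct τ (fun t => (q * p).eval t * N t) z = 0 := by
    intro z hz
    have h2 := hr' z (im_notMem hz.ne' I)
    have h3 := h z hz
    have h5 := congrArg (aeval z) h1'
    rw [map_mul, mul_assoc, h3] at h2
    simp only [map_sub, map_mul, map_zero] at h5
    linear_combination h5 - h2
  have h5 := mul_ct_tendsto (hintg (q * p))
  have h6 := tendsto_nhds_unique h5 (tendsto_const_nhds.congr' (f₁ := fun _ => (0 : ℂ)) (by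
    filter_upwards [eventually_gt_atTop 0] with y hy
    rw [h4 _ (by simpa using hy), mul_zero]))
  have h7 : ∫ t, (q * p).eval t * N t ∂τ = 0 := by exact_mod_cast h6
  rw [← h7]
  congr 1
  ext t
  rw [eval_mul]
  ring

lemma poly_eq_zero_of_integral {τ : Measure ℝ} {a b : ℝ} (h : Conc τ (Icc a b)) {N : ℝ → ℝ}
    (hN : ContinuousOn N (Icc a b)) (h0 : ∀ t ∈ Icc a b, N t ≠ 0) {p : ℝ[X]}
    (hp : ∫ t, p.eval t * (p.eval t * N t) ∂τ = 0) : p = 0 := by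
  have := h.fin
  by_contra hne
  have main : ∀ M : ℝ → ℝ, ContinuousOn M (Icc a b) → (∀ t ∈ Icc a b, 0 < M t) →
      ∫ t, p.eval t * (p.eval t * M t) ∂τ ≠ 0 := by
    intro M hM hpos hz
    have hae := ae_mem_of_compl h.compl
    rw [integral_eq_zero_iff_of_nonneg_ae] at hz
    · apply h.inf p.roots.toFinset
      have : ∀ᵐ t ∂τ, t ∈ (p.roots.toFinset : Set ℝ) := by
        filter_upwards [hz, hae] with t h1 h2
        have h3 := hpos t h2
        simp only [Pi.zero_apply, mul_eq_zero] at h1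
        simp only [Finset.mem_coe, Multiset.mem_toFinset, mem_roots hne, IsRoot]
        rcases h1 with h1 | h1 | h1
        · exact h1
        · exact h1
        · linarith
      rwa [ae_iff] at this
    · filter_upwards [hae] with t ht
      have := hpos t ht
      simp only [Pi.zero_apply]
      rw [← mul_assoc]
      exact mul_nonneg (mul_self_nonneg _) this.le
    · exact integrable_of_continuousOn isCompact_Icc h.compl
        (p.continuous.continuousOn.mul (p.continuous.continuousOn.mul hM))
  rcases const_sign hN h0 with hs | hs
  · exact main N hN hs hp
  · refine main (fun t => -N t) hN.neg (fun t ht => neg_pos.2 (hs t ht)) ?_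
    simp only [mul_neg, integral_neg, hp, neg_zero]

lemma conc_of_inv {μ : Measure ℝ} {a b : ℝ} (h : Conc μ (Icc a b)) {N : ℝ → ℝ}
    (hN : ContinuousOn N (Icc a b)) (h0 : ∀ t ∈ Icc a b, N t ≠ 0) {c α β : ℝ}
    {τ : Measure ℝ} [IsFiniteMeasure τ] (hτ : τ (Icc a b)ᶜ = 0) {M : ℝ → ℝ}
    (hM : ContinuousOn M (Icc a b))
    (hinv : ∀ z : ℂ, 0 < z.im → ((c : ℂ) + ct μ N z)⁻¹ = α * z + β + ct τ M z) :
    Conc τ (Icc a b) := by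
  have := h.fin
  refine ⟨inferInstance, hτ, fun F hF => ?_⟩
  let D : ℝ[X] := ∏ y ∈ F, (X - C y)
  have hD0 : D ≠ 0 := Finset.prod_ne_zero_iff.2 fun y _ => X_sub_C_ne_zero y
  obtain ⟨r, hr⟩ := poly_mul_ct isCompact_Icc hτ hM D
  have hz : ∀ z, ct τ (fun t => D.eval t * M t) z = 0 := by
    intro z
    rw [ct_congr (I := (F : Set ℝ)) hF (M := fun _ => 0)]
    · simp [ct]
    · intro t ht
      have : D.eval t = 0 := by
        rw [eval_prod]
        exact Finset.prod_eq_zero ht (by simp)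
      rw [this, zero_mul]
  let p : ℝ[X] := D * (C α * X + C β) + r
  have hp : ∀ z : ℂ, 0 < z.im → aeval z p * ((c : ℂ) + ct μ N z) = aeval z D := by
    intro z hz'
    have h1 := hr z (im_notMem hz'.ne' _)
    rw [hz, add_zero] at h1
    have hG : (c : ℂ) + ct μ N z ≠ 0 := by
      intro h2
      have := congrArg Complex.im h2
      simp at this
      exact ct_im_ne_zero h hN h0 hz' this
    have h3 : aeval z p = aeval z D * ((c : ℂ) + ct μ N z)⁻¹ := by
      rw [hinv z hz']
      simp only [p, map_add, map_mul, aeval_C, aeval_X, Complex.coe_algebraMap]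
      rw [← h1]
      ring
    rw [h3, mul_assoc, inv_mul_cancel₀ hG, mul_one]
  have hpz : p = 0 := by
    refine poly_eq_zero_of_integral h hN h0 ?_
    refine integral_eq_zero_of_poly isCompact_Icc h.compl hN (D := D - C c * p) ?_ p
    intro z hz'
    have := hp z hz'
    simp only [map_sub, map_mul, aeval_C, Complex.coe_algebraMap]
    linear_combination this
  apply hD0
  have h5 : ∀ z : ℂ, 0 < z.im → aeval z D = 0 := by
    intro z hz'
    rw [← hp z hz', hpz, map_zero, zero_mul]
  refine poly_eq_zero_of_tendsto (tendsto_const_nhds.congr' (f₁ := fun _ => (0 : ℂ)) ?_)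
  filter_upwards [eventually_gt_atTop 0] with y hy
  exact (h5 _ (by simpa using hy)).symm

lemma exists_inv_pos {μ : Measure ℝ} {a b : ℝ} (h : Conc μ (Icc a b)) {N : ℝ → ℝ}
    (hN : ContinuousOn N (Icc a b)) (h0 : ∀ t ∈ Icc a b, 0 < N t) {c : ℝ}
    (hG : ∀ x : ℝ, x ∉ Icc a b → c + ctR μ N x ≠ 0) :
    ∃ (τ : Measure ℝ) (M : ℝ → ℝ) (α β : ℝ), Conc τ (Icc a b) ∧ ContinuousOn M (Icc a b) ∧
      (∀ t ∈ Icc a b, M t ≠ 0) ∧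
      ∀ z : ℂ, 0 < z.im → ((c : ℂ) + ct μ N z)⁻¹ = α * z + β + ct τ M z := by
  have := h.fin
  have hGz : ∀ (z : ℂ), 0 < z.im → (c : ℂ) + ct μ N z ≠ 0 := by
    intro z hz h2
    have := congrArg Complex.im h2
    simp at this
    exact ct_im_ne_zero h hN (fun t ht => (h0 t ht).ne') hz this
  suffices hs : ∃ (τ : Measure ℝ) (M : ℝ → ℝ) (α β : ℝ), IsFiniteMeasure τ ∧
      τ (Icc a b)ᶜ = 0 ∧ ContinuousOn M (Icc a b) ∧ (∀ t ∈ Icc a b, M t ≠ 0) ∧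
      ∀ z : ℂ, 0 < z.im → ((c : ℂ) + ct μ N z)⁻¹ = α * z + β + ct τ M z by
    obtain ⟨τ, M, α, β, h1, h2, h3, h4, h5⟩ := hs
    exact ⟨τ, M, α, β, conc_of_inv h hN (fun t ht => (h0 t ht).ne') h2 h3 h5, h3, h4, h5⟩
  by_cases hc : c = 0
  · subst hc
    let x₀ := a - 1
    let C := ∫ t, N t ∂μ
    have hC : C ≠ 0 := (integral_pos_on isCompact_Icc h.compl (conc_ne_zero h) hN h0).ne'
    have hN' : ContinuousOn (fun t => (t - x₀) * N t) (Icc a b) :=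
      ContinuousOn.mul (by fun_prop) hN
    have hK : IsCompact (insert x₀ (Icc a b)) := isCompact_Icc.insert x₀
    have hx0 : x₀ ∉ Icc a b := fun hx => by
      have := hx.1
      simp only [x₀] at this
      linarith
    have hN'K : ContinuousOn (fun t => (t - x₀) * N t) (insert x₀ (Icc a b)) := by
      rw [insert_eq]
      exact (continuousOn_singleton _ _).union_of_isClosed hN' isClosed_singleton isClosed_Icc
    have hcompl : μ (insert x₀ (Icc a b))ᶜ = 0 :=
      measure_mono_null (compl_subset_compl.2 (subset_insert _ _)) h.compl
    obtain ⟨ν, hνf, hν0, hν⟩ := inv_transform_of_ne hK hcompl hN'K (by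
      rintro t (rfl | ht)
      · simp
      · exact mul_nonneg (by have := ht.1; simp only [x₀]; linarith) (h0 t ht).le) hC (by
      intro x hx
      have hxI : x ∉ Icc a b := fun h => hx (mem_insert_of_mem _ h)
      have hxx : x ≠ x₀ := fun h => hx (h ▸ mem_insert _ _)
      have h1 := mul_ct isCompact_Icc h.compl hN (ofReal_notMem hxI) x₀
      rw [ct_ofReal, ct_ofReal] at h1
      have h2 : (x - x₀) * ctR μ N x = C + ctR μ (fun t => (t - x₀) * N t) x := by
        exact_mod_cast h1
      rw [← h2]
      refine mul_ne_zero (sub_ne_zero.2 hxx) ?_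
      simpa using hG x hxI)
    have hνI : (ν.restrict (Icc a b)) (Icc a b)ᶜ = 0 := by
      rw [Measure.restrict_apply measurableSet_Icc.compl]
      simp
    refine ⟨ν.restrict (Icc a b), fun t => -(C ^ 2)⁻¹ * (t - x₀), C⁻¹,
      -x₀ * C⁻¹ - (C ^ 2)⁻¹ * (∫ _, 1 ∂ν), inferInstance, hνI, by fun_prop, ?_, ?_⟩
    · intro t ht
      refine mul_ne_zero (by simpa using hC) ?_
      have := ht.1
      simp only [x₀]
      linarith
    · intro z hz
      have hzI := im_notMem hz.ne'
      have h1 := mul_ct isCompact_Icc h.compl hN (hzI _) x₀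
      have h2 := hGz z hz
      simp only [Complex.ofReal_zero, zero_add] at h2 ⊢
      have hzx : z - x₀ ≠ 0 := sub_ne_of_notMem (hzI {x₀}) rfl
      have h3 := hν z hz.ne' (by
        rw [← h1]; exact mul_ne_zero hzx h2)
      rw [← h1, mul_inv] at h3
      have h4 : (ct μ N z)⁻¹ = (z - x₀) * ((C : ℂ)⁻¹ - ((C : ℂ) ^ 2)⁻¹ * ct ν (fun _ => 1) z) := by
        rw [← h3]
        field_simp
      have h5 := mul_ct hK hν0 (N := fun _ => 1) continuousOn_const (hzI _) x₀
      have h6 : ct ν (fun t => (t - x₀) * 1) z = ct (ν.restrict (Icc a b)) (fun t => t - x₀) z := by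
        simp only [mul_one, ct]
        rw [setIntegral_eq_integral_of_ae_compl_eq_zero]
        filter_upwards [ae_mem_of_compl hν0] with t ht hnot
        rcases ht with rfl | ht
        · simp
        · exact absurd ht hnot
      rw [h6] at h5
      rw [h4, ct_const_mul]
      push_cast at h5 ⊢
      linear_combination -((C : ℂ) ^ 2)⁻¹ * h5
  · obtain ⟨ν, hνf, hν0, hν⟩ := inv_transform_of_ne isCompact_Icc h.compl hN
      (fun t ht => (h0 t ht).le) hc hG
    refine ⟨ν, fun _ => -(c ^ 2)⁻¹ * 1, 0, c⁻¹, hνf, hν0, continuousOn_const, ?_, ?_⟩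
    · intro t _
      simpa using hc
    · intro z hz
      rw [hν z hz.ne' (hGz z hz), ct_const_mul]
      push_cast
      ring

lemma exists_inv {μ : Measure ℝ} {a b : ℝ} (h : Conc μ (Icc a b)) {N : ℝ → ℝ}
    (hN : ContinuousOn N (Icc a b)) (h0 : ∀ t ∈ Icc a b, N t ≠ 0) {c : ℝ}
    (hG : ∀ x : ℝ, x ∉ Icc a b → c + ctR μ N x ≠ 0) :
    ∃ (τ : Measure ℝ) (M : ℝ → ℝ) (α β : ℝ), Conc τ (Icc a b) ∧ ContinuousOn M (Icc a b) ∧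
      (∀ t ∈ Icc a b, M t ≠ 0) ∧
      ∀ z : ℂ, 0 < z.im → ((c : ℂ) + ct μ N z)⁻¹ = α * z + β + ct τ M z := by
  rcases const_sign hN h0 with hs | hs
  · exact exists_inv_pos h hN hs hG
  · have hR : ∀ x, ctR μ (fun t => -N t) x = -ctR μ N x := by
      intro x
      simp only [ctR, neg_div, integral_neg]
    obtain ⟨τ, M, α, β, h1, h2, h3, h4⟩ := exists_inv_pos h hN.neg
      (fun t ht => neg_pos.2 (hs t ht)) (c := -c) (fun x hx => by
        have := hG x hx
        change -c + ctR μ (fun t => -N t) x ≠ 0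
        rw [hR, ← neg_add]
        exact neg_ne_zero.2 this)
    refine ⟨τ, fun t => -M t, -α, -β, h1, h2.neg, fun t ht => neg_ne_zero.2 (h3 t ht), ?_⟩
    intro z hz
    have := h4 z hz
    change (((-c : ℝ) : ℂ) + ct μ (fun t => -N t) z)⁻¹ = _ at this
    rw [ct_neg, Complex.ofReal_neg, ← neg_add, inv_neg] at this
    rw [ct_neg]
    push_cast
    linear_combination -this

section

lemma sub_ne_of_disjoint {I J : Set ℝ} (h : Disjoint I J) {t w : ℝ} (ht : t ∈ I) (hw : w ∈ J) :
    t - w ≠ 0 := fun h' => h.le_bot ⟨ht, by rwa [sub_eq_zero.1 h']⟩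

/-- Partial fraction identity for products of Cauchy transforms of measures on disjoint sets. -/
lemma ct_mul_ct {ρ κ : Measure ℝ} [IsFiniteMeasure ρ] [IsFiniteMeasure κ] {I J : Set ℝ}
    (hI : IsCompact I) (hJ : IsCompact J) (hρ : ρ Iᶜ = 0) (hκ : κ Jᶜ = 0) (hIJ : Disjoint I J)
    {N n : ℝ → ℝ} (hN : ContinuousOn N I) (hn : ContinuousOn n J) {z : ℂ}
    (hzI : z ∉ ((↑) : ℝ → ℂ) '' I) (hzJ : z ∉ ((↑) : ℝ → ℂ) '' J) :
    ct ρ N z * ct κ n z =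
      ct ρ (fun t => N t * ctR κ n t) z + ct κ (fun w => n w * ctR ρ N w) z := by
  have e1 : ct ρ (fun t => N t * ctR κ n t) z =
      ∫ t, ∫ w, (N t : ℂ) * n w / ((t - w) * (z - t)) ∂κ ∂ρ := by
    unfold ct
    refine integral_congr_on hρ fun t ht => ?_
    have : (ctR κ n t : ℂ) = ∫ w, (n w : ℂ) / (t - w) ∂κ := by
      rw [← ct_ofReal]; rfl
    rw [Complex.ofReal_mul, this, mul_div_assoc, div_eq_mul_inv _ (z - (t : ℂ)),
      ← integral_mul_const, ← integral_const_mul]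
    refine integral_congr_on hκ fun w hw => ?_
    field_simp
  have e2 : ct κ (fun w => n w * ctR ρ N w) z =
      ∫ t, ∫ w, (N t : ℂ) * n w / ((w - t) * (z - w)) ∂κ ∂ρ := by
    rw [integral_swap_on hI hJ hρ hκ]
    · unfold ct
      refine integral_congr_on hκ fun w hw => ?_
      have : (ctR ρ N w : ℂ) = ∫ t, (N t : ℂ) / (w - t) ∂ρ := by
        rw [← ct_ofReal]; rfl
      rw [Complex.ofReal_mul, this, mul_div_assoc, div_eq_mul_inv _ (z - (w : ℂ)),
        ← integral_mul_const, ← integral_const_mul]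
      refine integral_congr_on hρ fun t ht => ?_
      field_simp
    · refine ContinuousOn.div ?_ (by fun_prop) ?_
      · exact (Complex.continuous_ofReal.comp_continuousOn
          (hN.comp continuousOn_fst fun p hp => hp.1)).mul
          (Complex.continuous_ofReal.comp_continuousOn
          (hn.comp continuousOn_snd fun p hp => hp.2))
      · rintro ⟨t, w⟩ ⟨ht, hw⟩
        exact mul_ne_zero (by exact_mod_cast sub_ne_of_disjoint hIJ.symm hw ht)
          (sub_ne_of_notMem hzJ hw)
  have e3 : ct ρ N z * ct κ n z =
      ∫ t, ∫ w, (N t : ℂ) * n w / ((z - t) * (z - w)) ∂κ ∂ρ := by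
    unfold ct
    rw [← integral_mul_const]
    congr 1
    ext t
    rw [← integral_const_mul]
    congr 1
    ext w
    rw [div_mul_div_comm]
  have c1 : ∀ t ∈ I, ContinuousOn (fun w : ℝ => (N t : ℂ) * n w / ((t - w) * (z - t))) J := by
    intro t ht
    refine ContinuousOn.div (continuousOn_const.mul (Complex.continuous_ofReal.comp_continuousOn hn))
      (by fun_prop) fun w hw => ?_
    exact mul_ne_zero (by exact_mod_cast sub_ne_of_disjoint hIJ ht hw) (sub_ne_of_notMem hzI ht)
  have c2 : ∀ t ∈ I, ContinuousOn (fun w : ℝ => (N t : ℂ) * n w / ((w - t) * (z - w))) J := by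
    intro t ht
    refine ContinuousOn.div (continuousOn_const.mul (Complex.continuous_ofReal.comp_continuousOn hn))
      (by fun_prop) fun w hw => ?_
    exact mul_ne_zero (by exact_mod_cast sub_ne_of_disjoint hIJ.symm hw ht) (sub_ne_of_notMem hzJ hw)
  have d1 : Integrable (fun t => ∫ w, (N t : ℂ) * n w / ((t - w) * (z - t)) ∂κ) ρ := by
    refine (ct_integrable hI hρ (hN.mul (ctR_continuousOn hJ hκ hn hIJ)) hzI).congr ?_
    filter_upwards [ae_mem_of_compl hρ] with t ht
    have : (ctR κ n t : ℂ) = ∫ w, (n w : ℂ) / (t - w) ∂κ := by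
      rw [← ct_ofReal]; rfl
    rw [Pi.mul_apply, Complex.ofReal_mul, this, mul_div_assoc, div_eq_mul_inv _ (z - (t : ℂ)),
      ← integral_mul_const, ← integral_const_mul]
    refine integral_congr_on hκ fun w hw => ?_
    field_simp
  have d3 : Integrable (fun t => ∫ w, (N t : ℂ) * n w / ((z - t) * (z - w)) ∂κ) ρ := by
    refine ((ct_integrable hI hρ hN hzI).mul_const (ct κ n z)).congr (ae_of_all _ fun t => ?_)
    unfold ct
    simp only
    rw [← integral_const_mul]
    congr 1
    ext w
    rw [div_mul_div_comm]
  have key : ∀ t ∈ I, ∫ w, (N t : ℂ) * n w / ((w - t) * (z - w)) ∂κ =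
      ∫ w, (N t : ℂ) * n w / ((z - t) * (z - w)) ∂κ -
        ∫ w, (N t : ℂ) * n w / ((t - w) * (z - t)) ∂κ := by
    intro t ht
    rw [← integral_sub]
    · refine integral_congr_on hκ fun w hw => ?_
      have h1 : (t : ℂ) - w ≠ 0 := by exact_mod_cast sub_ne_of_disjoint hIJ ht hw
      have h1' : (w : ℂ) - t ≠ 0 := by exact_mod_cast sub_ne_of_disjoint hIJ.symm hw ht
      have h2 := sub_ne_of_notMem hzI ht
      have h3 := sub_ne_of_notMem hzJ hw
      have h4 : (w : ℂ) - t = -(t - w) := by ring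
      rw [h4]
      field_simp
      ring
    · refine integrable_of_continuousOn hJ hκ (ContinuousOn.div (continuousOn_const.mul
        (Complex.continuous_ofReal.comp_continuousOn hn)) (by fun_prop) fun w hw => ?_)
      exact mul_ne_zero (sub_ne_of_notMem hzI ht) (sub_ne_of_notMem hzJ hw)
    · exact integrable_of_continuousOn hJ hκ (c1 t ht)
  rw [e1, e2, e3, integral_congr_on hρ key, integral_sub d3 d1]
  ring

/-- The identity `Ĥ - ρ̂·η = const - κ̂` used to reduce ratios of forms. -/
lemma ct_mul_affine {ρ κ : Measure ℝ} [IsFiniteMeasure ρ] [IsFiniteMeasure κ] {I J : Set ℝ}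
    (hI : IsCompact I) (hJ : IsCompact J) (hρ : ρ Iᶜ = 0) (hκ : κ Jᶜ = 0) (hIJ : Disjoint I J)
    {N n : ℝ → ℝ} (hN : ContinuousOn N I) (hn : ContinuousOn n J) {z : ℂ}
    (hzI : z ∉ ((↑) : ℝ → ℂ) '' I) (hzJ : z ∉ ((↑) : ℝ → ℂ) '' J) (α β : ℝ) :
    ct ρ (fun t => N t * (α * t + β + ctR κ n t)) z =
      ct ρ N z * (α * z + β + ct κ n z) - α * (∫ t, N t ∂ρ : ℝ) -
        ct κ (fun w => n w * ctR ρ N w) z := by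
  have h1 := ct_mul_ct hI hJ hρ hκ hIJ hN hn hzI hzJ
  have h2 := mul_ct hI hρ hN hzI 0
  have h3 : (fun t => N t * (α * t + β + ctR κ n t)) =
      fun t => (α * ((t - 0) * N t) + β * N t) + N t * ctR κ n t := by
    ext t; ring
  have hc : ContinuousOn (fun t => (t - 0) * N t) I := ContinuousOn.mul (by fun_prop) hN
  have a1 : ContinuousOn (fun t => α * ((t - 0) * N t)) I := continuousOn_const.mul hc
  have a2 : ContinuousOn (fun t => β * N t) I := continuousOn_const.mul hN
  have a3 : ContinuousOn (fun t => N t * ctR κ n t) I :=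
    hN.mul (ctR_continuousOn hJ hκ hn hIJ)
  have a4 : ContinuousOn (fun t => α * ((t - 0) * N t) + β * N t) I := a1.add a2
  rw [h3, ct_add hI hρ a4 a3 hzI, ct_add hI hρ a1 a2 hzI, ct_const_mul, ct_const_mul]
  simp only [Complex.ofReal_zero, sub_zero] at h2 ⊢
  linear_combination -h1 - (α : ℂ) * h2

lemma affine_limit {α β : ℝ} {f : ℝ → ℂ} {l : ℂ} (hf : Tendsto f atTop (𝓝 0))
    (h : Tendsto (fun y : ℝ => (α : ℂ) * (y * Complex.I) + β + f y) atTop (𝓝 l)) :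
    α = 0 ∧ (β : ℂ) = l := by
  have h1 : Tendsto (fun y : ℝ => (α : ℂ) * (y * Complex.I)) atTop (𝓝 (l - β)) := by
    have := (h.sub hf).sub (tendsto_const_nhds (x := (β : ℂ)))
    rw [sub_zero] at this
    refine this.congr fun y => ?_
    ring
  have hα : α = 0 := by
    by_contra hne
    have h2 : Tendsto (fun y : ℝ => ‖(α : ℂ) * (y * Complex.I)‖) atTop atTop := by
      simp only [norm_mul, Complex.norm_I, mul_one, Complex.norm_real, Real.norm_eq_abs]
      exact tendsto_abs_atTop_atTop.const_mul_atTop (abs_pos.2 hne)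
    exact not_tendsto_nhds_of_tendsto_atTop h2 _ h1.norm
  refine ⟨hα, ?_⟩
  subst hα
  simp only [Complex.ofReal_zero, zero_mul] at h1
  have := tendsto_nhds_unique h1 tendsto_const_nhds
  linear_combination -this

/-- An infinite sequence of measures on consecutively disjoint intervals. -/
structure Sys where
  A : ℕ → ℝ
  B : ℕ → ℝ
  μ : ℕ → Measure ℝ
  conc : ∀ q, Conc (μ q) (Icc (A q) (B q))
  disj : ∀ q, Disjoint (Icc (A q) (B q)) (Icc (A (q + 1)) (B (q + 1)))

namespace Sys

/-- The `q`-th interval. -/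
def I (S : Sys) (q : ℕ) : Set ℝ := Icc (S.A q) (S.B q)

/-- Real iterated transforms. -/
def uR (S : Sys) : ℕ → ℕ → ℝ → ℝ
  | 0, _, _ => 1
  | d + 1, i, x => ctR (S.μ (i + 1)) (S.uR d (i + 1)) x

/-- Complex iterated transforms `U^i_k`. -/
def U (S : Sys) (i k : ℕ) (z : ℂ) : ℂ :=
  if k < i then 0 else if k = i then 1 else ct (S.μ (i + 1)) (S.uR (k - i - 1) (i + 1)) z

variable (S : Sys)

lemma isCompact_I (q : ℕ) : IsCompact (S.I q) := isCompact_Icc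

lemma disjoint_I (q : ℕ) : Disjoint (S.I q) (S.I (q + 1)) := S.disj q

lemma compl_I (q : ℕ) : S.μ q (S.I q)ᶜ = 0 := (S.conc q).compl

instance (q : ℕ) : IsFiniteMeasure (S.μ q) := (S.conc q).fin

lemma uR_prop (d : ℕ) : ∀ i, (∀ x ∉ S.I (i + 1), S.uR d i x ≠ 0) ∧
    ContinuousOn (S.uR d i) (S.I i) := by
  induction d with
  | zero => exact fun i => ⟨fun x _ => one_ne_zero, continuousOn_const⟩
  | succ d ih =>
    intro i
    have hne : ∀ t ∈ S.I (i + 1), S.uR d (i + 1) t ≠ 0 := fun t ht =>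
      (ih (i + 1)).1 t fun h => (S.disjoint_I (i + 1)).le_bot ⟨ht, h⟩
    exact ⟨fun x hx => ctR_ne_zero (S.conc _) (ih (i + 1)).2 hne hx,
      ctR_continuousOn (S.isCompact_I _) (S.compl_I _) (ih (i + 1)).2 (S.disjoint_I i)⟩

lemma uR_ne (d i : ℕ) {t : ℝ} (ht : t ∈ S.I i) : S.uR d i t ≠ 0 :=
  (S.uR_prop d i).1 t fun h => (S.disjoint_I i).le_bot ⟨ht, h⟩

lemma uR_cont (d i : ℕ) : ContinuousOn (S.uR d i) (S.I i) := (S.uR_prop d i).2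

@[simp] lemma U_self (i : ℕ) (z : ℂ) : S.U i i z = 1 := by simp [U]

lemma U_of_lt {i k : ℕ} (h : k < i) (z : ℂ) : S.U i k z = 0 := by simp [U, h]

lemma U_of_gt {i k : ℕ} (h : i < k) (z : ℂ) :
    S.U i k z = ct (S.μ (i + 1)) (S.uR (k - i - 1) (i + 1)) z := by
  simp [U, h.not_gt, h.ne']

lemma U_ofReal {i k : ℕ} (h : i ≤ k) (x : ℝ) : S.U i k x = S.uR (k - i) i x := by
  rcases h.eq_or_lt with rfl | h
  · simp [uR]
  · rw [U_of_gt S h, ct_ofReal]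
    obtain ⟨d, hd⟩ : ∃ d, k - i = d + 1 := ⟨k - i - 1, by omega⟩
    rw [hd]
    rfl

lemma U_continuousAt (i k : ℕ) {x : ℝ} (hx : x ∈ S.I i) : ContinuousAt (S.U i k) x := by
  rcases lt_trichotomy k i with h | rfl | h
  · rw [show S.U i k = fun _ => 0 from funext fun z => U_of_lt S h z]
    exact continuousAt_const
  · rw [show S.U k k = fun _ => 1 from funext fun z => U_self S k z]
    exact continuousAt_const
  · rw [show S.U i k = _ from funext fun z => U_of_gt S h z]
    exact ct_continuousAt (S.isCompact_I _) (S.compl_I _) (S.uR_cont _ _)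
      (ofReal_notMem fun h => (S.disjoint_I i).le_bot ⟨hx, h⟩)

end Sys

end

section

/-- `V` is a combination of `U^i`, `s ≤ i ≤ e`, at `z`, vanishing at the indices in `J`. -/
def IsPre (S : Sys) (s e : ℕ) (J : Finset ℕ) (z : ℂ) (V : ℕ → ℂ) : Prop :=
  ∃ c : ℕ → ℂ, (∀ i, c i ≠ 0 → s ≤ i ∧ i ≤ e) ∧
    (∀ k, V k = ∑ i ∈ Finset.range (k + 1), c i * S.U i k z) ∧ ∀ j ∈ J, V j = 0

/-- The vectors with as many free coefficients as vanishing conditions, plus one. -/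
def IsVec (S : Sys) (s : ℕ) (J : Finset ℕ) (z : ℂ) (V : ℕ → ℂ) : Prop :=
  IsPre S s (s + J.card) J z V

/-- On all vectors `V` of type `(s, J)`, the ratio `V k / V b` is the function `F`. -/
def IsRatio (S : Sys) (s : ℕ) (J : Finset ℕ) (k b : ℕ) (F : ℂ → ℂ) : Prop :=
  ∀ z : ℂ, 0 < z.im → ∀ V, IsVec S s J z V → V k = V b * F z

variable {S : Sys} {s e : ℕ} {J : Finset ℕ} {z : ℂ} {V W : ℕ → ℂ}

lemma IsPre.mono (h : IsPre S s e J z V) {s' e' : ℕ} {J' : Finset ℕ} (hs : s' ≤ s) (he : e ≤ e')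
    (hJ : J' ⊆ J) : IsPre S s' e' J' z V := by
  obtain ⟨c, h1, h2, h3⟩ := h
  exact ⟨c, fun i hi => ⟨hs.trans (h1 i hi).1, (h1 i hi).2.trans he⟩, h2,
    fun j hj => h3 j (hJ hj)⟩

lemma pre_coeff {c : ℕ → ℂ} (h1 : ∀ i, c i ≠ 0 → s ≤ i ∧ i ≤ e)
    (h2 : ∀ k, V k = ∑ i ∈ Finset.range (k + 1), c i * S.U i k z) : V s = c s := by
  rw [h2, Finset.sum_range_succ, S.U_self, mul_one, Finset.sum_eq_zero, zero_add]
  intro i hi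
  have : c i = 0 := by
    by_contra h
    have := (h1 i h).1
    simp at hi
    omega
  rw [this, zero_mul]

lemma IsPre.sub_smul (hV : IsPre S s e J z V) (hW : IsPre S s e J z W) (x : ℂ) :
    IsPre S s e J z (fun k => V k - x * W k) := by
  obtain ⟨c, h1, h2, h3⟩ := hV
  obtain ⟨d, k1, k2, k3⟩ := hW
  refine ⟨fun i => c i - x * d i, fun i hi => ?_, fun k => ?_, fun j hj => ?_⟩
  · by_cases hc : c i = 0
    · by_cases hd : d i = 0
      · simp [hc, hd] at hi
      · exact k1 i hd
    · exact h1 i hc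
  · simp only [h2, k2, Finset.mul_sum, ← Finset.sum_sub_distrib]
    exact Finset.sum_congr rfl fun i _ => by ring
  · simp only [h3 j hj, k3 j hj, mul_zero, sub_zero]

lemma IsPre.smul (hV : IsPre S s e J z V) (x : ℂ) : IsPre S s e J z (fun k => x * V k) := by
  obtain ⟨c, h1, h2, h3⟩ := hV
  refine ⟨fun i => x * c i, fun i hi => h1 i fun h => hi (by simp [h]), fun k => ?_, fun j hj => ?_⟩
  · simp only [h2, Finset.mul_sum]
    exact Finset.sum_congr rfl fun i _ => by ring
  · simp only [h3 j hj, mul_zero]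

lemma IsPre.succ (hV : IsPre S s e J z V) (h0 : V s = 0) : IsPre S (s + 1) e J z V := by
  obtain ⟨c, h1, h2, h3⟩ := hV
  refine ⟨c, fun i hi => ⟨?_, (h1 i hi).2⟩, h2, h3⟩
  have h4 := pre_coeff h1 h2
  have h5 := (h1 i hi).1
  rcases h5.eq_or_lt with rfl | h
  · exact absurd (h4 ▸ h0) hi
  · exact h

lemma IsPre.apply_of_lt (hV : IsPre S (s + 1) e J z V) : V s = 0 := by
  obtain ⟨c, h1, h2, h3⟩ := hV
  rw [h2, Finset.sum_eq_zero]
  intro i hi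
  have : c i = 0 := by
    by_contra h
    have := (h1 i h).1
    simp at hi
    omega
  rw [this, zero_mul]

lemma IsPre.elim (hV : IsPre S s e J z V) (hW : IsPre S s e J z W) (hW1 : W s = 1) :
    IsPre S (s + 1) e J z (fun k => V k - V s * W k) :=
  (hV.sub_smul hW (V s)).succ (by simp [hW1])

lemma isVec_erase (hs : s ∈ J) : IsVec S s J z V ↔ IsVec S (s + 1) (J.erase s) z V := by
  have hc := Finset.card_erase_add_one hs
  unfold IsVec
  rw [show s + J.card = s + 1 + (J.erase s).card by omega]
  constructor
  · intro h
    obtain ⟨c, h1, h2, h3⟩ := h.succ (by obtain ⟨_, _, _, h3⟩ := h; exact h3 s hs)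
    exact ⟨c, h1, h2, fun j hj => h3 j (Finset.mem_of_mem_erase hj)⟩
  · intro h
    have h0 := h.apply_of_lt
    obtain ⟨c, h1, h2, h3⟩ := h
    refine ⟨c, fun i hi => ⟨by have := (h1 i hi).1; omega, (h1 i hi).2⟩, h2, fun j hj => ?_⟩
    rcases eq_or_ne j s with rfl | hne
    · exact h0
    · exact h3 j (Finset.mem_erase.2 ⟨hne, hj⟩)

lemma isRatio_erase (hs : s ∈ J) {k b : ℕ} {F : ℂ → ℂ} :
    IsRatio S s J k b F ↔ IsRatio S (s + 1) (J.erase s) k b F := by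
  unfold IsRatio
  simp only [isVec_erase hs]

lemma isRatio_insert (hs : s ∉ J) {k b : ℕ} {F : ℂ → ℂ} :
    IsRatio S s (insert s J) k b F ↔ IsRatio S (s + 1) J k b F := by
  rw [isRatio_erase (Finset.mem_insert_self s J), Finset.erase_insert hs]

lemma isVec_U (S : Sys) (s : ℕ) (z : ℂ) : IsVec S s ∅ z (fun k => S.U s k z) := by
  refine ⟨fun i => if i = s then 1 else 0, ?_, fun k => ?_, by simp⟩
  · intro i hi
    have : i = s := by by_contra h; simp [h] at hi
    simp [this]
  · simp only [ite_mul, one_mul, zero_mul, Finset.sum_ite_eq', Finset.mem_range]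
    split_ifs with h
    · rfl
    · exact S.U_of_lt (by omega) z

lemma isVec_empty (h : IsVec S s ∅ z V) (k : ℕ) : V k = V s * S.U s k z := by
  obtain ⟨c, h1, h2, h3⟩ := h
  rw [pre_coeff h1 h2, h2]
  have : ∀ i, i ≠ s → c i = 0 := by
    intro i hi
    by_contra h
    have := h1 i h
    simp at this
    omega
  by_cases hk : s ≤ k
  · rw [Finset.sum_eq_single s]
    · intro i _ hi
      rw [this i hi, zero_mul]
    · intro h
      simp at h
      omega
  · rw [S.U_of_lt (by omega), mul_zero, Finset.sum_eq_zero]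
    intro i hi
    simp at hi
    rw [this i (by omega), zero_mul]

/-- Existence of vectors normalized at `a`. -/
def HasVec (S : Sys) (s : ℕ) (J : Finset ℕ) (a : ℕ) : Prop :=
  ∀ z : ℂ, 0 < z.im → ∃ V, IsVec S s J z V ∧ V a = 1

lemma hasVec_of_ne {a : ℕ} (h : ∀ z : ℂ, 0 < z.im → ∃ V, IsVec S s J z V ∧ V a ≠ 0) :
    HasVec S s J a := by
  intro z hz
  obtain ⟨V, h1, h2⟩ := h z hz
  exact ⟨fun k => (V a)⁻¹ * V k, IsPre.smul h1 _, inv_mul_cancel₀ h2⟩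

/-- Integral representation of the ratios `V k / V a`. -/
structure RepD (S : Sys) (m s q : ℕ) (J : Finset ℕ) (a : ℕ) (τ : Measure ℝ) (N : ℕ → ℝ → ℝ)
    (α β : ℕ → ℝ) : Prop where
  conc : Conc τ (S.I (q + 1))
  cont : ∀ k ∈ Finset.Icc s m \ insert a J, ContinuousOn (N k) (S.I (q + 1))
  ne : ∀ k ∈ Finset.Icc s m \ insert a J, ∀ t ∈ S.I (q + 1), N k t ≠ 0
  ratio : ∀ k ∈ Finset.Icc s m \ insert a J,
    IsRatio S s J k a (fun z => α k * z + β k + ct τ (N k) z)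
  hα : ∀ k ∈ Finset.Icc s m \ insert a J, α k ≠ 0 → k ≤ q ∧ q < a
  hβ : ∀ k ∈ Finset.Icc s m \ insert a J, β k ≠ 0 → ¬ (a ≤ q ∧ q < k)
  link : ∀ k ∈ Finset.Icc s m \ insert a J, ∀ b ∈ Finset.Icc s m \ insert a J,
    ∀ t ∈ S.I (q + 1), ∀ F : ℂ → ℂ, ContinuousAt F t → IsRatio S s (insert a J) k b F →
      (N k t : ℂ) = N b t * F t

/-- Integral representation of the ratios `V k / V s`. -/
structure Rep0 (S : Sys) (m s q : ℕ) (J : Finset ℕ) (ρ : Measure ℝ) (c : ℕ → ℝ)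
    (N : ℕ → ℝ → ℝ) : Prop where
  conc : Conc ρ (S.I (q + 1))
  cs : c s = 1
  Ns : ∀ t, N s t = 0
  cont : ∀ k ∈ Finset.Icc s m \ J, ContinuousOn (N k) (S.I (q + 1))
  ne : ∀ k ∈ Finset.Icc s m \ insert s J, ∀ t ∈ S.I (q + 1), N k t ≠ 0
  ratio : ∀ k ∈ Finset.Icc s m \ J, IsRatio S s J k s (fun z => c k + ct ρ (N k) z)
  hc : ∀ k ∈ Finset.Icc s m \ insert s J, q < k → c k = 0
  link : ∀ k ∈ Finset.Icc s m \ insert s J, ∀ b ∈ Finset.Icc s m \ insert s J,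
    ∀ t ∈ S.I (q + 1), ∀ F : ℂ → ℂ, ContinuousAt F t → IsRatio S s (insert s J) k b F →
      (N k t : ℂ) = N b t * F t

/-- The ratios do not vanish on the real line off the interval. -/
def Rep0NV (S : Sys) (m s q : ℕ) (J : Finset ℕ) (ρ : Measure ℝ) (c : ℕ → ℝ)
    (N : ℕ → ℝ → ℝ) : Prop :=
  ∀ k ∈ Finset.Icc s m \ insert s J, (∀ x ∉ S.I (q + 1), c k + ctR ρ (N k) x ≠ 0) ∧
    (k ≤ q → c k ≠ 0)

lemma rep0_base (S : Sys) (m s : ℕ) : Rep0 S m s s ∅ (S.μ (s + 1))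
    (fun k => if k = s then 1 else 0)
    (fun k t => if k = s then 0 else S.uR (k - s - 1) (s + 1) t) := by
  constructor
  · exact S.conc _
  · simp
  · simp
  · intro k hk
    by_cases h : k = s
    · simp only [h, if_true]
      exact continuousOn_const
    · simp only [h, if_false]
      exact S.uR_cont _ _
  · intro k hk t ht
    have : k ≠ s := by
      rintro rfl
      simp at hk
    simp only [this, if_false]
    exact S.uR_ne _ _ ht
  · intro k hk z hz V hV
    rw [isVec_empty hV k]
    congr 1
    by_cases h : k = s
    · simp [h, ct]
    · have : s < k := by
        simp at hk
        omega
      simp only [h, if_false]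
      rw [S.U_of_gt this]
      simp
  · intro k hk _
    have : k ≠ s := by
      rintro rfl
      simp at hk
    simp [this]
  · intro k hk b hb t ht F hF hr
    have hk' : s + 1 ≤ k := by simp at hk; omega
    have hb' : s + 1 ≤ b := by simp at hb; omega
    rw [isRatio_insert (by simp)] at hr
    have h1 : S.U (s + 1) k t = S.U (s + 1) b t * F t := by
      refine eq_of_eq_upper (F := S.U (s + 1) k) (G := fun z => S.U (s + 1) b z * F z)
        (S.U_continuousAt _ _ ht) ((S.U_continuousAt _ _ ht).mul hF) fun z hz => ?_
      exact hr z hz _ (isVec_U S (s + 1) z)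
    rw [S.U_ofReal hk', S.U_ofReal hb'] at h1
    have e1 : k ≠ s := by omega
    have e2 : b ≠ s := by omega
    simp only [e1, e2, if_false]
    rw [Nat.sub_sub, Nat.sub_sub]
    exact h1

lemma nv_base (S : Sys) (m s : ℕ) : Rep0NV S m s s ∅ (S.μ (s + 1))
    (fun k => if k = s then 1 else 0)
    (fun k t => if k = s then 0 else S.uR (k - s - 1) (s + 1) t) := by
  intro k hk
  have : k ≠ s := by
    rintro rfl
    simp at hk
  have h2 : s < k := by
    simp at hk
    omega
  refine ⟨fun x hx => ?_, fun h => by omega⟩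
  simp only [this, if_false, zero_add]
  exact ctR_ne_zero (S.conc _) (S.uR_cont _ _) (fun t ht => S.uR_ne _ _ ht) hx

/-- The constants after one elimination step. -/
def stepC (s i : ℕ) (ρ : Measure ℝ) (c : ℕ → ℝ) (N : ℕ → ℝ → ℝ) (α β : ℕ → ℝ) (k : ℕ) : ℝ :=
  if k = s then 1 else c k - c i * β k - α k * ∫ t, N i t ∂ρ

/-- The densities after one elimination step. -/
def stepN (s i : ℕ) (ρ : Measure ℝ) (c : ℕ → ℝ) (N n : ℕ → ℝ → ℝ) (k : ℕ) (w : ℝ) : ℝ :=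
  if k = s then 0 else -(n k w * (c i + ctR ρ (N i) w))

lemma stepN_self (s i : ℕ) (ρ : Measure ℝ) (c : ℕ → ℝ) (N n : ℕ → ℝ → ℝ) :
    stepN s i ρ c N n s = fun _ => 0 := by
  ext w
  simp [stepN]

lemma stepN_of_ne {s i k : ℕ} (h : k ≠ s) (ρ : Measure ℝ) (c : ℕ → ℝ) (N n : ℕ → ℝ → ℝ) :
    stepN s i ρ c N n k = fun w => -(n k w * (c i + ctR ρ (N i) w)) := by
  ext w
  simp [stepN, h]

lemma stepC_of_ne {s i k : ℕ} (h : k ≠ s) (ρ : Measure ℝ) (c : ℕ → ℝ) (N : ℕ → ℝ → ℝ)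
    (α β : ℕ → ℝ) :
    stepC s i ρ c N α β k = c k - c i * β k - α k * ∫ t, N i t ∂ρ := by
  simp [stepC, h]

lemma rep0_step {m q i : ℕ} {I : Finset ℕ} (hI : I ⊆ Finset.Icc (s + 1) m)
    (hi : i ∈ Finset.Icc (s + 1) m) (hiI : i ∉ I) {ρ κ : Measure ℝ} {c α β : ℕ → ℝ}
    {N n : ℕ → ℝ → ℝ} (h : Rep0 S m s q I ρ c N) (hNV : Rep0NV S m s q I ρ c N)
    (hex : HasVec S s I s) (ht : RepD S m (s + 1) (q + 1) I i κ n α β) (hq : q = s + I.card) :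
    Rep0 S m s (q + 1) (insert i I) κ (stepC s i ρ c N α β) (stepN s i ρ c N n) := by
  have hfρ := h.conc.fin
  have hfκ := ht.conc.fin
  have hsI : s ∉ I := fun hs => by have := hI hs; simp at this
  have hsi : i ≠ s := by rintro rfl; simp at hi
  have hi0 : i ∈ Finset.Icc s m \ insert s I := by
    simp only [Finset.mem_sdiff, Finset.mem_Icc, Finset.mem_insert, not_or] at hi ⊢
    exact ⟨by omega, hsi, hiI⟩
  have hsub : insert s I ⊇ I := Finset.subset_insert _ _
  have hi1 : i ∈ Finset.Icc s m \ I := by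
    simp only [Finset.mem_sdiff, Finset.mem_insert, not_or] at hi0 ⊢
    exact ⟨hi0.1, hi0.2.2⟩
  have hmem : ∀ k ∈ Finset.Icc s m \ insert s (insert i I),
      k ∈ Finset.Icc (s + 1) m \ insert i I := by
    intro k hk
    simp only [Finset.mem_sdiff, Finset.mem_Icc, Finset.mem_insert, not_or] at hk ⊢
    exact ⟨by omega, hk.2.2⟩
  have hmem0 : ∀ k ∈ Finset.Icc s m \ insert s (insert i I), k ∈ Finset.Icc s m \ insert s I := by
    intro k hk
    simp only [Finset.mem_sdiff, Finset.mem_Icc, Finset.mem_insert, not_or] at hk ⊢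
    exact ⟨by omega, hk.2.1, hk.2.2.2⟩
  have hmem1 : ∀ k ∈ Finset.Icc s m \ insert s (insert i I), k ∈ Finset.Icc s m \ I := by
    intro k hk
    simp only [Finset.mem_sdiff, Finset.mem_Icc, Finset.mem_insert, not_or] at hk ⊢
    exact ⟨by omega, hk.2.2.2⟩
  have hnes : ∀ k ∈ Finset.Icc s m \ insert s (insert i I), k ≠ s := by
    rintro k hk rfl
    simp at hk
  have hmem2 : ∀ k ∈ Finset.Icc s m \ insert i I, k ≠ s →
      k ∈ Finset.Icc s m \ insert s (insert i I) := by
    intro k hk hks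
    simp only [Finset.mem_sdiff, Finset.mem_Icc, Finset.mem_insert, not_or] at hk ⊢
    exact ⟨by omega, hks, hk.2⟩
  have hdis := S.disjoint_I (q + 1)
  have hGc : ContinuousOn (fun w => c i + ctR ρ (N i) w) (S.I (q + 1 + 1)) :=
    continuousOn_const.add (ctR_continuousOn (S.isCompact_I _) h.conc.compl (h.cont i hi1)
      hdis.symm)
  have hGne : ∀ w ∈ S.I (q + 1 + 1), c i + ctR ρ (N i) w ≠ 0 := fun w hw =>
    (hNV i hi0).1 w fun hw' => hdis.le_bot ⟨hw', hw⟩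
  constructor
  · exact ht.conc
  · simp [stepC]
  · simp [stepN]
  · intro k hk
    by_cases hks : k = s
    · subst hks
      rw [stepN_self]
      exact continuousOn_const
    · rw [stepN_of_ne hks]
      exact ((ht.cont k (hmem k (hmem2 k hk hks))).mul hGc).neg
  · intro k hk t htt
    simp only [stepN, hnes k hk, if_false]
    exact neg_ne_zero.2 (mul_ne_zero (ht.ne k (hmem k hk) t htt) (hGne t htt))
  · intro k hk z hz V hV
    by_cases hks : k = s
    · subst hks
      simp [stepC, stepN, ct]
    have hk' := hmem2 k hk hks
    rw [stepC_of_ne hks, stepN_of_ne hks]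
    obtain ⟨W, hW, hW1⟩ := hex z hz
    have hVi : V i = 0 := by
      obtain ⟨_, _, _, h3⟩ := hV
      exact h3 i (Finset.mem_insert_self _ _)
    have hT : IsVec S (s + 1) I z (fun k => V k - V s * W k) := by
      have hc := Finset.card_insert_of_notMem hiI
      unfold IsVec at hV hW ⊢
      exact (hV.mono le_rfl (by omega) (Finset.subset_insert _ _)).elim
        (hW.mono le_rfl (by omega) subset_rfl) hW1
    have e1 := ht.ratio k (hmem k hk') z hz _ hT
    have e2 := h.ratio k (hmem1 k hk') z hz W hW
    have e3 := h.ratio i hi1 z hz W hW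
    simp only [hVi, hW1, one_mul] at e1 e2 e3
    have e4 : ct ρ (N k) z = ct ρ (fun t => N i t * (α k * t + β k + ctR κ (n k) t)) z := by
      refine ct_congr h.conc.compl (fun t htt => ?_) z
      have hcont : ContinuousAt (fun z : ℂ => α k * z + β k + ct κ (n k) z) t :=
        ContinuousAt.add (by fun_prop) (ct_continuousAt (S.isCompact_I _) ht.conc.compl
          (ht.cont k (hmem k hk')) (ofReal_notMem fun h' => hdis.le_bot ⟨htt, h'⟩))
      have := h.link k (hmem0 k hk') i hi0 t htt _ hcont ((isRatio_insert hsI).2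
        (ht.ratio k (hmem k hk')))
      rw [ct_ofReal] at this
      exact_mod_cast this
    have e5 := ct_mul_affine (S.isCompact_I _) (S.isCompact_I _) h.conc.compl ht.conc.compl hdis
      (h.cont i hi1) (ht.cont k (hmem k hk')) (im_notMem hz.ne' _) (im_notMem hz.ne' _) (α k) (β k)
    have e6 : c i * α k = 0 := by
      by_contra hne
      have h1 := (ht.hα k (hmem k hk') (right_ne_zero_of_mul hne)).2
      exact left_ne_zero_of_mul hne (h.hc i hi0 (by omega))
    have e6' : (c i : ℂ) * α k = 0 := by exact_mod_cast e6
    have e7 : ct κ (fun w => -(n k w * (c i + ctR ρ (N i) w))) z =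
        -(c i * ct κ (n k) z + ct κ (fun w => n k w * ctR ρ (N i) w) z) := by
      have hnc := ht.cont k (hmem k hk')
      have hcc : ContinuousOn (ctR ρ (N i)) (S.I (q + 1 + 1)) :=
        ctR_continuousOn (S.isCompact_I _) h.conc.compl (h.cont i hi1) hdis.symm
      have a1 : ContinuousOn (fun t => c i * n k t) (S.I (q + 1 + 1)) :=
        continuousOn_const.mul hnc
      have a2 : ContinuousOn (fun t => n k t * ctR ρ (N i) t) (S.I (q + 1 + 1)) := hnc.mul hcc
      rw [ct_neg, ← ct_const_mul, ← ct_add (S.isCompact_I _) ht.conc.compl a1 a2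
        (im_notMem hz.ne' _)]
      congr 2
      ext w
      ring
    beta_reduce
    rw [e7]
    push_cast
    have e8 : V k = V s * W k + (0 - V s * W i) * (α k * z + β k + ct κ (n k) z) := by
      rw [← e1]; ring
    rw [e8, e2, e3, e4, e5]
    linear_combination -V s * z * e6'
  · intro k hk hqk
    simp only [stepC, hnes k hk, if_false]
    have h1 : c k = 0 := h.hc k (hmem0 k hk) (by omega)
    have h2 : α k = 0 := by
      by_contra hne
      have := (ht.hα k (hmem k hk) hne).1
      omega
    have h3 : c i * β k = 0 := by
      by_contra hne
      have hci := left_ne_zero_of_mul hne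
      have := ht.hβ k (hmem k hk) (right_ne_zero_of_mul hne)
      have hiq : i ≤ q := by
        by_contra hlt
        exact hci (h.hc i hi0 (by omega))
      omega
    rw [h1, h2, h3]
    simp
  · intro k hk b hb t htt F hF hr
    simp only [stepN, hnes k hk, hnes b hb, if_false]
    rw [isRatio_insert (by simp [hsI, hsi.symm])] at hr
    have := ht.link k (hmem k hk) b (hmem b hb) t htt F hF hr
    push_cast
    rw [this]
    ring

end

section

variable {S : Sys} {s : ℕ} {J : Finset ℕ}

/-- Existence of an integral representation of the ratios `V k / V a`. -/
def Rep (S : Sys) (m s : ℕ) (J : Finset ℕ) (a : ℕ) : Prop :=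
  ∃ τ N α β, RepD S m s (s + J.card) J a τ N α β

lemma exists_large {q j : ℕ} (hJ : ∀ i ∈ J, s + 1 ≤ i) (hq : q = s + J.card) (hj : s + 1 ≤ j)
    (hjq : j ≤ q) (hjJ : j ∉ J) : ∃ i ∈ J, q < i := by
  by_contra hcon
  push Not at hcon
  have h1 : insert j J ⊆ Finset.Icc (s + 1) q := by
    intro i hi
    rw [Finset.mem_insert] at hi
    rw [Finset.mem_Icc]
    rcases hi with rfl | hi
    · exact ⟨hj, hjq⟩
    · exact ⟨hJ i hi, hcon i hi⟩
  have h2 := Finset.card_le_card h1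
  rw [Finset.card_insert_of_notMem hjJ, Nat.card_Icc] at h2
  omega

lemma rep0_nv {m q : ℕ} (hJ : J ⊆ Finset.Icc (s + 1) m) {ρ : Measure ℝ} {c : ℕ → ℝ}
    {N : ℕ → ℝ → ℝ} (h : Rep0 S m s q J ρ c N) (hq : q = s + J.card) (hex : HasVec S s J s)
    (hJ' : ∀ J' ⊆ Finset.Icc (s + 1) m, J'.card = J.card →
      (∃ ρ' c' N', Rep0 S m s q J' ρ' c' N') ∧ HasVec S s J' s)
    (htail : ∀ I ⊆ Finset.Icc (s + 1) m, ∀ a ∈ Finset.Icc (s + 1) m, a ∉ I → Rep S m (s + 1) I a) :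
    Rep0NV S m s q J ρ c N := by
  intro j hj
  have hfρ := h.conc.fin
  by_cases hjq : q < j
  · refine ⟨fun x hx => ?_, fun h' => by omega⟩
    rw [h.hc j hj hjq, zero_add]
    refine ctR_ne_zero h.conc (h.cont j ?_) (h.ne j hj) hx
    simp only [Finset.mem_sdiff, Finset.mem_insert, not_or] at hj ⊢
    exact ⟨hj.1, hj.2.2⟩
  push Not at hjq
  have hj' := hj
  simp only [Finset.mem_sdiff, Finset.mem_Icc, Finset.mem_insert, not_or] at hj'
  have hJs : ∀ i ∈ J, s + 1 ≤ i := fun i hi => (Finset.mem_Icc.1 (hJ hi)).1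
  obtain ⟨i, hiJ, hqi⟩ := exists_large hJs hq (by omega) hjq hj'.2.2
  have him := Finset.mem_Icc.1 (hJ hiJ)
  have hIcard := Finset.card_erase_add_one hiJ
  set I := J.erase i with hI
  have hIJ : I ⊆ J := Finset.erase_subset _ _
  have hjI : j ∉ I := fun h' => hj'.2.2 (hIJ h')
  have hj1 : j ∈ Finset.Icc (s + 1) m := by rw [Finset.mem_Icc]; omega
  have hcard' : (insert j I).card = J.card := by
    rw [Finset.card_insert_of_notMem hjI]; omega
  obtain ⟨⟨ρ', c', N', h'⟩, hex'⟩ := hJ' (insert j I)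
    (Finset.insert_subset hj1 (hIJ.trans hJ)) hcard'
  obtain ⟨κ, n, α, β, ht⟩ := htail I (hIJ.trans hJ) j hj1 hjI
  rw [show s + 1 + I.card = q by omega] at ht
  have hfρ' := h'.conc.fin
  have hfκ := ht.conc.fin
  have hij : i ≠ j := by rintro rfl; exact hj'.2.2 hiJ
  have hi1 : i ∈ Finset.Icc (s + 1) m \ insert j I := by
    simp only [Finset.mem_sdiff, Finset.mem_Icc, Finset.mem_insert, not_or]
    exact ⟨by omega, hij, Finset.notMem_erase i J⟩
  have hi2 : i ∈ Finset.Icc s m \ insert s (insert j I) := by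
    simp only [Finset.mem_sdiff, Finset.mem_Icc, Finset.mem_insert, not_or]
    exact ⟨by omega, by omega, hij, Finset.notMem_erase i J⟩
  have hi3 : i ∈ Finset.Icc s m \ insert j I := by
    simp only [Finset.mem_sdiff, Finset.mem_Icc, Finset.mem_insert, not_or]
    exact ⟨by omega, hij, Finset.notMem_erase i J⟩
  have hj2 : j ∈ Finset.Icc s m \ J := by
    simp only [Finset.mem_sdiff, Finset.mem_Icc]
    exact ⟨by omega, hj'.2.2⟩
  have hα : α i = 0 := by
    by_contra hne
    have := (ht.hα i hi1 hne).1
    omega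
  have hβ : β i = 0 := by
    by_contra hne
    exact ht.hβ i hi1 hne ⟨hjq, hqi⟩
  have hc' : c' i = 0 := h'.hc i hi2 hqi
  have key : ∀ z : ℂ, 0 < z.im → -ct ρ' (N' i) z = (c j + ct ρ (N j) z) * ct κ (n i) z := by
    intro z hz
    obtain ⟨V, hV, hV1⟩ := hex z hz
    obtain ⟨W, hW, hW1⟩ := hex' z hz
    have e1 := h.ratio j hj2 z hz V hV
    have e2 := h'.ratio i hi3 z hz W hW
    have hVi : V i = 0 := by
      obtain ⟨_, _, _, h3⟩ := hV
      exact h3 i hiJ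
    have hWj : W j = 0 := by
      obtain ⟨_, _, _, h3⟩ := hW
      exact h3 j (Finset.mem_insert_self _ _)
    have hT : IsVec S (s + 1) I z (fun k => V k - V s * W k) := by
      unfold IsVec at hV hW ⊢
      exact (hV.mono le_rfl (by omega) hIJ).elim
        (hW.mono le_rfl (by omega) (Finset.subset_insert _ _)) hW1
    have e3 := ht.ratio i hi1 z hz _ hT
    simp only [hVi, hV1, hW1, hWj, one_mul, e1, e2, hα, hβ, hc', Complex.ofReal_zero, zero_mul,
      zero_add, mul_zero, sub_zero, zero_sub] at e3
    exact e3
  constructor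
  · intro x hx
    have hxI := ofReal_notMem hx
    have k1 : -ct ρ' (N' i) x = (c j + ct ρ (N j) x) * ct κ (n i) x := by
      refine eq_of_eq_upper (F := fun z => -ct ρ' (N' i) z)
        (G := fun z => (c j + ct ρ (N j) z) * ct κ (n i) z) ?_ ?_ key
      · exact (ct_continuousAt (S.isCompact_I _) h'.conc.compl (h'.cont i hi3) hxI).neg
      · exact (continuousAt_const.add (ct_continuousAt (S.isCompact_I _) h.conc.compl
          (h.cont j hj2) hxI)).mul (ct_continuousAt (S.isCompact_I _) ht.conc.compl
          (ht.cont i hi1) hxI)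
    intro h0
    rw [ct_ofReal, ct_ofReal ρ] at k1
    have h0' : (c j : ℂ) + (ctR ρ (N j) x : ℝ) = 0 := by exact_mod_cast h0
    rw [h0', zero_mul, neg_eq_zero] at k1
    exact ctR_ne_zero h'.conc (h'.cont i hi3) (h'.ne i hi2) hx (by exact_mod_cast k1)
  · intro _ h0
    have i1 := integrable_of_continuousOn (S.isCompact_I _) h'.conc.compl (h'.cont i hi3)
    have i2 := integrable_of_continuousOn (S.isCompact_I _) h.conc.compl (h.cont j hj2)
    have i3 := integrable_of_continuousOn (S.isCompact_I _) ht.conc.compl (ht.cont i hi1)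
    have l1 := (mul_ct_tendsto i1).neg
    have l2 := (ct_tendsto_zero i2).mul (mul_ct_tendsto i3)
    rw [zero_mul] at l2
    have l3 := tendsto_nhds_unique (l1.congr' (by
      filter_upwards [eventually_gt_atTop 0] with y hy
      have := key (y * Complex.I) (by simpa using hy)
      rw [h0, Complex.ofReal_zero, zero_add] at this
      rw [mul_left_comm, ← this, mul_neg])) l2
    rw [neg_eq_zero] at l3
    exact integral_ne_zero_on h'.conc (h'.cont i hi3) (h'.ne i hi2) (by exact_mod_cast l3)

lemma rep_of_mem {m a : ℕ} (hs : s ∈ J) (ha : a ∉ J) (h : Rep S m (s + 1) (J.erase s) a) :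
    Rep S m s J a := by
  have hc := Finset.card_erase_add_one hs
  obtain ⟨τ, N, α, β, h⟩ := h
  rw [show s + 1 + (J.erase s).card = s + J.card by omega] at h
  have has : a ≠ s := by rintro rfl; exact ha hs
  have hmem : ∀ k ∈ Finset.Icc s m \ insert a J,
      k ∈ Finset.Icc (s + 1) m \ insert a (J.erase s) := by
    intro k hk
    simp only [Finset.mem_sdiff, Finset.mem_Icc, Finset.mem_insert, Finset.mem_erase,
      not_or, not_and] at hk ⊢
    have : k ≠ s := by rintro rfl; exact hk.2.2 hs
    exact ⟨by omega, hk.2.1, fun _ => hk.2.2⟩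
  refine ⟨τ, N, α, β, h.conc, fun k hk => h.cont k (hmem k hk), fun k hk => h.ne k (hmem k hk),
    fun k hk => (isRatio_erase hs).2 (h.ratio k (hmem k hk)), fun k hk => h.hα k (hmem k hk),
    fun k hk => h.hβ k (hmem k hk), fun k hk b hb t ht F hF hr =>
      h.link k (hmem k hk) b (hmem b hb) t ht F hF ?_⟩
  rw [isRatio_erase (Finset.mem_insert_of_mem hs), Finset.erase_insert_of_ne has] at hr
  exact hr

lemma rep_of_rep0 {m : ℕ} {ρ : Measure ℝ} {c : ℕ → ℝ}
    {N : ℕ → ℝ → ℝ} (h : Rep0 S m s (s + J.card) J ρ c N) : Rep S m s J s := by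
  have hmem : ∀ k ∈ Finset.Icc s m \ insert s J, k ∈ Finset.Icc s m \ J := by
    intro k hk
    simp only [Finset.mem_sdiff, Finset.mem_insert, not_or] at hk ⊢
    exact ⟨hk.1, hk.2.2⟩
  refine ⟨ρ, N, 0, c, h.conc, fun k hk => h.cont k (hmem k hk), h.ne, fun k hk => ?_,
    fun k hk h0 => absurd rfl h0, fun k hk h0 h1 => h0 (h.hc k hk h1.2), h.link⟩
  simpa using h.ratio k (hmem k hk)

end

section

variable {S : Sys} {s : ℕ} {J : Finset ℕ}

lemma rep_swap {m q j : ℕ} (hJ : J ⊆ Finset.Icc (s + 1) m) (hj : j ∈ Finset.Icc (s + 1) m)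
    (hjJ : j ∉ J) {ρ κ : Measure ℝ} {c c' α β : ℕ → ℝ} {N N' n : ℕ → ℝ → ℝ}
    (h : Rep0 S m s q J ρ c N) (hNV : Rep0NV S m s q J ρ c N)
    (ht : RepD S m (s + 1) (q + 1) J j κ n α β)
    (hN' : ∀ k, k ≠ s → N' k = fun w => -(n k w * (c j + ctR ρ (N j) w)))
    (h' : Rep0 S m s (q + 1) (insert j J) κ c' N') (hNV' : Rep0NV S m s (q + 1) (insert j J) κ c' N')
    (hex : HasVec S s J s) (hex' : HasVec S s (insert j J) s) (hq : q = s + J.card) :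
    Rep S m s J j := by
  have hfρ := h.conc.fin
  have hfκ := ht.conc.fin
  have hj' := Finset.mem_Icc.1 hj
  have hsJ : s ∉ J := fun hs => by have := hJ hs; simp at this
  have hjs : j ≠ s := by omega
  have hj0 : j ∈ Finset.Icc s m \ insert s J := by
    simp only [Finset.mem_sdiff, Finset.mem_Icc, Finset.mem_insert, not_or]
    exact ⟨by omega, hjs, hjJ⟩
  have hj1 : j ∈ Finset.Icc s m \ J := by
    simp only [Finset.mem_sdiff, Finset.mem_insert, not_or] at hj0 ⊢
    exact ⟨hj0.1, hj0.2.2⟩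
  have hdis := S.disjoint_I (q + 1)
  have hGne : ∀ z : ℂ, 0 < z.im → (c j : ℂ) + ct ρ (N j) z ≠ 0 := by
    intro z hz h0
    have := congrArg Complex.im h0
    rw [Complex.add_im, Complex.ofReal_im, zero_add, Complex.zero_im] at this
    exact ct_im_ne_zero h.conc (h.cont j hj1) (h.ne j hj0) hz this
  obtain ⟨τ, M, α₀, β₀, hτ, hM, hM0, hinv⟩ := exists_inv h.conc (h.cont j hj1) (h.ne j hj0)
    (c := c j) (hNV j hj0).1
  have hfτ := hτ.fin
  have hmul : ∀ w ∈ S.I (q + 1 + 1),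
      (c j + ctR ρ (N j) w) * (α₀ * w + β₀ + ctR τ M w) = 1 := by
    intro w hw
    have hwI : w ∉ S.I (q + 1) := fun h' => hdis.le_bot ⟨h', hw⟩
    have h1 := eq_of_eq_upper (x := w)
      (F := fun z => (c j + ct ρ (N j) z) * (α₀ * z + β₀ + ct τ M z))
      (G := fun _ => 1) ?_ continuousAt_const ?_
    · rw [ct_ofReal, ct_ofReal] at h1
      exact_mod_cast h1
    · exact (continuousAt_const.add (ct_continuousAt (S.isCompact_I _) h.conc.compl
        (h.cont j hj1) (ofReal_notMem hwI))).mul (ContinuousAt.add (by fun_prop)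
        (ct_continuousAt (S.isCompact_I _) hτ.compl hM (ofReal_notMem hwI)))
    · intro z hz
      rw [← hinv z hz, mul_inv_cancel₀ (hGne z hz)]
  have hk1 : ∀ k ∈ Finset.Icc s m \ insert j J, k ∈ Finset.Icc s m \ J := by
    intro k hk
    simp only [Finset.mem_sdiff, Finset.mem_Icc, Finset.mem_insert, not_or] at hk ⊢
    exact ⟨hk.1, hk.2.2⟩
  have hEc : ∀ k ∈ Finset.Icc s m \ insert j J,
      ContinuousOn (fun t => c' k + ctR κ (N' k) t) (S.I (q + 1)) := fun k hk =>
    continuousOn_const.add (ctR_continuousOn (S.isCompact_I _) h'.conc.compl (h'.cont k hk) hdis)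
  have hmain : ∀ k, ∃ α' β' : ℝ, k ∈ Finset.Icc s m \ insert j J → IsRatio S s J k j
      (fun z => α' * z + β' + ct τ (fun t => M t * (c' k + ctR κ (N' k) t)) z) := by
    intro k
    by_cases hk : k ∈ Finset.Icc s m \ insert j J
    swap
    · exact ⟨0, 0, fun h => absurd h hk⟩
    by_cases hks : k = s
    · subst hks
      refine ⟨α₀, β₀, fun _ z hz V hV => ?_⟩
      have e1 := h.ratio j hj1 z hz V hV
      have e2 : ct τ (fun t => M t * (c' k + ctR κ (N' k) t)) z = ct τ M z := by
        congr 1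
        ext t
        rw [h'.cs, show N' k = fun _ => 0 from funext h'.Ns]
        simp [ctR]
      beta_reduce
      rw [e2, ← hinv z hz, e1, mul_inv_cancel_right₀ (hGne z hz)]
    · have hk2 : k ∈ Finset.Icc (s + 1) m \ insert j J := by
        simp only [Finset.mem_sdiff, Finset.mem_Icc] at hk ⊢
        exact ⟨by omega, hk.2⟩
      refine ⟨α k + α₀ * c' k, β k + β₀ * c' k + α₀ * ∫ t, N' k t ∂κ, fun _ z hz V hV => ?_⟩
      have hzI := im_notMem hz.ne'
      obtain ⟨W, hW, hW1⟩ := hex' z hz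
      have hWj : W j = 0 := by
        obtain ⟨_, _, _, h3⟩ := hW
        exact h3 j (Finset.mem_insert_self _ _)
      have hT : IsVec S (s + 1) J z (fun k => V k - V s * W k) := by
        have hc := Finset.card_insert_of_notMem hjJ
        unfold IsVec at hV hW ⊢
        exact (hV.mono le_rfl (by omega) subset_rfl).elim
          (hW.mono le_rfl (by omega) (Finset.subset_insert _ _)) hW1
      have e1 := ht.ratio k hk2 z hz _ hT
      have e2 := h'.ratio k hk z hz W hW
      have e3 := h.ratio j hj1 z hz V hV
      simp only [hWj, hW1, one_mul, mul_zero, sub_zero] at e1 e2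
      have e4 : V s = V j * (α₀ * z + β₀ + ct τ M z) := by
        rw [← hinv z hz, e3, mul_inv_cancel_right₀ (hGne z hz)]
      have hN'c := h'.cont k hk
      have e5 := ct_mul_affine (S.isCompact_I _) (S.isCompact_I _) hτ.compl h'.conc.compl hdis
        hM hN'c (hzI _) (hzI _) 0 (c' k)
      have e6 := mul_ct (S.isCompact_I _) h'.conc.compl hN'c (hzI _) 0
      have a1 : ContinuousOn (fun t => α₀ * ((t - 0) * N' k t)) (S.I (q + 1 + 1)) :=
        ContinuousOn.mul (by fun_prop) (ContinuousOn.mul (by fun_prop) hN'c)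
      have a2 : ContinuousOn (fun t => β₀ * N' k t) (S.I (q + 1 + 1)) :=
        ContinuousOn.mul (by fun_prop) hN'c
      have a3 : ContinuousOn (fun t => α₀ * ((t - 0) * N' k t) + β₀ * N' k t) (S.I (q + 1 + 1)) :=
        a1.add a2
      have a4 : ContinuousOn (fun t => N' k t * ctR τ M t) (S.I (q + 1 + 1)) :=
        hN'c.mul (ctR_continuousOn (S.isCompact_I _) hτ.compl hM hdis.symm)
      have e7 : -ct κ (n k) z =
          ct κ (fun t => α₀ * ((t - 0) * N' k t) + β₀ * N' k t + N' k t * ctR τ M t) z := by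
        rw [← ct_neg]
        refine ct_congr ht.conc.compl (fun w hw => ?_) z
        have := hmul w hw
        rw [hN' k hks]
        linear_combination (n k w) * this
      rw [ct_add (S.isCompact_I _) ht.conc.compl a3 a4 (hzI _),
        ct_add (S.isCompact_I _) ht.conc.compl a1 a2 (hzI _), ct_const_mul, ct_const_mul] at e7
      simp only [Complex.ofReal_zero, sub_zero, zero_mul, zero_add] at e5 e6 e7
      beta_reduce
      rw [e5]
      push_cast
      rw [e4, e2] at e1
      linear_combination e1 - V j * e7 + V j * α₀ * e6
  choose α' β' hαβ using hmain
  have hlim : ∀ k ∈ Finset.Icc s m \ insert j J, ∀ y : ℝ, 0 < y →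
      (c k + ct ρ (N k) (y * Complex.I)) / (c j + ct ρ (N j) (y * Complex.I)) =
      α' k * (y * Complex.I) + β' k +
        ct τ (fun t => M t * (c' k + ctR κ (N' k) t)) (y * Complex.I) := by
    intro k hk y hy
    have hz : 0 < ((y : ℂ) * Complex.I).im := by simpa using hy
    obtain ⟨V, hV, hV1⟩ := hex _ hz
    have e1 := hαβ k hk _ hz V hV
    have e2 := h.ratio j hj1 _ hz V hV
    have e3 := h.ratio k (hk1 k hk) _ hz V hV
    beta_reduce at e1 e2 e3
    rw [hV1, one_mul] at e2 e3
    rw [div_eq_iff (hGne _ hz), ← e3, e1, e2, mul_comm]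
  have hintg : ∀ k ∈ Finset.Icc s m \ J, Integrable (N k) ρ := fun k hk =>
    integrable_of_continuousOn (S.isCompact_I _) h.conc.compl (h.cont k hk)
  have hf0 : ∀ k ∈ Finset.Icc s m \ insert j J, Tendsto (fun y : ℝ =>
      ct τ (fun t => M t * (c' k + ctR κ (N' k) t)) (y * Complex.I)) atTop (𝓝 0) := fun k hk =>
    ct_tendsto_zero (integrable_of_continuousOn (S.isCompact_I _) hτ.compl (hM.mul (hEc k hk)))
  have hlt : ∀ k ∈ Finset.Icc s m \ insert j J, q < k → k ∈ Finset.Icc s m \ insert s J := by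
    intro k hk hqk
    simp only [Finset.mem_sdiff, Finset.mem_Icc, Finset.mem_insert, not_or] at hk ⊢
    exact ⟨hk.1, by omega, hk.2.2⟩
  have hcase1 : ∀ k ∈ Finset.Icc s m \ insert j J, j ≤ q →
      α' k = 0 ∧ (β' k : ℂ) = c k / c j := by
    intro k hk hjq
    refine affine_limit (hf0 k hk) ?_
    have l1 := (tendsto_const_nhds (x := (c k : ℂ))).add (ct_tendsto_zero (hintg k (hk1 k hk)))
    have l2 := (tendsto_const_nhds (x := (c j : ℂ))).add (ct_tendsto_zero (hintg j hj1))
    rw [add_zero] at l1 l2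
    refine (l1.div l2 (by exact_mod_cast (hNV j hj0).2 hjq)).congr' ?_
    filter_upwards [eventually_gt_atTop 0] with y hy
    exact hlim k hk y hy
  have hcase2 : ∀ k ∈ Finset.Icc s m \ insert j J, q < j → q < k → α' k = 0 := by
    intro k hk hjq hkq
    have l1 := mul_ct_tendsto (hintg k (hk1 k hk))
    have l2 := mul_ct_tendsto (hintg j hj1)
    have hL : ((∫ t, N j t ∂ρ : ℝ) : ℂ) ≠ 0 := by
      exact_mod_cast integral_ne_zero_on h.conc (h.cont j hj1) (h.ne j hj0)
    refine (affine_limit (β := β' k) (hf0 k hk) ((l1.div l2 hL).congr' ?_)).1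
    filter_upwards [eventually_gt_atTop 0] with y hy
    have := hlim k hk y hy
    rw [h.hc j hj0 hjq, h.hc k (hlt k hk hkq) hkq, Complex.ofReal_zero, zero_add, zero_add] at this
    rw [← this]
    have hy' : (y : ℂ) * Complex.I ≠ 0 := by simp [hy.ne']
    exact mul_div_mul_left _ _ hy'
  have hEne : ∀ k ∈ Finset.Icc s m \ insert j J, ∀ x ∈ S.I (q + 1),
      c' k + ctR κ (N' k) x ≠ 0 := by
    intro k hk x hx
    by_cases hks : k = s
    · rw [hks, h'.cs, show N' s = fun _ => 0 from funext h'.Ns]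
      simp [ctR]
    · refine (hNV' k ?_).1 x fun hx' => hdis.le_bot ⟨hx, hx'⟩
      simp only [Finset.mem_sdiff, Finset.mem_Icc, Finset.mem_insert, not_or] at hk ⊢
      exact ⟨hk.1, hks, hk.2⟩
  subst hq
  refine ⟨τ, fun k t => M t * (c' k + ctR κ (N' k) t), α', β', hτ,
    fun k hk => hM.mul (hEc k hk), fun k hk t htt => mul_ne_zero (hM0 t htt) (hEne k hk t htt),
    fun k hk => hαβ k hk, fun k hk h0 => ?_, fun k hk h0 h1 => ?_, ?_⟩
  · have hqj : s + J.card < j := by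
      by_contra hle
      exact h0 (hcase1 k hk (by omega)).1
    refine ⟨?_, hqj⟩
    by_contra hle
    exact h0 (hcase2 k hk hqj (by omega))
  · have := (hcase1 k hk h1.1).2
    rw [h.hc k (hlt k hk h1.2) h1.2, Complex.ofReal_zero, zero_div] at this
    exact h0 (by exact_mod_cast this)
  · intro k hk b hb t htt F hF hr
    have htI : (t : ℂ) ∉ ((↑) : ℝ → ℂ) '' S.I (s + J.card + 1 + 1) :=
      ofReal_notMem fun hx' => hdis.le_bot ⟨htt, hx'⟩
    have hcont : ∀ k ∈ Finset.Icc s m \ insert j J,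
        ContinuousAt (fun z => c' k + ct κ (N' k) z) (t : ℂ) := fun k hk =>
      continuousAt_const.add (ct_continuousAt (S.isCompact_I _) h'.conc.compl (h'.cont k hk) htI)
    have h1 := eq_of_eq_upper (x := t) (F := fun z => c' k + ct κ (N' k) z)
      (G := fun z => (c' b + ct κ (N' b) z) * F z) (hcont k hk) ((hcont b hb).mul hF) (by
        intro z hz
        obtain ⟨W, hW, hW1⟩ := hex' z hz
        have e1 := h'.ratio k hk z hz W hW
        have e2 := h'.ratio b hb z hz W hW
        have e3 := hr z hz W hW
        rw [hW1, one_mul] at e1 e2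
        beta_reduce at e1 e2 e3 ⊢
        rw [← e1, ← e2]
        exact e3)
    rw [ct_ofReal, ct_ofReal] at h1
    push_cast
    rw [h1]
    ring

end

section

variable {S : Sys} {s : ℕ} {J : Finset ℕ}

/-- All representations and normalized vectors at level `s`. -/
def Full (S : Sys) (m s : ℕ) : Prop :=
  ∀ J ⊆ Finset.Icc s m, ∀ a ∈ Finset.Icc s m, a ∉ J → Rep S m s J a ∧ HasVec S s J a

lemma rep0_all {m : ℕ} (hF : Full S m (s + 1)) (n : ℕ) :
    ∀ J ⊆ Finset.Icc (s + 1) m, J.card = n → HasVec S s J s ∧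
      ∃ ρ c N, Rep0 S m s (s + n) J ρ c N ∧ Rep0NV S m s (s + n) J ρ c N := by
  induction n with
  | zero =>
    intro J hJ hn
    rw [Finset.card_eq_zero] at hn
    subst hn
    exact ⟨fun z hz => ⟨_, isVec_U S s z, S.U_self s z⟩, _, _, _, rep0_base S m s, nv_base S m s⟩
  | succ n ih =>
    have key : ∀ J ⊆ Finset.Icc (s + 1) m, J.card = n + 1 → HasVec S s J s ∧
        ∃ ρ c N, Rep0 S m s (s + (n + 1)) J ρ c N := by
      intro J hJ hn
      obtain ⟨i, hi⟩ : J.Nonempty := Finset.card_pos.1 (by omega)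
      have hI : J.erase i ⊆ Finset.Icc (s + 1) m := (Finset.erase_subset _ _).trans hJ
      have hc := Finset.card_erase_add_one hi
      obtain ⟨hex, ρ, c, N, h, hNV⟩ := ih (J.erase i) hI (by omega)
      have hiI : i ∉ J.erase i := Finset.notMem_erase _ _
      obtain ⟨⟨κ, n', α, β, ht⟩, hv⟩ := hF (J.erase i) hI i (hJ hi) hiI
      rw [show s + 1 + (J.erase i).card = s + n + 1 by omega] at ht
      have := rep0_step hI (hJ hi) hiI h hNV hex ht (by omega)
      rw [Finset.insert_erase hi] at this
      refine ⟨fun z hz => ?_, _, _, _, this⟩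
      obtain ⟨W, hW, hW1⟩ := hex z hz
      obtain ⟨T, hT, hT1⟩ := hv z hz
      have hT0 : T s = 0 := IsPre.apply_of_lt hT
      refine ⟨fun k => W k - W i * T k, ?_, by simp [hT0, hW1]⟩
      have h1 : IsPre S s (s + J.card) (J.erase i) z (fun k => W k - W i * T k) := by
        unfold IsVec at hT hW
        exact (hW.mono le_rfl (by omega) subset_rfl).sub_smul
          (hT.mono (by omega) (by omega) subset_rfl) _
      obtain ⟨d, d1, d2, d3⟩ := h1
      refine ⟨d, d1, d2, fun j hj => ?_⟩
      by_cases hji : j = i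
      · simp [hji, hT1]
      · exact d3 j (Finset.mem_erase.2 ⟨hji, hj⟩)
    intro J hJ hn
    obtain ⟨hex, ρ, c, N, h⟩ := key J hJ hn
    refine ⟨hex, ρ, c, N, h, rep0_nv hJ h (by omega) hex (fun J' hJ' hc => ?_)
      fun I hI a ha haI => (hF I hI a ha haI).1⟩
    obtain ⟨h1, h2⟩ := key J' hJ' (hc.trans hn)
    exact ⟨h2, h1⟩

lemma full_step {m : ℕ} (hF : Full S m (s + 1)) : Full S m s := by
  have hsub : ∀ J : Finset ℕ, J ⊆ Finset.Icc s m → s ∉ J → J ⊆ Finset.Icc (s + 1) m := by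
    intro J hJ hs k hk
    have := Finset.mem_Icc.1 (hJ hk)
    have : k ≠ s := by rintro rfl; exact hs hk
    rw [Finset.mem_Icc]
    omega
  intro J hJ a ha haJ
  rw [Finset.mem_Icc] at ha
  by_cases hs : s ∈ J
  · have has : a ≠ s := by rintro rfl; exact haJ hs
    have hE : J.erase s ⊆ Finset.Icc (s + 1) m :=
      hsub _ ((Finset.erase_subset _ _).trans hJ) (Finset.notMem_erase _ _)
    obtain ⟨h1, h2⟩ := hF (J.erase s) hE a (by rw [Finset.mem_Icc]; omega)
      fun h => haJ (Finset.mem_of_mem_erase h)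
    refine ⟨rep_of_mem hs haJ h1, fun z hz => ?_⟩
    obtain ⟨V, hV, hV1⟩ := h2 z hz
    exact ⟨V, (isVec_erase hs).2 hV, hV1⟩
  · have hJ' := hsub J hJ hs
    obtain ⟨hex, ρ, c, N, h, hNV⟩ := rep0_all hF J.card J hJ' rfl
    by_cases has : a = s
    · subst has
      exact ⟨rep_of_rep0 h, hex⟩
    · have haI : a ∈ Finset.Icc (s + 1) m := by rw [Finset.mem_Icc]; omega
      obtain ⟨⟨κ, n, α, β, ht⟩, -⟩ := hF J hJ' a haI haJ
      rw [show s + 1 + J.card = s + J.card + 1 by omega] at ht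
      have hins : insert a J ⊆ Finset.Icc (s + 1) m := Finset.insert_subset haI hJ'
      have hci := Finset.card_insert_of_notMem haJ
      have h' := rep0_step hJ' haI haJ h hNV hex ht rfl
      obtain ⟨hex', -⟩ := rep0_all hF _ _ hins rfl
      have hNV' := rep0_nv hins h' (by omega) hex' (fun J' hJ' hc => by
        obtain ⟨h1, ρ', c', N', h2, -⟩ := rep0_all hF _ J' hJ' hc
        rw [show s + (insert a J).card = s + J.card + 1 by omega] at h2
        exact ⟨⟨_, _, _, h2⟩, h1⟩) fun I hI a ha haI => (hF I hI a ha haI).1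
      have hR : Rep S m s J a := rep_swap hJ' haI haJ h hNV ht
        (fun k hk => stepN_of_ne hk ..) h' hNV' hex hex' rfl
      refine ⟨hR, hasVec_of_ne fun z hz => ?_⟩
      obtain ⟨V, hV, hV1⟩ := hex z hz
      refine ⟨V, hV, fun h0 => ?_⟩
      obtain ⟨τ, M, α', β', hd⟩ := hR
      have := hd.ratio s (by
        simp only [Finset.mem_sdiff, Finset.mem_Icc, Finset.mem_insert, not_or]
        exact ⟨by omega, fun h => has h.symm, hs⟩) z hz V hV
      rw [hV1, h0, zero_mul] at this
      exact one_ne_zero this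

lemma full (S : Sys) (m : ℕ) : Full S m 0 := by
  have : ∀ d s, s + d = m + 1 → Full S m s := by
    intro d
    induction d with
    | zero =>
      intro s hs J _ a ha
      rw [Finset.mem_Icc] at ha
      omega
    | succ d ih => exact fun s hs => full_step (ih (s + 1) (by omega))
  exact this (m + 1) 0 (by omega)

end

/-- The monic polynomial with simple zeros at the points of `Z`. -/
def nod (Z : Finset ℝ) : ℝ[X] := Lagrange.nodal Z id

lemma eval_nod (Z : Finset ℝ) (x : ℝ) : (nod Z).eval x = ∏ y ∈ Z, (x - y) := by
  simp [nod, Lagrange.eval_nodal]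

lemma nod_ne {Z : Finset ℝ} {x : ℝ} (hx : x ∉ Z) : (nod Z).eval x ≠ 0 := by
  rw [eval_nod, Finset.prod_ne_zero_iff]
  rintro y hy h
  exact hx (by rwa [sub_eq_zero.1 h])

lemma nod_monic (Z : Finset ℝ) : (nod Z).Monic := Lagrange.nodal_monic

lemma degree_nod (Z : Finset ℝ) : (nod Z).degree = Z.card := Lagrange.degree_nodal

lemma natDegree_nod (Z : Finset ℝ) : (nod Z).natDegree = Z.card := Lagrange.natDegree_nodal

lemma sign_on {I : Set ℝ} (hI : I.OrdConnected) {g : ℝ → ℝ} (hg : ContinuousOn g I)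
    (h : ∀ x ∈ I, g x ≠ 0) : ∃ ε : ℝ, (ε = 1 ∨ ε = -1) ∧ ∀ x ∈ I, 0 < ε * g x := by
  by_cases hpos : ∀ x ∈ I, 0 < g x
  · exact ⟨1, Or.inl rfl, by simpa using hpos⟩
  · refine ⟨-1, Or.inr rfl, fun x hx => ?_⟩
    by_contra hcon
    push Not at hpos
    obtain ⟨y, hy, hy0⟩ := hpos
    obtain ⟨w, hw, hw0⟩ := hI.isPreconnected.intermediate_value hy hx hg ⟨hy0, by linarith⟩
    exact h w hw hw0

lemma sign_pattern (Z : Finset ℝ) : ∀ (I : Set ℝ), I.OrdConnected → ∀ g : ℝ → ℝ,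
    ContinuousOn g I → (∀ x ∈ I, x ∉ Z → g x ≠ 0) →
    ∃ Z' ⊆ Z, ∃ ε : ℝ, (ε = 1 ∨ ε = -1) ∧ ∀ x ∈ I, x ∉ Z → 0 < ε * (g x * (nod Z').eval x) := by
  induction Z using Finset.induction_on_max with
  | empty =>
    intro I hI g hg h
    obtain ⟨ε, h1, h2⟩ := sign_on hI hg fun x hx => h x hx (by simp)
    exact ⟨∅, subset_rfl, ε, h1, fun x hx _ => by simpa [eval_nod] using h2 x hx⟩
  | insert z Z hz ih =>
    intro I hI g hg h
    obtain ⟨Z', hZ', ε₁, h1, h2⟩ := ih (I ∩ Iio z) (hI.inter ordConnected_Iio) g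
      (hg.mono inter_subset_left) fun x hx hxZ => h x hx.1 (by
        rw [Finset.mem_insert, not_or]; exact ⟨(ne_of_lt hx.2), hxZ⟩)
    obtain ⟨ε₂, h3, h4⟩ := sign_on (hI.inter (ordConnected_Ioi (a := z)))
      (hg.mono inter_subset_left) fun x hx => h x hx.1 (by
        rw [Finset.mem_insert, not_or]
        exact ⟨(ne_of_gt hx.2), fun hxZ => (hz x hxZ).not_gt hx.2⟩)
    have hpos : ∀ x, z < x → 0 < (nod Z').eval x := by
      intro x hx
      rw [eval_nod]
      exact Finset.prod_pos fun y hy => sub_pos.2 ((hz y (hZ' hy)).trans hx)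
    have hzZ' : z ∉ Z' := fun h => (hz z (hZ' h)).false
    have hsplit : ∀ x, x ∉ insert z Z → x ∉ Z ∧ (x < z ∨ z < x) := by
      intro x hx
      rw [Finset.mem_insert, not_or] at hx
      exact ⟨hx.2, lt_or_gt_of_ne hx.1⟩
    by_cases hεε : ε₁ = ε₂
    · refine ⟨Z', hZ'.trans (Finset.subset_insert _ _), ε₁, h1, fun x hx hxZ => ?_⟩
      obtain ⟨hxZ, hlt | hgt⟩ := hsplit x hxZ
      · exact h2 x ⟨hx, hlt⟩ hxZ
      · rw [← mul_assoc, hεε]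
        exact mul_pos (h4 x ⟨hx, hgt⟩) (hpos x hgt)
    · have hneg : ε₁ = -ε₂ := by
        rcases h1 with h1 | h1 <;> rcases h3 with h3 | h3 <;> simp_all
      refine ⟨insert z Z', Finset.insert_subset_insert _ hZ', ε₂, h3, fun x hx hxZ => ?_⟩
      obtain ⟨hxZ, hlt | hgt⟩ := hsplit x hxZ
      · have := h2 x ⟨hx, hlt⟩ hxZ
        rw [eval_nod, Finset.prod_insert hzZ', ← eval_nod]
        rw [hneg] at this
        nlinarith [mul_pos this (sub_pos.2 hlt)]
      · rw [eval_nod, Finset.prod_insert hzZ', ← eval_nod]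
        have := mul_pos (mul_pos (h4 x ⟨hx, hgt⟩) (hpos x hgt)) (sub_pos.2 hgt)
        linarith

lemma integral_ne_zero_of_pos_off {θ : Measure ℝ} {I : Set ℝ} (hI : IsCompact I) (hθ : Conc θ I)
    {f : ℝ → ℝ} (hf : ContinuousOn f I) (Z : Finset ℝ) (h : ∀ x ∈ I, x ∉ Z → 0 < f x)
    (hZ : ∀ x ∈ I, x ∈ Z → f x = 0) : 0 < ∫ x, f x ∂θ := by
  have := hθ.fin
  have hnn : ∀ x ∈ I, 0 ≤ f x := fun x hx => by
    by_cases hxZ : x ∈ Z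
    · exact (hZ x hx hxZ).ge
    · exact (h x hx hxZ).le
  rw [integral_pos_iff_support_of_nonneg_ae ((ae_mem_of_compl hθ.compl).mono fun x hx => hnn x hx)
    (integrable_of_continuousOn hI hθ.compl hf), pos_iff_ne_zero]
  intro h0
  apply hθ.inf Z
  refine measure_mono_null (t := Function.support f ∪ Iᶜ) (fun x hx => ?_)
    (measure_union_null h0 hθ.compl)
  by_cases hxI : x ∈ I
  · exact Or.inl (h x hxI hx).ne'
  · exact Or.inr hxI

lemma zeros_of_orth {θ : Measure ℝ} {a b : ℝ} (hθ : Conc θ (Icc a b)) {g w : ℝ → ℝ}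
    (hg : ContinuousOn g (Icc a b)) (hw : ContinuousOn w (Icc a b))
    (hw0 : ∀ x ∈ Icc a b, w x ≠ 0) (d : ℕ)
    (h : ∀ p : ℝ[X], p.degree < d → ∫ x, g x * p.eval x * w x ∂θ = 0) :
    ∃ Z : Finset ℝ, (Z : Set ℝ) ⊆ Icc a b ∧ Z.card = d ∧ ∀ y ∈ Z, g y = 0 := by
  have hfin := hθ.fin
  by_contra hcon
  push Not at hcon
  have hZfin : {x ∈ Icc a b | g x = 0}.Finite := by
    by_contra hinf
    obtain ⟨Z, h1, h2⟩ := Set.Infinite.exists_subset_card_eq hinf d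
    obtain ⟨y, hy, hy0⟩ := hcon Z (fun x hx => (h1 hx).1) h2
    exact hy0 (h1 hy).2
  set Z := hZfin.toFinset with hZ
  have hmem : ∀ x, x ∈ Z ↔ x ∈ Icc a b ∧ g x = 0 := fun x => by simp [hZ]
  have hcard : Z.card < d := by
    by_contra hle
    obtain ⟨Z₁, h1, h2⟩ := Finset.exists_subset_card_eq (not_lt.1 hle)
    obtain ⟨y, hy, hy0⟩ := hcon Z₁ (fun x hx => ((hmem x).1 (h1 hx)).1) h2
    exact hy0 ((hmem y).1 (h1 hy)).2
  obtain ⟨Z', hZ', ε, -, hpos⟩ := sign_pattern Z (Icc a b) ordConnected_Icc g hg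
    fun x hx hxZ h0 => hxZ ((hmem x).2 ⟨hx, h0⟩)
  obtain ⟨ε', -, hpos'⟩ := sign_on ordConnected_Icc hw hw0
  have h0 := h (nod Z') (by
    rw [degree_nod]
    exact_mod_cast (Finset.card_le_card hZ').trans_lt hcard)
  have hc : ContinuousOn (fun x => (nod Z').eval x) (Icc a b) :=
    (nod Z').continuous.continuousOn
  have hcont : ContinuousOn (fun x => ε * ε' * (g x * (nod Z').eval x * w x)) (Icc a b) :=
    continuousOn_const.mul ((hg.mul hc).mul hw)
  have := integral_ne_zero_of_pos_off isCompact_Icc hθ hcont Z (fun x hx hxZ => by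
    have := mul_pos (hpos x hx hxZ) (hpos' x hx)
    linarith) fun x hx hxZ => by simp [((hmem x).1 hxZ).2]
  rw [integral_const_mul, h0, mul_zero] at this
  exact this.false

/-- Orthogonality to polynomials and to Cauchy kernels gives orthogonality for the divided
weight. -/
lemma orth_div {θ : Measure ℝ} {I : Set ℝ} [IsFiniteMeasure θ] (hI : IsCompact I)
    (h0 : θ Iᶜ = 0) {G : ℝ → ℝ} (hG : ContinuousOn G I) (Z : Finset ℝ)
    (hZ : ∀ y ∈ Z, y ∉ I) (n : ℕ) (h : ∀ p : ℝ[X], p.degree < n → ∫ x, G x * p.eval x ∂θ = 0)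
    (hy : ∀ y ∈ Z, ctR θ G y = 0) (p : ℝ[X]) (hp : p.degree < ((Z.card + n : ℕ) : WithBot ℕ)) :
    ∫ x, G x * p.eval x / (nod Z).eval x ∂θ = 0 := by
  have hIZ : ∀ x ∈ I, x ∉ Z := fun x hx hxZ => hZ x hxZ hx
  set h' := p /ₘ nod Z
  set r := p %ₘ nod Z with hr
  have hmod := modByMonic_add_div p (nod Z)
  have hrdeg : r.degree < Z.card := by
    rw [← degree_nod]
    exact degree_modByMonic_lt _ (nod_monic Z)
  have hh : ∫ x, G x * h'.eval x ∂θ = 0 := by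
    refine h _ ?_
    by_cases hd : (nod Z).degree ≤ p.degree
    · have := degree_add_divByMonic (nod_monic Z) hd
      rw [degree_nod] at this
      rw [← this] at hp
      push_cast at hp
      by_contra hcon
      exact (not_lt.2 (add_le_add_right (not_lt.1 hcon) (Z.card : WithBot ℕ))) hp
    · have : h' = 0 := (divByMonic_eq_zero_iff (nod_monic Z)).2 (not_le.1 hd)
      rw [this]
      simp
  have key : ∀ x ∈ I, G x * p.eval x / (nod Z).eval x = G x * h'.eval x +
      ∑ y ∈ Z, -(Lagrange.nodalWeight Z id y * r.eval y) * (G x / (y - x)) := by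
    intro x hx
    have hne := nod_ne (hIZ x hx)
    have e1 : r.eval x = (nod Z).eval x *
        ∑ y ∈ Z, Lagrange.nodalWeight Z id y * (x - y)⁻¹ * r.eval y := by
      conv_lhs => rw [Lagrange.eq_interpolate (f := r) (v := id) (injOn_id _) hrdeg]
      exact Lagrange.eval_interpolate_not_at_node _ fun y hy h => hIZ x hx (by rwa [h])
    have e2 : p.eval x = r.eval x + (nod Z).eval x * h'.eval x := by
      conv_lhs => rw [← hmod]
      rw [eval_add, eval_mul]
    rw [e2, e1, mul_div_assoc, ← mul_add, mul_div_cancel_left₀ _ hne, mul_add, add_comm,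
      Finset.mul_sum]
    congr 1
    refine Finset.sum_congr rfl fun y hy => ?_
    have : y - x = -(x - y) := by ring
    rw [this, div_neg, div_eq_mul_inv]
    ring
  have hi1 : Integrable (fun x => G x * h'.eval x) θ :=
    integrable_of_continuousOn hI h0 (hG.mul h'.continuous.continuousOn)
  have hi2 : ∀ y ∈ Z, Integrable (fun x =>
      -(Lagrange.nodalWeight Z id y * r.eval y) * (G x / (y - x))) θ := fun y hy =>
    (integrable_of_continuousOn hI h0 (hG.div (by fun_prop) fun x hx h =>
      hZ y hy (by rwa [sub_eq_zero.1 h]))).const_mul _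
  rw [integral_congr_on h0 key, integral_add hi1 (integrable_finsetSum _ hi2), hh, zero_add,
    integral_finsetSum _ hi2]
  refine Finset.sum_eq_zero fun y hyZ => ?_
  rw [integral_const_mul]
  have := hy y hyZ
  unfold ctR at this
  rw [this, mul_zero]

section

variable {S : Sys} {m q : ℕ} {J : Finset ℕ}

/-- Continuous nonvanishing weights on `S.I q` whose ratios are the ratios of the
vectors vanishing on `J`. -/
structure Wts (S : Sys) (m q : ℕ) (J : Finset ℕ) (X : ℕ → ℝ → ℝ) : Prop where
  sub : J ⊆ Finset.Icc 0 m
  card : q = J.card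
  cont : ∀ k ∈ Finset.Icc 0 m \ J, ContinuousOn (X k) (S.I q)
  ne : ∀ k ∈ Finset.Icc 0 m \ J, ∀ t ∈ S.I q, X k t ≠ 0
  link : ∀ k ∈ Finset.Icc 0 m \ J, ∀ b ∈ Finset.Icc 0 m \ J,
    ∀ t ∈ S.I q, ∀ F : ℂ → ℂ, ContinuousAt F t → IsRatio S 0 J k b F → (X k t : ℂ) = X b t * F t

lemma wts_base (S : Sys) (m : ℕ) : Wts S m 0 ∅ (fun k => S.uR k 0) where
  sub := by simp
  card := rfl
  cont k _ := S.uR_cont k 0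
  ne k _ t ht := S.uR_ne k 0 ht
  link k _ b _ t ht F hF hr := by
    have := eq_of_eq_upper (x := t) (F := S.U 0 k) (G := fun z => S.U 0 b z * F z)
      (S.U_continuousAt 0 k ht) ((S.U_continuousAt 0 b ht).mul hF)
      fun z hz => hr z hz _ (isVec_U S 0 z)
    rw [S.U_ofReal (Nat.zero_le _), S.U_ofReal (Nat.zero_le _)] at this
    exact this

lemma eval_sub_eval_div (p : ℝ[X]) (t : ℝ) {d : ℕ} (hp : p.degree < d) :
    ∃ h : ℝ[X], h.degree < d ∧ ∀ x, p.eval x = (x - t) * h.eval x + p.eval t := by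
  refine ⟨p /ₘ (X - C t), (degree_divByMonic_le _ _).trans_lt hp, fun x => ?_⟩
  conv_lhs => rw [← modByMonic_add_div p (X - C t)]
  rw [modByMonic_X_sub_C_eq_C_eval]
  simp
  ring

lemma peel_one {X : ℕ → ℝ → ℝ} (hX : Wts S m q J X) {θ : Measure ℝ} (hθ : Conc θ (S.I q))
    {g : ℝ → ℝ} (hg : ContinuousOn g (S.I q)) {n : ℕ → ℕ}
    (horth : ∀ k ∈ Finset.Icc 0 m \ J, ∀ p : ℝ[X], p.degree < n k →
      ∫ x, g x * p.eval x * X k x ∂θ = 0) {j : ℕ} (hj : j ∈ Finset.Icc 0 m \ J)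
    (hn : ∀ k ∈ Finset.Icc 0 m \ insert j J, n k ≤ n j ∧ (k < j → n k < n j)) :
    ∃ τ N, Wts S m (q + 1) (insert j J) N ∧ Conc τ (S.I (q + 1)) ∧
      ∀ k ∈ Finset.Icc 0 m \ insert j J, ∀ p : ℝ[X], p.degree < n k →
        ∫ t, ctR θ (fun x => g x * X j x) t * p.eval t * N k t ∂τ = 0 := by
  have hfθ := hθ.fin
  obtain ⟨hj1, hjJ⟩ := Finset.mem_sdiff.1 hj
  obtain ⟨⟨τ, N, α, β, hd⟩, -⟩ := full S m J hX.sub j hj1 hjJ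
  rw [zero_add, ← hX.card] at hd
  have hfτ := hd.conc.fin
  have hdis := S.disjoint_I q
  have hsub : ∀ k ∈ Finset.Icc 0 m \ insert j J, k ∈ Finset.Icc 0 m \ J := by
    intro k hk
    simp only [Finset.mem_sdiff, Finset.mem_insert, not_or] at hk ⊢
    exact ⟨hk.1, hk.2.2⟩
  have hgX : ContinuousOn (fun x => g x * X j x) (S.I q) := hg.mul (hX.cont j hj)
  refine ⟨τ, N, ⟨Finset.insert_subset hj1 hX.sub, ?_, hd.cont, hd.ne, hd.link⟩, hd.conc, ?_⟩
  · rw [Finset.card_insert_of_notMem hjJ, hX.card]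
  intro k hk p hp
  have hNk := hd.cont k hk
  obtain ⟨hn1, hn2⟩ := hn k hk
  have hval : ∀ x ∈ S.I q, X k x = X j x * (α k * x + β k + ctR τ (N k) x) := by
    intro x hx
    have hxI : (x : ℂ) ∉ ((↑) : ℝ → ℂ) '' S.I (q + 1) :=
      ofReal_notMem fun h => hdis.le_bot ⟨hx, h⟩
    have := hX.link k (hsub k hk) j hj x hx (fun z => α k * z + β k + ct τ (N k) z)
      (ContinuousAt.add (by fun_prop) (ct_continuousAt (S.isCompact_I _) hd.conc.compl hNk hxI))
      (hd.ratio k hk)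
    rw [ct_ofReal] at this
    exact_mod_cast this
  have hpc : ContinuousOn (fun x => p.eval x) (S.I q) := p.continuous.continuousOn
  have hcc : ContinuousOn (fun x => g x * p.eval x * X j x * ctR τ (N k) x) (S.I q) :=
    ((hg.mul hpc).mul (hX.cont j hj)).mul
      (ctR_continuousOn (S.isCompact_I _) hd.conc.compl hNk hdis)
  have haff : ∫ x, g x * (p * (C (α k) * Polynomial.X + C (β k))).eval x * X j x ∂θ = 0 := by
    refine horth j hj _ ?_
    by_cases hp0 : p = 0
    · simp [hp0]
    rw [degree_mul]
    have hpd : p.degree < n j := hp.trans_le (by exact_mod_cast hn1)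
    by_cases hα : α k = 0
    · rw [hα]
      simp only [map_zero, zero_mul, zero_add]
      calc p.degree + (C (β k)).degree ≤ p.degree + 0 := by
            gcongr
            exact degree_C_le
        _ < n j := by rwa [add_zero]
    · have hkj : k < j := by
        have := hd.hα k hk hα
        omega
      calc p.degree + (C (α k) * Polynomial.X + C (β k)).degree ≤ p.degree + 1 := by
            gcongr
            exact degree_linear_le
        _ ≤ n k := by
            rw [degree_eq_natDegree hp0] at hp ⊢
            have : p.natDegree < n k := by exact_mod_cast hp
            exact_mod_cast this
        _ < n j := by exact_mod_cast hn2 hkj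
  have hI1 : Integrable (fun x => g x * (p * (C (α k) * Polynomial.X + C (β k))).eval x * X j x)
      θ := integrable_of_continuousOn (S.isCompact_I _) hθ.compl
    ((hg.mul (Polynomial.continuous _).continuousOn).mul (hX.cont j hj))
  have h0 : ∫ x, g x * p.eval x * X j x * ctR τ (N k) x ∂θ = 0 := by
    have h1 := horth k (hsub k hk) p hp
    have h2 : ∀ x ∈ S.I q, g x * p.eval x * X k x =
        g x * (p * (C (α k) * Polynomial.X + C (β k))).eval x * X j x +
          g x * p.eval x * X j x * ctR τ (N k) x := by
      intro x hx
      rw [hval x hx]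
      simp
      ring
    rw [integral_congr_on hθ.compl h2, integral_add hI1
      (integrable_of_continuousOn (S.isCompact_I _) hθ.compl hcc), haff, zero_add] at h1
    exact h1
  have h3 : ∫ x, g x * p.eval x * X j x * ctR τ (N k) x ∂θ =
      ∫ t, ∫ x, g x * p.eval x * X j x * (N k t / (x - t)) ∂θ ∂τ := by
    rw [← integral_swap_on (S.isCompact_I _) (S.isCompact_I _) hθ.compl hd.conc.compl]
    · congr 1
      ext x
      unfold ctR
      rw [← integral_const_mul]
    · have c1 : ContinuousOn (fun y : ℝ × ℝ => g y.1 * p.eval y.1 * X j y.1)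
          (S.I q ×ˢ S.I (q + 1)) := ContinuousOn.comp (g := fun x => g x * p.eval x * X j x)
        ((hg.mul hpc).mul (hX.cont j hj)) continuousOn_fst fun y hy => hy.1
      have c2 : ContinuousOn (fun y : ℝ × ℝ => N k y.2) (S.I q ×ˢ S.I (q + 1)) :=
        hNk.comp continuousOn_snd fun y hy => hy.2
      exact c1.mul (c2.div (by fun_prop) fun y hy => sub_ne_of_disjoint hdis hy.1 hy.2)
  have h4 : ∀ t ∈ S.I (q + 1), ∫ x, g x * p.eval x * X j x * (N k t / (x - t)) ∂θ =
      -(ctR θ (fun x => g x * X j x) t * p.eval t * N k t) := by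
    intro t ht
    obtain ⟨h, hh, hp'⟩ := eval_sub_eval_div p t (hp.trans_le (by exact_mod_cast hn1) :
      p.degree < (n j : ℕ))
    have e : ∀ x ∈ S.I q, g x * p.eval x * X j x * (N k t / (x - t)) =
        N k t * (g x * h.eval x * X j x) + -(p.eval t * N k t) * (g x * X j x / (t - x)) := by
      intro x hx
      have hne := sub_ne_of_disjoint hdis hx ht
      have hne' := sub_ne_of_disjoint hdis.symm ht hx
      rw [hp' x]
      have : t - x = -(x - t) := by ring
      rw [this]
      field_simp
    have i1 : Integrable (fun x => N k t * (g x * h.eval x * X j x)) θ :=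
      (integrable_of_continuousOn (S.isCompact_I _) hθ.compl
        ((hg.mul h.continuous.continuousOn).mul (hX.cont j hj))).const_mul _
    have i2 : Integrable (fun x => -(p.eval t * N k t) * (g x * X j x / (t - x))) θ :=
      (integrable_of_continuousOn (S.isCompact_I _) hθ.compl
        (hgX.div (by fun_prop) fun x hx => sub_ne_of_disjoint hdis.symm ht hx)).const_mul _
    rw [integral_congr_on hθ.compl e, integral_add i1 i2, integral_const_mul, integral_const_mul,
      horth j hj h hh, ctR]
    ring
  rw [h3, integral_congr_on hd.conc.compl h4, integral_neg, neg_eq_zero] at h0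
  exact h0

lemma exists_leftmost_max {A : Finset ℕ} (hA : A.Nonempty) (n : ℕ → ℕ) :
    ∃ j ∈ A, ∀ k ∈ A, n k ≤ n j ∧ (k < j → n k < n j) := by
  obtain ⟨j₀, hj₀, hmax⟩ := A.exists_max_image n hA
  have hne : (A.filter fun k => n k = n j₀).Nonempty := ⟨j₀, by simp [hj₀]⟩
  refine ⟨(A.filter fun k => n k = n j₀).min' hne, ?_⟩
  have hmem := Finset.min'_mem _ hne
  rw [Finset.mem_filter] at hmem
  refine ⟨hmem.1, fun k hk => ⟨by rw [hmem.2]; exact hmax k hk, fun hlt => ?_⟩⟩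
  rw [hmem.2]
  refine lt_of_le_of_ne (hmax k hk) fun h => ?_
  have := Finset.min'_le (A.filter fun k => n k = n j₀) k (Finset.mem_filter.2 ⟨hk, h⟩)
  omega

lemma sdiff_insert_erase (A J : Finset ℕ) (j : ℕ) : A \ insert j J = (A \ J).erase j := by
  ext k
  simp only [Finset.mem_sdiff, Finset.mem_insert, Finset.mem_erase, not_or]
  tauto

/-- Multiple orthogonality forces zeros, and after dividing by the zeros of the transform the
function is orthogonal to polynomials of the total degree. -/
lemma peel_zeros (c : ℕ) : ∀ {q : ℕ} {J : Finset ℕ}, (Finset.Icc 0 m \ J).card = c →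
    ∀ {X : ℕ → ℝ → ℝ}, Wts S m q J X → ∀ {θ : Measure ℝ}, Conc θ (S.I q) →
    ∀ {g : ℝ → ℝ}, ContinuousOn g (S.I q) → ∀ {n : ℕ → ℕ},
    (∀ k ∈ Finset.Icc 0 m \ J, ∀ p : ℝ[X], p.degree < n k →
      ∫ x, g x * p.eval x * X k x ∂θ = 0) →
    (∃ Z : Finset ℝ, (Z : Set ℝ) ⊆ S.I q ∧ Z.card = ∑ k ∈ Finset.Icc 0 m \ J, n k ∧
      ∀ y ∈ Z, g y = 0) ∧
    ∀ j ∈ Finset.Icc 0 m \ J,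
      (∀ k ∈ Finset.Icc 0 m \ insert j J, n k ≤ n j ∧ (k < j → n k < n j)) →
      ∃ Z : Finset ℝ, (Z : Set ℝ) ⊆ S.I (q + 1) ∧
        Z.card = ∑ k ∈ Finset.Icc 0 m \ insert j J, n k ∧
        ∀ p : ℝ[X], p.degree < ((∑ k ∈ Finset.Icc 0 m \ J, n k : ℕ) : WithBot ℕ) →
          ∫ x, g x * X j x * p.eval x / (nod Z).eval x ∂θ = 0 := by
  induction c with
  | zero =>
    intro q J hc X hX θ hθ g hg n horth
    rw [Finset.card_eq_zero] at hc
    rw [hc]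
    exact ⟨⟨∅, by simp⟩, by simp⟩
  | succ c ih =>
    intro q J hc X hX θ hθ g hg n horth
    have hfθ := hθ.fin
    have hdis := S.disjoint_I q
    have key : ∀ j ∈ Finset.Icc 0 m \ J,
      (∀ k ∈ Finset.Icc 0 m \ insert j J, n k ≤ n j ∧ (k < j → n k < n j)) →
      ∃ Z : Finset ℝ, (Z : Set ℝ) ⊆ S.I (q + 1) ∧
        Z.card = ∑ k ∈ Finset.Icc 0 m \ insert j J, n k ∧
        ∀ p : ℝ[X], p.degree < ((∑ k ∈ Finset.Icc 0 m \ J, n k : ℕ) : WithBot ℕ) →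
          ∫ x, g x * X j x * p.eval x / (nod Z).eval x ∂θ = 0 := by
      intro j hj hn
      obtain ⟨τ, N, hN, hτ, ho⟩ := peel_one hX hθ hg horth hj hn
      have hgX : ContinuousOn (fun x => g x * X j x) (S.I q) := hg.mul (hX.cont j hj)
      have hcard : (Finset.Icc 0 m \ insert j J).card = c := by
        rw [sdiff_insert_erase, Finset.card_erase_of_mem hj, hc]
        rfl
      obtain ⟨⟨Z, hZ1, hZ2, hZ3⟩, -⟩ := ih hcard hN hτ
        (ctR_continuousOn (S.isCompact_I _) hθ.compl hgX hdis.symm) ho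
      refine ⟨Z, hZ1, hZ2, fun p hp => ?_⟩
      refine orth_div (S.isCompact_I _) hθ.compl hgX Z
        (fun y hy h => hdis.le_bot ⟨h, hZ1 hy⟩) (n j) (fun p hp => ?_) hZ3 p ?_
      · rw [← horth j hj p hp]
        congr 1
        ext x
        ring
      · rwa [hZ2, sdiff_insert_erase, Finset.sum_erase_add _ _ hj]
    refine ⟨?_, key⟩
    obtain ⟨j, hj, hmax⟩ := exists_leftmost_max (A := Finset.Icc 0 m \ J)
      (Finset.card_pos.1 (by omega)) n
    obtain ⟨Z, hZ1, hZ2, hZ3⟩ := key j hj fun k hk => hmax k (by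
      rw [sdiff_insert_erase] at hk
      exact Finset.mem_of_mem_erase hk)
    have hZne : ∀ x ∈ S.I q, (nod Z).eval x ≠ 0 := fun x hx =>
      nod_ne fun h => hdis.le_bot ⟨hx, hZ1 h⟩
    refine zeros_of_orth hθ hg (w := fun x => X j x / (nod Z).eval x)
      ((hX.cont j hj).div (Polynomial.continuous _).continuousOn hZne)
      (fun x hx => div_ne_zero (hX.ne j hj x hx) (hZne x hx)) _ fun p hp => ?_
    rw [← hZ3 p hp]
    congr 1
    ext x
    ring

end

lemma supp_subset_Icc {s : SignedM} {Δ : Set ℝ} (h : IsM s Δ) : s.supp ⊆ Δ := by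
  rw [h.hullEq]
  exact fun x hx => ⟨csInf_le h.compactSupp.bddBelow hx, le_csSup h.compactSupp.bddAbove hx⟩

lemma null_of_disjoint_msupport {μ : Measure ℝ} {U : Set ℝ}
    (h : ∀ x ∈ U, x ∉ SignedM.msupport μ) : μ U = 0 := by
  refine measure_null_of_locally_null U fun x hx => ?_
  have := h x hx
  simp only [SignedM.msupport, mem_ofPred_eq, not_forall] at this
  obtain ⟨V, hV, hxV, h0⟩ := this
  exact ⟨V, mem_nhdsWithin_of_mem_nhds (hV.mem_nhds hxV), not_not.1 h0⟩

lemma conc_of_isM {s : SignedM} {Δ : Set ℝ} (h : IsM s Δ) : Conc (s.pos + s.neg) Δ := by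
  have h1 := h.posFinite
  have h2 := h.negFinite
  refine ⟨inferInstance, ?_, fun F hF => ?_⟩
  · rw [Measure.add_apply, null_of_disjoint_msupport, null_of_disjoint_msupport, add_zero]
    · exact fun x hx hs => hx (supp_subset_Icc h (Or.inr hs))
    · exact fun x hx hs => hx (supp_subset_Icc h (Or.inl hs))
  · rw [Measure.add_apply, add_eq_zero] at hF
    refine h.infiniteSupp (F.finite_toSet.subset ?_)
    have hO : IsOpen ((F : Set ℝ)ᶜ) := F.finite_toSet.isClosed.isOpen_compl
    rintro x (hx | hx) <;> by_contra hxF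
    · exact hx _ hO hxF hF.1
    · exact hx _ hO hxF hF.2

lemma conc_volume {a b : ℝ} (h : a < b) : Conc (volume.restrict (Icc a b)) (Icc a b) := by
  refine ⟨⟨by simp⟩, ?_, fun F hF => ?_⟩
  · rw [Measure.restrict_apply measurableSet_Icc.compl]
    simp
  · have h1 : volume (F : Set ℝ) = 0 := F.finite_toSet.measure_zero _
    rw [Measure.restrict_apply F.finite_toSet.measurableSet.compl] at hF
    have h2 : volume (Icc a b) ≤ 0 := by
      calc volume (Icc a b) ≤ volume ((F : Set ℝ)ᶜ ∩ Icc a b ∪ F) := by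
            refine measure_mono fun x hx => ?_
            by_cases hF : x ∈ (F : Set ℝ)
            · exact Or.inr hF
            · exact Or.inl ⟨hF, hx⟩
        _ ≤ _ := measure_union_le _ _
        _ = 0 := by rw [hF, h1, add_zero]
    rw [Real.volume_Icc, nonpos_iff_eq_zero, ENNReal.ofReal_eq_zero] at h2
    linarith

/-- Extension of finitely many measures to an infinite sequence on consecutively disjoint
intervals. -/
lemma exists_sys {m : ℕ} {σ : ℕ → SignedM} {Δ : ℕ → Set ℝ} (hσ : ∀ j ≤ m, IsM (σ j) (Δ j))
    (hdisj : ∀ j, j + 1 ≤ m → Δ j ∩ Δ (j + 1) = ∅) :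
    ∃ S : Sys, ∀ j ≤ m, S.I j = Δ j ∧ S.μ j = (σ j).pos + (σ j).neg := by
  set M := sSup (σ m).supp with hM
  have hgt : ∀ q, m < q → (m : ℝ) + 1 ≤ q := fun q hq => by exact_mod_cast hq
  refine ⟨⟨fun q => if q ≤ m then sInf (σ q).supp else M + 2 * (q - m) - 1,
    fun q => if q ≤ m then sSup (σ q).supp else M + 2 * (q - m),
    fun q => if q ≤ m then (σ q).pos + (σ q).neg else
      volume.restrict (Icc (M + 2 * (q - m) - 1) (M + 2 * (q - m))), ?_, ?_⟩, ?_⟩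
  · intro q
    by_cases hq : q ≤ m
    · simp only [hq, if_true]
      rw [← (hσ q hq).hullEq]
      exact conc_of_isM (hσ q hq)
    · simp only [hq, if_false]
      exact conc_volume (by linarith)
  · intro q
    by_cases hq : q + 1 ≤ m
    · have hq' : q ≤ m := by omega
      simp only [hq, hq', if_true]
      rw [← (hσ q hq').hullEq, ← (hσ _ hq).hullEq, disjoint_iff_inter_eq_empty]
      exact hdisj q hq
    · rw [Set.disjoint_left]
      intro x hx hx'
      simp only [hq, if_false] at hx'
      push_cast at hx'
      by_cases hq' : q ≤ m
      · have : q = m := by omega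
        subst this
        simp only [le_refl, if_true] at hx
        have h1 := hx.2
        have h2 := hx'.1
        linarith
      · simp only [hq', if_false] at hx
        have h1 := hx.2
        have h2 := hx'.1
        linarith
  · intro j hj
    refine ⟨?_, by simp only [hj, if_true]⟩
    rw [(hσ j hj).hullEq]
    simp only [Sys.I, hj, if_true]

lemma integral_withDensity_sub {E : Type*} [NormedAddCommGroup E] [NormedSpace ℝ E]
    {μ : Measure ℝ} [IsFiniteMeasure μ] {I : Set ℝ}
    (hI : IsCompact I) (h0 : μ Iᶜ = 0) {h : ℝ → ℝ} (hh : ContinuousOn h I) {f : ℝ → E}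
    (hf : ContinuousOn f I) :
    (∫ x, f x ∂(μ.withDensity fun x => ENNReal.ofReal (h x))) -
      ∫ x, f x ∂(μ.withDensity fun x => ENNReal.ofReal (-h x)) = ∫ x, h x • f x ∂μ := by
  have hm : AEMeasurable h μ :=
    (integrable_of_continuousOn hI h0 hh).aestronglyMeasurable.aemeasurable
  rw [integral_withDensity_eq_integral_toReal_smul₀ hm.ennreal_ofReal (ae_of_all _ fun x => by simp),
    integral_withDensity_eq_integral_toReal_smul₀ (f := fun x => ENNReal.ofReal (-h x))
      hm.neg.ennreal_ofReal
      (ae_of_all _ fun x => by simp), ← integral_sub]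
  · congr 1
    ext x
    rw [← sub_smul, ENNReal.toReal_ofReal', ENNReal.toReal_ofReal']
    congr 1
    rcases le_total 0 (h x) with h | h
    · rw [max_eq_left h, max_eq_right (by linarith), sub_zero]
    · rw [max_eq_right h, max_eq_left (by linarith), zero_sub, neg_neg]
  · simp only [ENNReal.toReal_ofReal']
    exact integrable_of_continuousOn hI h0 ((hh.sup continuousOn_const).smul hf)
  · simp only [ENNReal.toReal_ofReal']
    exact integrable_of_continuousOn hI h0 ((hh.neg.sup continuousOn_const).smul hf)

lemma nikSys_density {m : ℕ} {σ : ℕ → SignedM} {Δ : ℕ → Set ℝ} (hσ : ∀ j ≤ m, IsM (σ j) (Δ j))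
    {S : Sys} (hS : ∀ j ≤ m, S.I j = Δ j ∧ S.μ j = (σ j).pos + (σ j).neg) (d : ℕ) :
    ∀ j, j + d ≤ m → ∃ ε : ℝ, (ε = 1 ∨ ε = -1) ∧
      (nikSys σ j (j + d)).pos =
        (S.μ j).withDensity (fun x => ENNReal.ofReal (ε * S.uR d j x)) ∧
      (nikSys σ j (j + d)).neg =
        (S.μ j).withDensity (fun x => ENNReal.ofReal (-(ε * S.uR d j x))) := by
  induction d with
  | zero =>
    intro j hj
    obtain ⟨-, hμ⟩ := hS j hj
    have e : nikSys σ j (j + 0) = σ j := by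
      rw [nikSys]
      simp
    rw [e, hμ]
    rcases (hσ j hj).constSign with h | h
    · refine ⟨-1, Or.inr rfl, ?_, ?_⟩ <;> simp [h, Sys.uR]
      rw [ENNReal.ofReal_of_nonpos (by norm_num), zero_smul]
    · refine ⟨1, Or.inl rfl, ?_, ?_⟩ <;> simp [h, Sys.uR]
      rw [ENNReal.ofReal_of_nonpos (by norm_num), zero_smul]
  | succ d ih =>
    intro j hj
    obtain ⟨-, hμ⟩ := hS j (by omega)
    obtain ⟨ε, hε, hp, hn⟩ := ih (j + 1) (by omega)
    have e : nikSys σ j (j + (d + 1)) = (σ j).nik (nikSys σ (j + 1) (j + 1 + d)) := by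
      rw [nikSys, dif_pos (by omega), show j + (d + 1) = j + 1 + d by omega]
    set T := nikSys σ (j + 1) (j + 1 + d)
    have hg : ∀ x ∈ S.I j, T.cauchyR x = ε * S.uR (d + 1) j x := by
      intro x hx
      unfold SignedM.cauchyR SignedM.rintegral
      have c1 : ContinuousOn (fun t => ε * S.uR d (j + 1) t) (S.I (j + 1)) :=
        continuousOn_const.mul (S.uR_cont d (j + 1))
      have c2 : ContinuousOn (fun t => (x - t)⁻¹) (S.I (j + 1)) :=
        ContinuousOn.inv₀ (by fun_prop) fun t ht => sub_ne_of_disjoint (S.disjoint_I j) hx ht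
      rw [hp, hn, integral_withDensity_sub (S.isCompact_I (j + 1)) (S.compl_I _) c1 c2]
      simp only [smul_eq_mul, mul_assoc]
      rw [integral_const_mul]
      rfl
    have h1 : ∀ ν : ℝ, (S.μ j).withDensity (fun x => ENNReal.ofReal (ν * T.cauchyR x)) =
        (S.μ j).withDensity (fun x => ENNReal.ofReal (ν * (ε * S.uR (d + 1) j x))) := by
      intro ν
      refine withDensity_congr_ae ((ae_mem_of_compl (S.compl_I j)).mono fun x hx => ?_)
      simp only [hg x hx]
    have h2 := h1 1
    have h3 := h1 (-1)
    simp only [one_mul, neg_one_mul] at h2 h3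
    rw [e]
    unfold SignedM.nik SignedM.withDensityR
    rcases (hσ j (by omega)).constSign with h | h
    · rw [h, zero_add] at hμ
      refine ⟨-ε, by rcases hε with h | h <;> simp [h], ?_, ?_⟩
      · simp only [h, withDensity_zero_left, zero_add, ← hμ, neg_mul]
        exact h3
      · simp only [h, withDensity_zero_left, zero_add, ← hμ, neg_mul, neg_neg]
        exact h2
    · rw [h, add_zero] at hμ
      refine ⟨ε, hε, ?_, ?_⟩
      · simp only [h, withDensity_zero_left, add_zero, ← hμ]
        exact h2
      · simp only [h, withDensity_zero_left, add_zero, ← hμ]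
        exact h3

lemma nikSys_cauchy {m : ℕ} {σ : ℕ → SignedM} {Δ : ℕ → Set ℝ} (hσ : ∀ j ≤ m, IsM (σ j) (Δ j))
    {S : Sys} (hS : ∀ j ≤ m, S.I j = Δ j ∧ S.μ j = (σ j).pos + (σ j).neg) {k : ℕ} (hk : k ≤ m) :
    ∃ ε : ℝ, (ε = 1 ∨ ε = -1) ∧ ∀ z : ℂ, z ∉ ((↑) : ℝ → ℂ) '' S.I 0 →
      (nikSys σ 0 k).cauchy z = ε * ct (S.μ 0) (S.uR k 0) z := by
  obtain ⟨ε, hε, hp, hn⟩ := nikSys_density hσ hS k 0 (by omega)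
  rw [zero_add] at hp hn
  refine ⟨ε, hε, fun z hz => ?_⟩
  unfold SignedM.cauchy SignedM.cintegral
  have c1 : ContinuousOn (fun t => ε * S.uR k 0 t) (S.I 0) :=
    continuousOn_const.mul (S.uR_cont k 0)
  have c2 : ContinuousOn (fun t : ℝ => (z - (t : ℂ))⁻¹) (S.I 0) :=
    ContinuousOn.inv₀ (by fun_prop) fun t ht => sub_ne_of_notMem hz ht
  rw [hp, hn, integral_withDensity_sub (S.isCompact_I 0) (S.compl_I 0) c1 c2, ct,
    ← integral_const_mul]
  congr 1
  ext x
  rw [Complex.real_smul]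
  push_cast
  ring

/-- The order of vanishing of the remainder at infinity is equivalent to orthogonality. -/
lemma orth_of_bound {μ : Measure ℝ} [IsFiniteMeasure μ] {I : Set ℝ} (hI : IsCompact I)
    (h0 : μ Iᶜ = 0) {w : ℝ → ℝ} (hw : ContinuousOn w I) {Q P : ℝ[X]} {n : ℕ} {C R : ℝ}
    (h : ∀ z : ℂ, z ∉ ((↑) : ℝ → ℂ) '' I → R ≤ ‖z‖ →
      ‖aeval z Q * ct μ w z - aeval z P‖ ≤ C / ‖z‖ ^ (n + 1)) :
    (∀ z : ℂ, z ∉ ((↑) : ℝ → ℂ) '' I →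
      aeval z Q * ct μ w z - aeval z P = ct μ (fun x => Q.eval x * w x) z) ∧
    ∀ p : ℝ[X], p.degree < n → ∫ x, Q.eval x * p.eval x * w x ∂μ = 0 := by
  have hintg : ∀ q : ℝ[X], Integrable (fun t => q.eval t * w t) μ := fun q =>
    integrable_of_continuousOn hI h0 (q.continuous.continuousOn.mul hw)
  have hQw : ContinuousOn (fun t => Q.eval t * w t) I := Q.continuous.continuousOn.mul hw
  have hlim : Tendsto (fun y : ℝ => C * y⁻¹) atTop (𝓝 0) := by
    simpa using tendsto_inv_atTop_zero.const_mul C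
  have hnorm : ∀ y : ℝ, 0 < y → ‖(y : ℂ) * Complex.I‖ = y := fun y hy => by
    simp [abs_of_pos hy]
  have hbd : ∀ ν ≤ n, Tendsto (fun y : ℝ => ((y : ℂ) * Complex.I) ^ ν *
      (aeval ((y : ℂ) * Complex.I) Q * ct μ w (y * Complex.I) - aeval ((y : ℂ) * Complex.I) P))
      atTop (𝓝 0) := by
    intro ν hν
    refine squeeze_zero_norm' ?_ hlim
    filter_upwards [eventually_ge_atTop 1, eventually_ge_atTop R] with y hy hyR
    have hy0 : 0 < y := by linarith
    have h1 := h _ (mul_I_notMem hy0 I) (by rwa [hnorm y hy0])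
    rw [norm_mul, norm_pow, hnorm y hy0]
    rw [hnorm y hy0] at h1
    have hC : 0 ≤ C / y ^ (n + 1) := (norm_nonneg _).trans h1
    calc _ ≤ y ^ n * (C / y ^ (n + 1)) :=
          mul_le_mul (pow_le_pow_right₀ hy hν) h1 (norm_nonneg _) (by positivity)
      _ = C * y⁻¹ := by field_simp; ring
  obtain ⟨r, hr⟩ := poly_mul_ct hI h0 hw Q
  have h1 : r - P = 0 := by
    refine poly_eq_zero_of_tendsto ?_
    have h2 := (hbd 0 (Nat.zero_le _)).sub (ct_tendsto_zero (hintg Q))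
    rw [sub_zero] at h2
    refine h2.congr' ?_
    filter_upwards [eventually_gt_atTop 0] with y hy
    rw [hr _ (mul_I_notMem hy I), map_sub]
    ring
  have h3 : ∀ z : ℂ, z ∉ ((↑) : ℝ → ℂ) '' I →
      aeval z Q * ct μ w z - aeval z P = ct μ (fun x => Q.eval x * w x) z := fun z hz => by
    rw [hr z hz, sub_eq_zero.1 h1]
    ring
  refine ⟨h3, fun p hp => ?_⟩
  have hmom : ∀ ν < n, ∫ x, Q.eval x * (x ^ ν * w x) ∂μ = 0 := by
    intro ν hν
    have hiX : ∀ q : ℝ[X], Integrable (fun t => q.eval t * (Q.eval t * w t)) μ := fun q =>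
      integrable_of_continuousOn hI h0 (q.continuous.continuousOn.mul hQw)
    obtain ⟨r', hr'⟩ := poly_mul_ct hI h0 hQw (X ^ ν)
    have h4 : r' = 0 := by
      refine poly_eq_zero_of_tendsto ?_
      have h5 := (hbd ν hν.le).sub (ct_tendsto_zero (hiX (X ^ ν)))
      rw [sub_zero] at h5
      refine h5.congr' ?_
      filter_upwards [eventually_gt_atTop 0] with y hy
      have h6 := hr' _ (mul_I_notMem hy I)
      rw [h3 _ (mul_I_notMem hy I)]
      simp only [map_pow, aeval_X] at h6
      linear_combination h6
    have h7 := mul_ct_tendsto (hiX (X ^ ν))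
    have h8 := tendsto_nhds_unique_of_eventuallyEq h7 (hbd (ν + 1) hν) (by
      filter_upwards [eventually_gt_atTop 0] with y hy
      have h6 := hr' _ (mul_I_notMem hy I)
      rw [h3 _ (mul_I_notMem hy I)]
      simp only [map_pow, aeval_X, h4, map_zero, zero_add] at h6
      rw [← h6]
      ring)
    have h9 : ∫ t, (X ^ ν : ℝ[X]).eval t * (Q.eval t * w t) ∂μ = 0 := by exact_mod_cast h8
    rw [← h9]
    congr 1
    ext t
    simp
    ring
  have hsum : ∀ x, Q.eval x * p.eval x * w x =
      ∑ ν ∈ Finset.range n, p.coeff ν * (Q.eval x * (x ^ ν * w x)) := by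
    intro x
    have : p.eval x = ∑ ν ∈ Finset.range n, p.coeff ν * x ^ ν := by
      rcases eq_or_ne p 0 with rfl | hp0
      · simp
      · exact eval_eq_sum_range' ((natDegree_lt_iff_degree_lt hp0).2 hp) x
    rw [this, Finset.mul_sum, Finset.sum_mul]
    exact Finset.sum_congr rfl fun ν _ => by ring
  simp only [hsum]
  rw [integral_finsetSum]
  · refine Finset.sum_eq_zero fun ν hν => ?_
    rw [integral_const_mul, hmom ν (Finset.mem_range.1 hν), mul_zero]
  · intro ν _
    have a1 : ContinuousOn (fun t => Q.eval t * (t ^ ν * w t)) I :=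
      Q.continuous.continuousOn.mul (ContinuousOn.mul (by fun_prop) hw)
    exact (integrable_of_continuousOn hI h0 a1).const_mul _

/-- The interpolatory quadrature weights of `g dθ` at the nodes `Z`. -/
def qw (θ : Measure ℝ) (g : ℝ → ℝ) (Z : Finset ℝ) (i : ℝ) : ℝ :=
  ∫ x, (Lagrange.basis Z id i).eval x * g x ∂θ

lemma quadrature {θ : Measure ℝ} [IsFiniteMeasure θ] {I : Set ℝ} (hI : IsCompact I)
    (h0 : θ Iᶜ = 0) {g : ℝ → ℝ} (hg : ContinuousOn g I) {Z : Finset ℝ} {M : ℕ}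
    (h : ∀ p : ℝ[X], p.degree < M → ∫ x, (nod Z).eval x * p.eval x * g x ∂θ = 0)
    {p : ℝ[X]} (hp : p.degree < ((Z.card + M : ℕ) : WithBot ℕ)) :
    ∫ x, p.eval x * g x ∂θ = ∑ i ∈ Z, qw θ g Z i * p.eval i := by
  have hintg : ∀ q : ℝ[X], Integrable (fun t => q.eval t * g t) θ := fun q =>
    integrable_of_continuousOn hI h0 (q.continuous.continuousOn.mul hg)
  set h' := p /ₘ nod Z
  set r := p %ₘ nod Z with hr
  have hpe : r + nod Z * h' = p := modByMonic_add_div p (nod Z)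
  have hrd : r.degree < Z.card := by
    rw [← degree_nod]
    exact degree_modByMonic_lt _ (nod_monic Z)
  have hh : h'.degree < M := by
    rcases eq_or_ne p 0 with hp0 | hp0
    · simp [h', hp0, bot_lt_iff_ne_bot]
    · rcases eq_or_ne h' 0 with h0' | h0'
      · rw [h0', degree_zero]; exact bot_lt_iff_ne_bot.2 (by simp)
      · rw [← natDegree_lt_iff_degree_lt h0', natDegree_divByMonic _ (nod_monic Z), natDegree_nod]
        have h1 := (natDegree_lt_iff_degree_lt hp0).2 hp
        have h2 : M ≠ 0 := by
          rintro rfl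
          apply h0'
          refine (divByMonic_eq_zero_iff (nod_monic Z)).2 ?_
          rw [degree_nod]
          simpa using hp
        omega
  have hre : ∀ i ∈ Z, r.eval i = p.eval i := fun i hi => by
    rw [← hpe, eval_add, eval_mul, eval_nod, Finset.prod_eq_zero hi (sub_self i)]
    ring
  have hrI : r = ∑ i ∈ Z, C (p.eval i) * Lagrange.basis Z id i := by
    have := Lagrange.eq_interpolate (s := Z) (v := id) (f := r) Function.injective_id.injOn hrd
    rw [this, Lagrange.interpolate_apply]
    exact Finset.sum_congr rfl fun i hi => by simp [hre i hi]
  have e1 : ∀ x, p.eval x * g x = r.eval x * g x + (nod Z).eval x * h'.eval x * g x := fun x => by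
    conv_lhs => rw [← hpe, eval_add, eval_mul]
    ring
  have i2 : Integrable (fun x => (nod Z).eval x * h'.eval x * g x) θ := by
    simpa using hintg (nod Z * h')
  simp only [e1]
  rw [integral_add (hintg r) i2, h h' hh, add_zero]
  have e2 : ∀ x, r.eval x * g x =
      ∑ i ∈ Z, p.eval i * ((Lagrange.basis Z id i).eval x * g x) := fun x => by
    rw [hrI, eval_finsetSum, Finset.sum_mul]
    exact Finset.sum_congr rfl fun i _ => by rw [eval_mul, eval_C]; ring
  simp only [e2]
  rw [integral_finsetSum]
  · exact Finset.sum_congr rfl fun i _ => by rw [integral_const_mul, qw]; ring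
  · exact fun i _ => (hintg _).const_mul _

/-- Exactness on real polynomials, transferred to difference quotients at complex points. -/
lemma quadrature_cauchy {θ : Measure ℝ} [IsFiniteMeasure θ] {I : Set ℝ} (hI : IsCompact I)
    (h0 : θ Iᶜ = 0) {g : ℝ → ℝ} (hg : ContinuousOn g I) {Z : Finset ℝ} (hZ : (Z : Set ℝ) ⊆ I)
    {l : ℝ → ℝ} {M : ℕ}
    (h : ∀ p : ℝ[X], p.degree < M → ∫ x, p.eval x * g x ∂θ = ∑ i ∈ Z, l i * p.eval i)
    {G : ℝ[X]} (hG : G.natDegree ≤ M) {z : ℂ} (hz : z ∉ ((↑) : ℝ → ℂ) '' I) :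
    aeval z G * (ct θ g z - ∑ i ∈ Z, (l i : ℂ) / (z - i)) =
      ct θ (fun x => G.eval x * g x) z - ∑ i ∈ Z, ((G.eval i * l i : ℝ) : ℂ) / (z - i) := by
  have hC : ∀ p : ℂ[X], (p = 0 ∨ p.natDegree < M) →
      ∫ x, p.eval (x : ℂ) * (g x : ℂ) ∂θ = ∑ i ∈ Z, (l i : ℂ) * p.eval (i : ℂ) := by
    rintro p (rfl | hp)
    · simp
    simp only [eval_eq_sum_range' hp, Finset.sum_mul, Finset.mul_sum]
    rw [integral_finsetSum, Finset.sum_comm]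
    · refine Finset.sum_congr rfl fun ν hν => ?_
      have h1 := h (X ^ ν) (by
        rw [degree_X_pow]; exact_mod_cast Finset.mem_range.1 hν)
      have h2 : ∀ x : ℝ, p.coeff ν * (x : ℂ) ^ ν * (g x : ℂ) =
          p.coeff ν * (((X ^ ν : ℝ[X]).eval x * g x : ℝ) : ℂ) := fun x => by
        push_cast [eval_pow, eval_X]
        ring
      simp only [h2]
      rw [integral_const_mul, integral_complex_ofReal, h1]
      push_cast [eval_pow, eval_X, Finset.mul_sum]
      exact Finset.sum_congr rfl fun i _ => by ring
    · intro ν _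
      have a1 : ContinuousOn (fun x : ℝ => p.coeff ν * (x : ℂ) ^ ν * (g x : ℂ)) I :=
        ContinuousOn.mul (by fun_prop) (Complex.continuous_ofReal.comp_continuousOn hg)
      exact integrable_of_continuousOn hI h0 a1
  set Gc : ℂ[X] := G.map (algebraMap ℝ ℂ) with hGc
  set H := Gc /ₘ (X - C z) with hH
  have hGx : ∀ x : ℝ, Gc.eval (x : ℂ) = ((G.eval x : ℝ) : ℂ) := fun x => by
    rw [hGc]
    exact eval_map_apply (algebraMap ℝ ℂ) x
  have hGz : Gc.eval z = aeval z G := by rw [hGc, eval_map_algebraMap]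
  have hdiv : ∀ x : ℝ, ((G.eval x : ℝ) : ℂ) = (x - z) * H.eval (x : ℂ) + aeval z G := fun x => by
    rw [← hGx, ← hGz]
    conv_lhs => rw [← modByMonic_add_div Gc (X - C z)]
    rw [modByMonic_X_sub_C_eq_C_eval]
    simp [hH]
    ring
  have hHd : H = 0 ∨ H.natDegree < M := by
    rcases eq_or_ne H 0 with h1 | h1
    · exact Or.inl h1
    right
    have h2 : ¬ Gc.natDegree = 0 := fun h2 => h1 (by
      rw [hH, eq_C_of_natDegree_eq_zero h2]
      refine (divByMonic_eq_zero_iff (monic_X_sub_C z)).2 ?_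
      rw [degree_X_sub_C]
      exact degree_C_le.trans_lt (by norm_num))
    have h3 : Gc.natDegree ≤ M := natDegree_map_le.trans hG
    rw [hH, natDegree_divByMonic _ (monic_X_sub_C z), natDegree_X_sub_C]
    omega
  have e1 := hC H hHd
  have hne : ∀ x ∈ I, z - (x : ℂ) ≠ 0 := fun x hx => sub_ne_of_notMem hz hx
  have hHe : ∀ x ∈ I, H.eval (x : ℂ) = (aeval z G - ((G.eval x : ℝ) : ℂ)) / (z - x) := fun x hx => by
    rw [eq_div_iff (hne x hx), hdiv x]
    ring
  have e2 : ∫ x, H.eval (x : ℂ) * (g x : ℂ) ∂θ =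
      aeval z G * ct θ g z - ct θ (fun x => G.eval x * g x) z := by
    unfold ct
    have a1 : ContinuousOn (fun t => G.eval t * g t) I := G.continuous.continuousOn.mul hg
    rw [← integral_const_mul, ← integral_sub ((ct_integrable hI h0 hg hz).const_mul _)
      (ct_integrable hI h0 a1 hz)]
    refine integral_congr_on h0 fun x hx => ?_
    rw [hHe x hx]
    push_cast
    field_simp [hne x hx]
  have e3 : ∑ i ∈ Z, (l i : ℂ) * H.eval (i : ℂ) =
      aeval z G * (∑ i ∈ Z, (l i : ℂ) / (z - i)) -
        ∑ i ∈ Z, ((G.eval i * l i : ℝ) : ℂ) / (z - i) := by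
    rw [Finset.mul_sum, ← Finset.sum_sub_distrib]
    refine Finset.sum_congr rfl fun i hi => ?_
    rw [hHe i (hZ hi)]
    push_cast
    ring
  rw [e2, e3] at e1
  linear_combination e1

lemma aeval_nod (Z : Finset ℝ) (z : ℂ) : aeval z (nod Z) = ∏ y ∈ Z, (z - y) := by
  simp [nod, Lagrange.nodal, map_prod]

/-- The quadrature error for the Cauchy kernel, when all the weights off a small set `T` of nodes
have the same sign. -/
lemma quadrature_error {μ : Measure ℝ} [IsFiniteMeasure μ] {I : Set ℝ} (hI : IsCompact I)
    (h0 : μ Iᶜ = 0) {w : ℝ → ℝ} (hw : ContinuousOn w I) {Z : Finset ℝ} (hZ : (Z : Set ℝ) ⊆ I)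
    {l : ℝ → ℝ} {M : ℕ}
    (h : ∀ p : ℝ[X], p.degree < M → ∫ x, p.eval x * w x ∂μ = ∑ i ∈ Z, l i * p.eval i)
    {T : Finset ℝ} (hT : T ⊆ Z) {η : ℝ} (hη : η = 1 ∨ η = -1) (hl : ∀ i ∈ Z, i ∉ T → 0 ≤ η * l i)
    {s : ℝ[X]} (hs : ∀ x ∈ I, |s.eval x| ≤ 1) (hd1 : 2 * T.card + s.natDegree ≤ M)
    (hd2 : 2 * T.card < M) {L d : ℝ} (hL : ∀ x ∈ I, ∀ y ∈ I, |x - y| ≤ L) (hd : 0 < d) {z : ℂ}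
    (hz : ∀ x ∈ I, d ≤ ‖z - x‖) :
    d ^ (2 * T.card) * ‖aeval z s‖ * ‖ct μ w z - ∑ i ∈ Z, (l i : ℂ) / (z - i)‖ ≤
      2 * (L ^ (2 * T.card) * ∫ x, |w x| ∂μ) / d := by
  have hzI : z ∉ ((↑) : ℝ → ℂ) '' I := by
    rintro ⟨x, hx, rfl⟩
    have := hz x hx
    simp at this
    linarith
  set v := (nod T).eval with hv
  have hvc : Continuous v := (nod T).continuous
  have hvL : ∀ x ∈ I, v x ^ 2 ≤ L ^ (2 * T.card) := fun x hx => by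
    rw [hv]
    beta_reduce
    rw [eval_nod, ← sq_abs, Finset.abs_prod, mul_comm, pow_mul]
    refine pow_le_pow_left₀ (Finset.prod_nonneg fun _ _ => abs_nonneg _) ?_ 2
    rw [← Finset.prod_const]
    exact Finset.prod_le_prod (fun _ _ => abs_nonneg _) fun y hy => hL x hx y (hZ (hT hy))
  have hab : η = 1 ∨ η = -1 → ∀ a : ℝ, 0 ≤ η * a → |a| = η * a := by
    rintro (rfl | rfl) a ha
    · rw [one_mul] at *; exact abs_of_nonneg ha
    · rw [neg_one_mul] at *; exact abs_of_nonpos (by linarith)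
  have c1 : ContinuousOn (fun x => v x ^ 2 * |w x|) I := ContinuousOn.mul (by fun_prop) hw.abs
  have c2 : ContinuousOn (fun x => L ^ (2 * T.card) * |w x|) I := continuousOn_const.mul hw.abs
  set V := ∫ x, v x ^ 2 * |w x| ∂μ with hV
  have hVL : V ≤ L ^ (2 * T.card) * ∫ x, |w x| ∂μ := by
    rw [← integral_const_mul]
    refine integral_mono_ae (integrable_of_continuousOn hI h0 c1)
      (integrable_of_continuousOn hI h0 c2) ((ae_mem_of_compl h0).mono fun x hx => ?_)
    exact mul_le_mul_of_nonneg_right (hvL x hx) (abs_nonneg _)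
  have hn : (nod T ^ 2).natDegree = 2 * T.card := by
    rw [(nod_monic T).natDegree_pow, natDegree_nod]
  have hsum : ∑ i ∈ Z, v i ^ 2 * |l i| ≤ V := by
    have e1 : ∀ i ∈ Z, v i ^ 2 * |l i| = η * (l i * (nod T ^ 2).eval i) := fun i hi => by
      rw [eval_pow]
      by_cases hiT : i ∈ T
      · have : (nod T).eval i = 0 := by rw [eval_nod, Finset.prod_eq_zero hiT (sub_self i)]
        simp [hv, this]
      · rw [hab hη _ (hl i hi hiT)]
        ring
    rw [Finset.sum_congr rfl e1, ← Finset.mul_sum, ← h _ ?_]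
    · rw [← integral_const_mul]
      refine integral_mono_ae (integrable_of_continuousOn hI h0 ?_)
        (integrable_of_continuousOn hI h0 c1) (Eventually.of_forall fun x => ?_)
      · exact continuousOn_const.mul ((nod T ^ 2).continuous.continuousOn.mul hw)
      · simp only [eval_pow]
        rw [mul_left_comm]
        refine mul_le_mul_of_nonneg_left ?_ (sq_nonneg _)
        rcases hη with rfl | rfl
        · simpa using le_abs_self _
        · simpa using neg_le_abs _
    · rw [((nod_monic T).pow 2).ne_zero |> degree_eq_natDegree, hn]
      exact_mod_cast hd2
  have key := quadrature_cauchy hI h0 hw hZ h (G := nod T ^ 2 * s) (z := z)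
    (natDegree_mul_le.trans (by omega)) hzI
  have b1 : ‖ct μ (fun x => (nod T ^ 2 * s).eval x * w x) z‖ ≤ V / d := by
    unfold ct
    rw [hV, ← integral_div]
    refine norm_integral_le_of_norm_le ((integrable_of_continuousOn hI h0 c1).div_const d)
      ((ae_mem_of_compl h0).mono fun x hx => ?_)
    rw [norm_div, Complex.norm_real, Real.norm_eq_abs, abs_mul, eval_mul, eval_pow, abs_mul,
      abs_of_nonneg (sq_nonneg _)]
    gcongr
    · exact mul_le_of_le_one_right (sq_nonneg _) (hs x hx)
    · exact hz x hx
  have b2 : ‖∑ i ∈ Z, (((nod T ^ 2 * s).eval i * l i : ℝ) : ℂ) / (z - i)‖ ≤ V / d := by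
    refine (norm_sum_le _ _).trans (le_trans ?_ (div_le_div_of_nonneg_right hsum hd.le))
    rw [Finset.sum_div]
    refine Finset.sum_le_sum fun i hi => ?_
    rw [norm_div, Complex.norm_real, Real.norm_eq_abs, abs_mul, eval_mul, eval_pow, abs_mul,
      abs_of_nonneg (sq_nonneg _)]
    gcongr
    · exact mul_le_of_le_one_right (sq_nonneg _) (hs i (hZ hi))
    · exact hz i (hZ hi)
  have b3 : d ^ (2 * T.card) * ‖aeval z s‖ ≤ ‖aeval z (nod T ^ 2 * s)‖ := by
    rw [map_mul, map_pow, norm_mul, norm_pow, aeval_nod, norm_prod, mul_comm 2, pow_mul]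
    gcongr
    rw [← Finset.prod_const]
    exact Finset.prod_le_prod (fun _ _ => hd.le) fun y hy => hz y (hZ (hT hy))
  calc _ ≤ ‖aeval z (nod T ^ 2 * s)‖ * ‖ct μ w z - ∑ i ∈ Z, (l i : ℂ) / (z - i)‖ :=
        mul_le_mul_of_nonneg_right b3 (norm_nonneg _)
    _ = _ := by rw [← norm_mul, key]
    _ ≤ V / d + V / d := (norm_sub_le _ _).trans (add_le_add b1 b2)
    _ = 2 * V / d := by ring
    _ ≤ _ := by gcongr

/-- Few quadrature weights have the wrong sign. -/
lemma card_bad_weights {θ : Measure ℝ} {I : Set ℝ} (hI : IsCompact I) (hθ : Conc θ I)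
    {g : ℝ → ℝ} (hg : ContinuousOn g I) {η : ℝ} (hη : ∀ x ∈ I, 0 < η * g x) {Z : Finset ℝ}
    {l : ℝ → ℝ} {M : ℕ}
    (h : ∀ p : ℝ[X], p.degree < M → ∫ x, p.eval x * g x ∂θ = ∑ i ∈ Z, l i * p.eval i) :
    M + 2 * (Z.filter fun i => η * l i ≤ 0).card ≤ 2 * Z.card := by
  by_contra hcon
  set T := Z.filter fun i => η * l i ≤ 0 with hT
  have hc := Finset.card_sdiff_add_card_eq_card (Finset.filter_subset (fun i => η * l i ≤ 0) Z)
  rw [← hT] at hc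
  set p := nod (Z \ T) ^ 2 with hp
  have hpd : p.degree < M := by
    rw [degree_eq_natDegree ((nod_monic _).pow 2).ne_zero, (nod_monic _).natDegree_pow,
      natDegree_nod]
    exact_mod_cast (by omega : 2 * (Z \ T).card < M)
  have h1 := h p hpd
  have hpos : 0 < ∫ x, η * (p.eval x * g x) ∂θ := by
    refine integral_ne_zero_of_pos_off hI hθ
      (continuousOn_const.mul (p.continuous.continuousOn.mul hg)) (Z \ T) ?_ ?_
    · intro x hx hxZ
      have := nod_ne hxZ
      rw [mul_left_comm, hp, eval_pow]
      exact mul_pos (by positivity) (hη x hx)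
    · intro x _ hxZ
      simp only [hp, eval_pow]
      rw [eval_nod, Finset.prod_eq_zero hxZ (sub_self x)]
      simp
  rw [integral_const_mul, h1, Finset.mul_sum] at hpos
  refine absurd hpos (not_lt.2 (Finset.sum_nonpos fun i hi => ?_))
  by_cases hiT : i ∈ T
  · rw [← mul_assoc]
    refine mul_nonpos_of_nonpos_of_nonneg (Finset.mem_filter.1 hiT).2 ?_
    rw [hp, eval_pow]
    positivity
  · rw [hp, eval_pow, eval_nod, Finset.prod_eq_zero (Finset.mem_sdiff.2 ⟨hi, hiT⟩) (sub_self i)]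
    simp

/-- A real polynomial of degree at most two that is larger at a given point than on an interval. -/
lemma exists_separating {a b : ℝ} {z : ℂ} (hz : z ∉ ((↑) : ℝ → ℂ) '' Icc a b) :
    ∃ s : ℝ[X], s.natDegree ≤ 2 ∧ (∀ x ∈ Icc a b, |s.eval x| ≤ 1) ∧ 1 < ‖aeval z s‖ := by
  rcases (Icc a b).eq_empty_or_nonempty with he | hne
  · exact ⟨C 2, by simp, by simp [he], by simp⟩
  have hc : IsCompact (((↑) : ℝ → ℂ) '' Icc a b) := isCompact_Icc.image Complex.continuous_ofReal
  have hd := (hc.isClosed.notMem_iff_infDist_pos (hne.image _)).1 hz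
  set d := Metric.infDist z (((↑) : ℝ → ℂ) '' Icc a b) with hdd
  have hdx : ∀ x ∈ Icc a b, d ^ 2 ≤ (x - z.re) ^ 2 + z.im ^ 2 := fun x hx => by
    have h1 : d ≤ ‖z - x‖ := by
      rw [← dist_eq_norm]
      exact Metric.infDist_le_dist_of_mem (mem_image_of_mem _ hx)
    have h2 : ‖z - x‖ ^ 2 = (x - z.re) ^ 2 + z.im ^ 2 := by
      rw [Complex.sq_norm, Complex.normSq_apply]
      simp
      ring
    rw [← h2]
    exact pow_le_pow_left₀ hd.le h1 2
  set D := (|a - z.re| + |b - z.re|) ^ 2 + d ^ 2 with hD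
  have hDx : ∀ x ∈ Icc a b, (x - z.re) ^ 2 ≤ D := fun x hx => by
    have h1 : |x - z.re| ≤ |a - z.re| + |b - z.re| := by
      rw [abs_le]
      have h2 := neg_abs_le (a - z.re)
      have h3 := le_abs_self (b - z.re)
      have h4 := abs_nonneg (a - z.re)
      have h5 := abs_nonneg (b - z.re)
      constructor <;> linarith [hx.1, hx.2]
    rw [← sq_abs]
    have := pow_le_pow_left₀ (abs_nonneg _) h1 2
    nlinarith [sq_nonneg d]
  have hdpos : 0 < d ^ 2 := by positivity
  have hDd : d ^ 2 ≤ D := by rw [hD]; nlinarith [sq_nonneg (|a - z.re| + |b - z.re|)]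
  set B := D + z.im ^ 2 - d ^ 2 / 2 with hB
  have hBpos : 0 < B := by rw [hB]; nlinarith [sq_nonneg z.im]
  refine ⟨C B⁻¹ * (C D - (X - C z.re) ^ 2), ?_, fun x hx => ?_, ?_⟩
  · compute_degree
  · have h1 : (C B⁻¹ * (C D - (X - C z.re) ^ 2)).eval x = (D - (x - z.re) ^ 2) / B := by
      simp
      ring
    rw [h1, abs_of_nonneg (div_nonneg (by linarith [hDx x hx]) hBpos.le), div_le_one hBpos]
    linarith [hdx x hx]
  · have h1 : aeval z (C B⁻¹ * (C D - (X - C z.re) ^ 2)) = (((D + z.im ^ 2) / B : ℝ) : ℂ) := by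
      have h2 : z - z.re = z.im * Complex.I := by
        apply Complex.ext <;> simp
      simp only [map_mul, map_sub, map_pow, aeval_C, aeval_X, Complex.coe_algebraMap]
      rw [h2, mul_pow, Complex.I_sq]
      push_cast
      ring
    rw [h1, Complex.norm_real, Real.norm_eq_abs]
    refine lt_of_lt_of_le ?_ (le_abs_self _)
    rw [one_lt_div hBpos]
    linarith

/-- A version of `exists_separating` that is uniform on compact sets. -/
lemma exists_separating_compact {a b : ℝ} {K : Set ℂ} (hK : IsCompact K)
    (hKI : K ⊆ (((↑) : ℝ → ℂ) '' Icc a b)ᶜ) :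
    ∃ ρ : ℝ, 0 < ρ ∧ ρ < 1 ∧ ∀ z ∈ K, ∃ s : ℝ[X], s.natDegree ≤ 2 ∧
      (∀ x ∈ Icc a b, |s.eval x| ≤ 1) ∧ 1 ≤ ρ * ‖aeval z s‖ := by
  refine hK.induction_on (p := fun K => ∃ ρ : ℝ, 0 < ρ ∧ ρ < 1 ∧ ∀ z ∈ K, ∃ s : ℝ[X],
    s.natDegree ≤ 2 ∧ (∀ x ∈ Icc a b, |s.eval x| ≤ 1) ∧ 1 ≤ ρ * ‖aeval z s‖) ?_ ?_ ?_ ?_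
  · exact ⟨1 / 2, by norm_num, by norm_num, by simp⟩
  · rintro s t hst ⟨ρ, h0, h1, h2⟩
    exact ⟨ρ, h0, h1, fun z hz => h2 z (hst hz)⟩
  · rintro s t ⟨ρ, h0, h1, h2⟩ ⟨ρ', h0', h1', h2'⟩
    refine ⟨max ρ ρ', lt_max_of_lt_left h0, max_lt h1 h1', ?_⟩
    rintro z (hz | hz)
    · obtain ⟨s, hs1, hs2, hs3⟩ := h2 z hz
      exact ⟨s, hs1, hs2, hs3.trans (mul_le_mul_of_nonneg_right (le_max_left _ _) (norm_nonneg _))⟩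
    · obtain ⟨s, hs1, hs2, hs3⟩ := h2' z hz
      exact ⟨s, hs1, hs2, hs3.trans (mul_le_mul_of_nonneg_right (le_max_right _ _) (norm_nonneg _))⟩
  · intro z hz
    obtain ⟨s, hs1, hs2, hs3⟩ := exists_separating (hKI hz)
    have hpos : 0 < ‖aeval z s‖ := by linarith
    obtain ⟨ρ, hρ1, hρ2⟩ := exists_between (inv_lt_one_of_one_lt₀ hs3)
    have hρ0 : 0 < ρ := (inv_pos.2 hpos).trans hρ1
    have hlt : 1 < ρ * ‖aeval z s‖ := by
      rwa [inv_lt_iff_one_lt_mul₀ hpos] at hρ1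
    have hcont : Continuous fun z : ℂ => ρ * ‖aeval z s‖ := by fun_prop
    exact ⟨{y | 1 < ρ * ‖aeval y s‖}, mem_nhdsWithin_of_mem_nhds
      ((isOpen_lt continuous_const hcont).mem_nhds hlt), ρ, hρ0, hρ2,
      fun y hy => ⟨s, hs1, hs2, le_of_lt hy⟩⟩

lemma exists_dist_pos {a b : ℝ} {K : Set ℂ} (hK : IsCompact K)
    (hKI : K ⊆ (((↑) : ℝ → ℂ) '' Icc a b)ᶜ) :
    ∃ d : ℝ, 0 < d ∧ ∀ z ∈ K, ∀ x ∈ Icc a b, d ≤ ‖z - (x : ℂ)‖ := by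
  have hc : IsCompact (((↑) : ℝ → ℂ) '' Icc a b) := isCompact_Icc.image Complex.continuous_ofReal
  obtain ⟨d, hd, h⟩ := hK.exists_thickening_subset_open hc.isClosed.isOpen_compl hKI
  refine ⟨d, hd, fun z hz x hx => ?_⟩
  by_contra hlt
  rw [not_le, ← dist_eq_norm, dist_comm] at hlt
  exact h (Metric.mem_thickening_iff.2 ⟨z, hz, hlt⟩) (mem_image_of_mem _ hx)

section

lemma eq_C_mul_nod {Q : ℝ[X]} {Z : Finset ℝ} (hd : Q.degree ≤ (Z.card : WithBot ℕ))
    (h : ∀ y ∈ Z, Q.eval y = 0) : ∃ a : ℝ, Q = C a * nod Z := by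
  have hdvd : nod Z ∣ Q := by
    refine Finset.prod_dvd_of_coprime (fun x _ y _ hxy => ?_) fun y hy => ?_
    · exact isCoprime_X_sub_C_of_isUnit_sub (sub_ne_zero.2 hxy).isUnit
    · exact dvd_iff_isRoot.2 (h y hy)
  obtain ⟨q, rfl⟩ := hdvd
  rcases eq_or_ne q 0 with rfl | hq
  · exact ⟨0, by simp⟩
  rw [degree_mul, degree_nod, degree_eq_natDegree hq] at hd
  have : Z.card + q.natDegree ≤ Z.card := by exact_mod_cast hd
  rw [eq_C_of_natDegree_eq_zero (p := q) (by omega)]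
  exact ⟨_, mul_comm _ _⟩

/-- Changing the weight by a factor that is a polynomial multiplies the quadrature weights. -/
lemma qw_mul {θ : Measure ℝ} {I : Set ℝ} (h0 : θ Iᶜ = 0) {g w : ℝ → ℝ} {Z : Finset ℝ} {M : ℕ}
    (h : ∀ p : ℝ[X], p.degree < M → ∫ x, p.eval x * g x ∂θ = ∑ i ∈ Z, qw θ g Z i * p.eval i)
    {W : ℝ[X]} (hw : ∀ x ∈ I, w x = W.eval x * g x) (hW : Z.card + W.natDegree ≤ M) {i : ℝ}
    (hi : i ∈ Z) : qw θ w Z i = W.eval i * qw θ g Z i := by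
  have h1 := h (Lagrange.basis Z id i * W) (by
    refine (degree_mul_le _ _).trans_lt ?_
    rw [Lagrange.degree_basis Function.injective_id.injOn hi]
    have hc := Finset.card_pos.2 ⟨i, hi⟩
    refine (add_le_add_right degree_le_natDegree _).trans_lt ?_
    exact_mod_cast (by omega : Z.card - 1 + W.natDegree < M))
  have h2 : qw θ w Z i = ∫ x, (Lagrange.basis Z id i * W).eval x * g x ∂θ := by
    refine integral_congr_on h0 fun x hx => ?_
    rw [hw x hx, eval_mul]
    ring
  rw [h2, h1, Finset.sum_eq_single i]
  · have := Lagrange.eval_basis_self (s := Z) (v := id) Function.injective_id.injOn hi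
    rw [eval_mul, show (Lagrange.basis Z id i).eval i = 1 from this]
    ring
  · intro j hj hji
    have := Lagrange.eval_basis_of_ne (s := Z) (v := id) (i := i) hji.symm hj
    rw [eval_mul, show (Lagrange.basis Z id i).eval j = 0 from this]
    ring
  · exact fun h => absurd hi h

variable {S : Sys} {m : ℕ}

/-- The error estimate for the type II approximants, with few exceptional nodes. -/
lemma approx_error {n : ℕ → ℕ} {Q P : ℝ[X]} (hQ0 : Q ≠ 0) {N : ℕ}
    (hN : N = ∑ j ∈ Finset.range (m + 1), n j) (hQd : Q.degree ≤ (N : WithBot ℕ))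
    (horth : ∀ k ≤ m, ∀ p : ℝ[X], p.degree < n k →
      ∫ x, Q.eval x * p.eval x * S.uR k 0 x ∂S.μ 0 = 0)
    {k : ℕ} (hk : k ≤ m) {ε : ℝ} (hε : ε = 1 ∨ ε = -1)
    (hrem : ∀ z : ℂ, z ∉ ((↑) : ℝ → ℂ) '' S.I 0 →
      aeval z Q * (ε * ct (S.μ 0) (S.uR k 0) z) - aeval z P =
        ε * ct (S.μ 0) (fun x => Q.eval x * S.uR k 0 x) z)
    {r : ℕ} (hr : 1 ≤ r) (hrn : ∀ j ≤ m, r ≤ n j) :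
    ∃ b : ℕ, 2 * b + (m + 1) * r ≤ N + m ∧ ∀ {L d : ℝ},
      (∀ x ∈ S.I 0, ∀ y ∈ S.I 0, |x - y| ≤ L) → 0 < d → ∀ z : ℂ, (∀ x ∈ S.I 0, d ≤ ‖z - x‖) →
      ∀ s : ℝ[X], (∀ x ∈ S.I 0, |s.eval x| ≤ 1) → 2 * b + s.natDegree ≤ N → 2 * b < N →
        d ^ (2 * b) * ‖aeval z s‖ *
          ‖ε * ct (S.μ 0) (S.uR k 0) z - aeval z P / aeval z Q‖ ≤
            2 * (L ^ (2 * b) * ∫ x, |S.uR k 0 x| ∂S.μ 0) / d := by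
  have hI := S.isCompact_I 0
  have h0 := S.compl_I 0
  have huc := S.uR_cont k 0
  have hrange : Finset.Icc 0 m \ ∅ = Finset.range (m + 1) := by
    ext j
    simp only [Finset.mem_sdiff, Finset.mem_Icc, Finset.mem_range, Finset.notMem_empty,
      not_false_eq_true, and_true]
    omega
  obtain ⟨⟨Z, hZI, hZc, hZ0⟩, -⟩ := peel_zeros _ rfl (wts_base S m) (S.conc 0)
    (g := Q.eval) Q.continuous.continuousOn (n := n) (fun k hk p hp => horth k (by
      rw [hrange, Finset.mem_range] at hk; omega) p hp)
  rw [hrange, ← hN] at hZc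
  set r' : ℕ → ℕ := fun j => if j = k then r else r - 1 with hr'
  have hr'n : ∀ j ≤ m, r' j ≤ n j := fun j hj => by
    have := hrn j hj
    simp only [hr']
    split_ifs <;> omega
  obtain ⟨-, hpeel⟩ := peel_zeros _ rfl (wts_base S m) (S.conc 0)
    (g := Q.eval) Q.continuous.continuousOn (n := r') (fun k hk p hp => by
      rw [hrange, Finset.mem_range] at hk
      exact horth k (by omega) p (hp.trans_le (by exact_mod_cast hr'n k (by omega))))
  obtain ⟨T, hTI, hTc, hTorth⟩ := hpeel k (by rw [hrange, Finset.mem_range]; omega) (by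
    intro j hj
    simp only [Finset.mem_sdiff, Finset.mem_insert, not_or] at hj
    simp only [hr', if_neg hj.2.1, if_true]
    omega)
  have hsdiff : Finset.Icc 0 m \ insert k ∅ = (Finset.range (m + 1)).erase k := by
    rw [← hrange]
    ext j
    simp only [Finset.mem_sdiff, Finset.mem_insert, Finset.mem_erase, Finset.notMem_empty]
    tauto
  have hkm : k ∈ Finset.range (m + 1) := Finset.mem_range.2 (by omega)
  have hTc' : T.card = m * (r - 1) := by
    rw [hTc, hsdiff, Finset.sum_congr rfl (g := fun _ => r - 1), Finset.sum_const,
      Finset.card_erase_of_mem hkm, Finset.card_range, smul_eq_mul, Nat.add_sub_cancel]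
    exact fun j hj => if_neg (Finset.ne_of_mem_erase hj)
  have hsum : ∑ j ∈ Finset.Icc 0 m \ ∅, r' j = T.card + r := by
    rw [hrange, ← Finset.sum_erase_add _ _ hkm, hTc, hsdiff]
    simp [hr']
  rw [hsum] at hTorth
  obtain ⟨a, rfl⟩ := eq_C_mul_nod (by rwa [hZc]) hZ0
  have ha : a ≠ 0 := by
    rintro rfl
    exact hQ0 (by simp)
  have hTI' : ∀ x ∈ S.I 0, x ∉ T := fun x hx hxT =>
    (S.disjoint_I 0).le_bot ⟨hx, hTI hxT⟩
  set u := S.uR k 0 with hu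
  have hun : ∀ x ∈ S.I 0, u x ≠ 0 := fun x hx => S.uR_ne k 0 hx
  set g : ℝ → ℝ := fun x => u x / (nod T).eval x with hg
  have hgc : ContinuousOn g (S.I 0) :=
    huc.div (nod T).continuous.continuousOn fun x hx => nod_ne (hTI' x hx)
  have ex1 : ∀ p : ℝ[X], p.degree < ((Z.card + (T.card + r) : ℕ) : WithBot ℕ) →
      ∫ x, p.eval x * g x ∂S.μ 0 = ∑ i ∈ Z, qw (S.μ 0) g Z i * p.eval i := fun p hp => by
    refine quadrature hI h0 hgc (fun q hq => ?_) hp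
    have h1 := hTorth q hq
    have h2 : ∀ x, (C a * nod Z).eval x * u x * q.eval x / (nod T).eval x =
        a * ((nod Z).eval x * q.eval x * g x) := fun x => by
      rw [eval_mul, eval_C, hg]
      ring
    simp only [h2] at h1
    rw [integral_const_mul] at h1
    exact (mul_eq_zero.1 h1).resolve_left ha
  have ex2 : ∀ p : ℝ[X], p.degree < ((Z.card + n k : ℕ) : WithBot ℕ) →
      ∫ x, p.eval x * u x ∂S.μ 0 = ∑ i ∈ Z, qw (S.μ 0) u Z i * p.eval i := fun p hp => by
    refine quadrature hI h0 huc (fun q hq => ?_) hp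
    have h1 : ∫ x, (C a * nod Z).eval x * q.eval x * u x ∂S.μ 0 = 0 := horth k hk q hq
    have h2 : ∀ x, (C a * nod Z).eval x * q.eval x * u x =
        a * ((nod Z).eval x * q.eval x * u x) := fun x => by
      rw [eval_mul, eval_C]
      ring
    simp only [h2] at h1
    rw [integral_const_mul] at h1
    exact (mul_eq_zero.1 h1).resolve_left ha
  have hord : (S.I 0).OrdConnected := ordConnected_Icc
  obtain ⟨η, hη, hηg⟩ := sign_on hord hgc fun x hx => div_ne_zero (hun x hx) (nod_ne (hTI' x hx))
  obtain ⟨η', hη', hηT⟩ := sign_on hord (nod T).continuous.continuousOn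
    fun x hx => nod_ne (hTI' x hx)
  have hcard := card_bad_weights hI (S.conc 0) hgc hηg ex1
  set B := Z.filter fun i => η * qw (S.μ 0) g Z i ≤ 0 with hB
  have hql : ∀ i ∈ Z, i ∉ B → 0 ≤ (η * η') * qw (S.μ 0) u Z i := fun i hi hiB => by
    rw [qw_mul h0 (w := u) (W := nod T) ex1 (fun x hx => by
      rw [hg]
      field_simp [nod_ne (hTI' x hx)]) (by
      rw [natDegree_nod]
      omega) hi]
    · have h1 : 0 < η * qw (S.μ 0) g Z i := by
        by_contra h1
        exact hiB (Finset.mem_filter.2 ⟨hi, not_lt.1 h1⟩)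
      have := mul_pos h1 (hηT i (hZI hi))
      nlinarith
  have hηη : η * η' = 1 ∨ η * η' = -1 := by
    rcases hη with rfl | rfl <;> rcases hη' with rfl | rfl <;> simp
  refine ⟨B.card, ?_, ?_⟩
  · have h1 : (m + 1) * r = T.card + r + m := by
      rw [hTc']
      obtain ⟨r, rfl⟩ := Nat.exists_eq_add_of_le hr
      simp only [Nat.add_sub_cancel_left]
      ring
    omega
  intro L d hL hd z hz s hs hd1 hd2
  have hzI : z ∉ ((↑) : ℝ → ℂ) '' S.I 0 := by
    rintro ⟨x, hx, rfl⟩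
    have := hz x hx
    simp at this
    linarith
  have hQz : aeval z (C a * nod Z) ≠ 0 := by
    rw [map_mul, aeval_C, aeval_nod, Complex.coe_algebraMap]
    refine mul_ne_zero (by exact_mod_cast ha) (Finset.prod_ne_zero_iff.2 fun y hy => ?_)
    exact sub_ne_of_notMem hzI (hZI hy)
  have hqc := quadrature_cauchy hI h0 huc hZI ex2 (G := C a * nod Z) (by
    rw [natDegree_C_mul ha, natDegree_nod]
    omega) hzI
  have hz0 : ∑ i ∈ Z, (((C a * nod Z).eval i * qw (S.μ 0) u Z i : ℝ) : ℂ) / (z - i) = 0 :=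
    Finset.sum_eq_zero fun i hi => by rw [hZ0 i hi]; simp
  rw [hz0, sub_zero] at hqc
  have herr : ε * ct (S.μ 0) u z - aeval z P / aeval z (C a * nod Z) =
      ε * (ct (S.μ 0) u z - ∑ i ∈ Z, (qw (S.μ 0) u Z i : ℂ) / (z - i)) := by
    have h1 := hrem z hzI
    rw [← hqc] at h1
    have h2 : aeval z P = aeval z (C a * nod Z) *
        (ε * ∑ i ∈ Z, (qw (S.μ 0) u Z i : ℂ) / (z - i)) := by
      linear_combination -h1
    rw [h2, mul_div_cancel_left₀ _ hQz]
    ring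
  have hε1 : ‖(ε : ℂ)‖ = 1 := by rcases hε with rfl | rfl <;> simp
  rw [herr, norm_mul, hε1, one_mul]
  exact quadrature_error (T := B) hI h0 huc hZI ex2 (Finset.filter_subset _ _) hηη hql hs
    (by omega) (by omega) hL hd hz

end

lemma rpow_eventually_le {κ : ℝ} (hκ : κ < 1) (a b : ℝ) :
    ∃ N₀ : ℕ, ∀ N : ℕ, N₀ ≤ N → a * (N : ℝ) ^ κ + b ≤ N := by
  have h1 : Tendsto (fun x : ℝ => a * x ^ (-(1 - κ))) atTop (𝓝 0) := by
    simpa using (tendsto_rpow_neg_atTop (by linarith : 0 < 1 - κ)).const_mul a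
  have h2 := (h1.comp tendsto_natCast_atTop_atTop).eventually
    (eventually_le_nhds (by norm_num : (0 : ℝ) < 1 / 2))
  have h3 := (tendsto_natCast_atTop_atTop (R := ℝ)).eventually (eventually_ge_atTop (2 * b))
  obtain ⟨N₀, h⟩ := eventually_atTop.1 ((h2.and h3).and (eventually_gt_atTop 0))
  refine ⟨N₀, fun N hN => ?_⟩
  obtain ⟨⟨h4, h5⟩, h6⟩ := h N hN
  have hN0 : (0 : ℝ) < N := by exact_mod_cast h6
  simp only [Function.comp_apply] at h4
  have h7 : (N : ℝ) ^ κ = (N : ℝ) ^ (-(1 - κ)) * N := by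
    conv_rhs => rw [← Real.rpow_add_one hN0.ne']
    congr 1
    ring
  rw [h7]
  nlinarith

lemma geometric_bound {ρ d L M E X : ℝ} (hρ : 0 < ρ) (hd : 0 < d) (hE : 0 ≤ E) {p q b j N : ℕ}
    (hL0 : 0 ≤ L) (hL : L / d ≤ ρ⁻¹ ^ p) (hM : 2 * M / d ≤ ρ⁻¹ ^ q) (hX : 1 ≤ ρ * X) (hρ1 : ρ < 1)
    (h : d ^ (2 * b) * X ^ j * E ≤ 2 * (L ^ (2 * b) * M) / d)
    (hj : q + 2 * b * p + N ≤ j) : E ≤ ρ ^ N := by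
  have hX' : ρ⁻¹ ≤ X := by rwa [inv_le_iff_one_le_mul₀' hρ]
  have hr1 : 1 ≤ ρ⁻¹ := (one_le_inv₀ hρ).2 hρ1.le
  have h1 : ρ⁻¹ ^ j * E ≤ (L / d) ^ (2 * b) * (2 * M / d) := by
    have h2 : d ^ (2 * b) * (ρ⁻¹ ^ j * E) ≤ 2 * (L ^ (2 * b) * M) / d := by
      refine le_trans ?_ h
      rw [← mul_assoc]
      gcongr
    rw [div_pow]
    refine le_of_mul_le_mul_left (h2.trans (le_of_eq ?_)) (by positivity : 0 < d ^ (2 * b))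
    field_simp
  have h3 : (L / d) ^ (2 * b) * (2 * M / d) ≤ ρ⁻¹ ^ (2 * b * p + q) := by
    rw [pow_add, mul_comm (2 * b) p, pow_mul ρ⁻¹ p]
    refine (mul_le_mul_of_nonneg_left hM (by positivity)).trans
      (mul_le_mul_of_nonneg_right ?_ (by positivity))
    exact pow_le_pow_left₀ (by positivity) hL _
  have h4 : ρ⁻¹ ^ (2 * b * p + q) * (ρ⁻¹ ^ N * E) ≤ ρ⁻¹ ^ (2 * b * p + q) * 1 := by
    rw [← mul_assoc, ← pow_add, mul_one]
    refine le_trans ?_ (h1.trans h3)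
    exact mul_le_mul_of_nonneg_right (pow_le_pow_right₀ hr1 (by omega)) hE
  have h5 := le_of_mul_le_mul_left h4 (by positivity)
  rw [inv_pow, inv_mul_le_iff₀ (by positivity), mul_one] at h5
  exact h5

lemma orth_of_isTypeII {m : ℕ} {σ : ℕ → SignedM} {S : Sys} {n : ℕ → ℕ} {Q : ℝ[X]}
    {P : ℕ → ℝ[X]} (h : IsTypeII σ m n Q P) {k : ℕ} (hk : k ≤ m) {ε : ℝ} (hε : ε = 1 ∨ ε = -1)
    (hc : ∀ z : ℂ, z ∉ ((↑) : ℝ → ℂ) '' S.I 0 →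
      (nikSys σ 0 k).cauchy z = ε * ct (S.μ 0) (S.uR k 0) z) :
    (∀ z : ℂ, z ∉ ((↑) : ℝ → ℂ) '' S.I 0 →
      aeval z Q * (ε * ct (S.μ 0) (S.uR k 0) z) - aeval z (P k) =
        ε * ct (S.μ 0) (fun x => Q.eval x * S.uR k 0 x) z) ∧
    ∀ p : ℝ[X], p.degree < n k → ∫ x, Q.eval x * p.eval x * S.uR k 0 x ∂S.μ 0 = 0 := by
  obtain ⟨C, R, hb⟩ := h.2.2 k hk
  have hw : ContinuousOn (fun x => ε * S.uR k 0 x) (S.I 0) :=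
    continuousOn_const.mul (S.uR_cont k 0)
  obtain ⟨h1, h2⟩ := orth_of_bound (S.isCompact_I 0) (S.compl_I 0) hw (Q := Q) (P := P k) (n := n k)
    (C := C) (R := R) fun z hz hR => by
      rw [ct_const_mul, ← hc z hz]
      exact hb z hR
  refine ⟨fun z hz => ?_, fun p hp => ?_⟩
  · rw [← ct_const_mul, h1 z hz, ← ct_const_mul]
    congr 1
    ext x
    ring
  · have h3 := h2 p hp
    have h4 : ∀ x, Q.eval x * p.eval x * (ε * S.uR k 0 x) =
        ε * (Q.eval x * p.eval x * S.uR k 0 x) := fun x => by ring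
    simp only [h4] at h3
    rw [integral_const_mul] at h3
    refine (mul_eq_zero.1 h3).resolve_left ?_
    rcases hε with rfl | rfl <;> norm_num

lemma exists_rate {m : ℕ} {σ : ℕ → SignedM} {Δ : ℕ → Set ℝ}
    (hσ : ∀ j ≤ m, IsM (σ j) (Δ j)) (hdisj : ∀ j, j + 1 ≤ m → Δ j ∩ Δ (j + 1) = ∅)
    {Λ : Set (ℕ → ℕ)} {c κ : ℝ} (hκ : κ < 1)
    (hΛ : ∀ n ∈ Λ, ∀ j ≤ m,
      ((∑ i ∈ Finset.range (m + 1), n i : ℕ) : ℝ) / (m + 1) -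
          c * ((∑ i ∈ Finset.range (m + 1), n i : ℕ) : ℝ) ^ κ ≤ (n j : ℝ))
    {Q : (ℕ → ℕ) → ℝ[X]} {P : (ℕ → ℕ) → ℕ → ℝ[X]}
    (hQP : ∀ n ∈ Λ, IsTypeII σ m n (Q n) (P n)) {k : ℕ} (hk : k ≤ m) {K : Set ℂ}
    (hK : IsCompact K) (hKΔ : K ⊆ (cSet (Δ 0))ᶜ) :
    ∃ δ : ℝ, 0 ≤ δ ∧ δ < 1 ∧ ∃ N₀ : ℕ, ∀ n ∈ Λ, N₀ ≤ ∑ i ∈ Finset.range (m + 1), n i → ∀ z ∈ K,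
      ‖(nikSys σ 0 k).cauchy z - aeval z (P n k) / aeval z (Q n)‖ ≤
        δ ^ (2 * ∑ i ∈ Finset.range (m + 1), n i) := by
  obtain ⟨S, hS⟩ := exists_sys hσ hdisj
  have hKI : K ⊆ (((↑) : ℝ → ℂ) '' S.I 0)ᶜ := by
    rw [(hS 0 (Nat.zero_le m)).1]
    exact hKΔ
  obtain ⟨ε, hε, hc⟩ := nikSys_cauchy hσ hS hk
  obtain ⟨ρ, hρ0, hρ1, hsep⟩ := exists_separating_compact hK hKI
  obtain ⟨d, hd, hdK⟩ := exists_dist_pos hK hKI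
  obtain ⟨L, hL0, hL⟩ : ∃ L : ℝ, 0 ≤ L ∧ ∀ x ∈ S.I 0, ∀ y ∈ S.I 0, |x - y| ≤ L :=
    ⟨Metric.diam (S.I 0), Metric.diam_nonneg, fun x hx y hy =>
      Metric.dist_le_diam_of_mem (S.isCompact_I 0).isBounded hx hy⟩
  have hr1 : 1 < ρ⁻¹ := (one_lt_inv₀ hρ0).2 hρ1
  set M := ∫ x, |S.uR k 0 x| ∂S.μ 0
  obtain ⟨p, hp⟩ := pow_unbounded_of_one_lt (L / d) hr1
  obtain ⟨q, hq⟩ := pow_unbounded_of_one_lt (2 * M / d) hr1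
  obtain ⟨N₁, hN₁⟩ := rpow_eventually_le hκ (16 * (p + 1) * ((m + 1) * c)) (16 * (p + 1) * m)
  obtain ⟨N₂, hN₂⟩ := rpow_eventually_le hκ ((m + 1) * c) 1
  refine ⟨ρ ^ (1 / 16 : ℝ), by positivity, Real.rpow_lt_one hρ0.le hρ1 (by norm_num),
    max (max N₁ N₂) (16 * (q + 1)), fun n hn hN z hz => ?_⟩
  set N := ∑ i ∈ Finset.range (m + 1), n i with hNdef
  have hNN₁ := hN₁ N (by omega)
  have hNN₂ := hN₂ N (by omega)
  have hm : (0 : ℝ) < m + 1 := by positivity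
  set t : ℝ := N / (m + 1) - c * (N : ℝ) ^ κ with ht
  have htm : (m + 1) * t = N - (m + 1) * c * (N : ℝ) ^ κ := by
    rw [ht]
    field_simp
  have htpos : 0 < t := by
    by_contra h
    have := mul_nonpos_of_nonneg_of_nonpos hm.le (not_lt.1 h)
    linarith
  set r := ⌈t⌉₊ with hr
  have hrt : t ≤ r := Nat.le_ceil t
  obtain ⟨b, hb, hest⟩ := approx_error (S := S) (m := m) (n := n) (P := P n k) (hQP n hn).1 hNdef
    (hQP n hn).2.1
    (fun k hk => by
      obtain ⟨ε', hε', hc'⟩ := nikSys_cauchy hσ hS hk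
      exact (orth_of_isTypeII (hQP n hn) hk hε' hc').2) hk hε
    (orth_of_isTypeII (hQP n hn) hk hε hc).1 (Nat.ceil_pos.2 htpos)
    (fun j hj => Nat.ceil_le.2 (hΛ n hn j hj))
  have hbN : 16 * (p + 1) * (2 * b) ≤ N := by
    have h1 : (2 * b + (m + 1) * r : ℝ) ≤ N + m := by exact_mod_cast hb
    have h2 : (m + 1) * t ≤ (m + 1) * (r : ℝ) := mul_le_mul_of_nonneg_left hrt hm.le
    have h3 : (2 * b : ℝ) ≤ (m + 1) * c * (N : ℝ) ^ κ + m := by linarith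
    have h4 : (16 * (p + 1) * (2 * b) : ℝ) ≤ N := by
      refine (mul_le_mul_of_nonneg_left h3 (by positivity)).trans (le_trans (le_of_eq ?_) hNN₁)
      ring
    exact_mod_cast h4
  have hbN' : 16 * (2 * b * p) + 16 * (2 * b) ≤ N := by
    refine le_trans (le_of_eq ?_) hbN
    ring
  obtain ⟨s, hs2, hs1, hsz⟩ := hsep z hz
  set j := (N - 2 * b) / 2 with hj
  have hE := hest hL hd z (hdK z hz) (s ^ j) (fun x hx => by
    rw [eval_pow, abs_pow]
    exact pow_le_one₀ (abs_nonneg _) (hs1 x hx)) (by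
    have := (natDegree_pow_le (p := s) (n := j)).trans (Nat.mul_le_mul_left j hs2)
    omega) (by omega)
  rw [map_pow, norm_pow, ← hc z (hKI hz)] at hE
  have hfin := geometric_bound (N := N / 8 + 1) hρ0 hd (norm_nonneg _) hL0 hp.le hq.le hsz hρ1 hE
    (by omega)
  refine hfin.trans ?_
  have hδ : ρ = (ρ ^ (1 / 16 : ℝ)) ^ 16 := by
    rw [← Real.rpow_natCast, ← Real.rpow_mul hρ0.le]
    norm_num
  conv_lhs => rw [hδ, ← pow_mul]
  exact pow_le_pow_of_le_one (by positivity) (Real.rpow_le_one hρ0.le hρ1.le (by norm_num))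
    (by omega)

end NikAux

/-- Corollary 1 (Markov-type theorem): under the stated condition on the multi-indices in
`Λ`, the type II approximants `P_{n,k}/Q_n` converge to `ŝ_{0,k}` uniformly on compact
subsets of `ℂ ∖ Co(supp σ₀)`, with geometric rate `δ_K < 1` in the `1/(2|n|)`-root sense. -/
theorem stmt10
    (m : ℕ)
    (σ : ℕ → SignedM) (Δ : ℕ → Set ℝ)
    (hσ : ∀ j ≤ m, IsM (σ j) (Δ j))
    (hdisj : ∀ j, j + 1 ≤ m → Δ j ∩ Δ (j + 1) = ∅)
    (Λ : Set (ℕ → ℕ)) (hΛinf : Λ.Infinite)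
    (hΛsupp : ∀ n ∈ Λ, ∀ j, m < j → n j = 0)
    (c κ : ℝ) (hc : 0 < c) (hκ : κ < 1)
    (hΛ : ∀ n ∈ Λ, ∀ j ≤ m,
      ((∑ i ∈ Finset.range (m + 1), n i : ℕ) : ℝ) / (m + 1) -
          c * ((∑ i ∈ Finset.range (m + 1), n i : ℕ) : ℝ) ^ κ ≤ (n j : ℝ))
    (Q : (ℕ → ℕ) → Polynomial ℝ) (P : (ℕ → ℕ) → ℕ → Polynomial ℝ)
    (hQP : ∀ n ∈ Λ, IsTypeII σ m n (Q n) (P n)) :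
    ∀ k ≤ m, ∀ K : Set ℂ, IsCompact K → K ⊆ (cSet (Δ 0))ᶜ →
      ((∀ ε : ℝ, 0 < ε → ∃ Nb : ℕ, ∀ n ∈ Λ,
          Nb ≤ ∑ i ∈ Finset.range (m + 1), n i → ∀ z ∈ K,
            ‖(nikSys σ 0 k).cauchy z - aeval z (P n k) / aeval z (Q n)‖ < ε) ∧
        ∃ δ : ℝ, 0 ≤ δ ∧ δ < 1 ∧ ∀ ε : ℝ, 0 < ε → ∃ Nb : ℕ, ∀ n ∈ Λ,
          Nb ≤ ∑ i ∈ Finset.range (m + 1), n i → ∀ z ∈ K,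
            ‖(nikSys σ 0 k).cauchy z - aeval z (P n k) / aeval z (Q n)‖ ≤
              (δ + ε) ^ (2 * ∑ i ∈ Finset.range (m + 1), n i)) := by
  intro k hk K hK hKΔ
  obtain ⟨δ, hδ0, hδ1, N₀, h⟩ := NikAux.exists_rate hσ hdisj hκ hΛ hQP hk hK hKΔ
  refine ⟨fun ε hε => ?_, δ, hδ0, hδ1, fun ε hε => ⟨N₀, fun n hn hN z hz =>
    (h n hn hN z hz).trans (pow_le_pow_left₀ hδ0 (by linarith) _)⟩⟩
  obtain ⟨N₁, hN₁⟩ := exists_pow_lt_of_lt_one hε hδ1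
  refine ⟨max N₀ N₁, fun n hn hN z hz => (h n hn (by omega) z hz).trans_lt (lt_of_le_of_lt ?_ hN₁)⟩
  exact pow_le_pow_of_le_one hδ0 hδ1.le (by omega)
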